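/- Let X be a smooth plane dendroid with initial point p. If E(X) is hereditarily disconnected, then no two points of E(X) \ {p} belong to the same quasicomponent of E(X); in particular, E(X) \ {p} is totally disconnected. -/

import Mathlib

open Set Filter Topology

/-- The Euclidean plane. -/
abbrev Plane := EuclideanSpace ℝ (Fin 2)

section Defs

variable {α : Type*} [TopologicalSpace α]

/-- `A` is an arc with endpoints `a` and `b`: a homeomorphic image of `[0,1]`
sending `0 ↦ a` and `1 ↦ b`. -/
def IsArcWithEndpoints (A : Set α) (a b : α) : Prop :=
  ∃ f : ℝ → α, ContinuousOn f (Set.Icc 0 1) ∧ Set.InjOn f (Set.Icc 0 1) ∧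
    f '' (Set.Icc 0 1) = A ∧ f 0 = a ∧ f 1 = b

/-- `A` is an arc. -/
def IsArc (A : Set α) : Prop := ∃ a b, IsArcWithEndpoints A a b

/-- Every two distinct points of `X` are joined by an arc inside `X`. -/
def ArcwiseConnected (X : Set α) : Prop :=
  ∀ x ∈ X, ∀ y ∈ X, x ≠ y → ∃ A, A ⊆ X ∧ IsArcWithEndpoints A x y

/-- Every two subcontinua of `X` have connected intersection. -/
def HereditarilyUnicoherent (X : Set α) : Prop :=
  ∀ K L : Set α, K ⊆ X → L ⊆ X → IsCompact K → IsConnected K →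
    IsCompact L → IsConnected L → IsPreconnected (K ∩ L)

/-- A dendroid: a hereditarily unicoherent, arcwise connected continuum. -/
def IsDendroid (X : Set α) : Prop :=
  IsCompact X ∧ IsConnected X ∧ HereditarilyUnicoherent X ∧ ArcwiseConnected X

/-- The set of endpoints of `X`: points that are endpoints of every arc in `X`
containing them. -/
def Endpoints (X : Set α) : Set α :=
  {e | e ∈ X ∧ ∀ A : Set α, A ⊆ X → IsArc A → e ∈ A → ∃ b, IsArcWithEndpoints A e b}

/-- `X` is Suslinian: every collection of pairwise-disjoint non-degenerate
subcontinua of `X` is countable. -/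
def IsSuslinian (X : Set α) : Prop :=
  ∀ S : Set (Set α), (∀ K ∈ S, K ⊆ X ∧ IsCompact K ∧ IsConnected K ∧ K.Nontrivial) →
    S.PairwiseDisjoint id → S.Countable

/-- The arc component of `x` inside the set `S`. -/
def arcComponentIn (S : Set α) (x : α) : Set α :=
  {y | y ∈ S ∧ (y = x ∨ ∃ A, A ⊆ S ∧ IsArcWithEndpoints A x y)}

/-- The collection of arc components of `X \ {x}`; its cardinality is the order of `x`. -/
def orderComponents (X : Set α) (x : α) : Set (Set α) :=
  {C | ∃ y ∈ X \ {x}, C = arcComponentIn (X \ {x}) y}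

/-- Ramification points of `X`: points of order at least 3. -/
def RamificationPoints (X : Set α) : Set α :=
  {x | x ∈ X ∧ 3 ≤ (orderComponents X x).encard}

/-- `A` is a clopen subset of the subspace `Y`. -/
def IsClopenIn (Y A : Set α) : Prop :=
  A ⊆ Y ∧ (∃ U, IsOpen U ∧ A = Y ∩ U) ∧ (∃ C, IsClosed C ∧ A = Y ∩ C)

/-- The quasicomponent of `x` in the subspace `Y`: the intersection of all
clopen subsets of `Y` containing `x`. -/
def quasicomponentIn (Y : Set α) (x : α) : Set α :=
  {y ∈ Y | ∀ A : Set α, IsClopenIn Y A → x ∈ A → y ∈ A}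

/-- `Y` is hereditarily disconnected: it contains no non-degenerate connected subset. -/
def HereditarilyDisconnected (Y : Set α) : Prop :=
  ∀ S : Set α, S ⊆ Y → IsPreconnected S → S.Subsingleton

end Defs

/-- The point `x` of `X` is (arcwise) accessible from `ℝ² \ X`. -/
def AccessiblePoint (X : Set Plane) (x : Plane) : Prop :=
  ∃ A : Set Plane, IsArc A ∧ A ∩ X = {x}

/-- `σ` separates the points `b` and `d` in the plane: no connected subset of the
complement of `σ` contains both. -/
def SeparatesPoints (σ : Set Plane) (b d : Plane) : Prop :=
  b ∉ σ ∧ d ∉ σ ∧ ∀ K : Set Plane, K ⊆ σᶜ → IsPreconnected K → b ∈ K → d ∉ K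

/-- A simple closed curve in the plane: the image of a period-1 parametrization
injective on `[0,1)`. -/
def IsSimpleClosedCurve (O : Set Plane) : Prop :=
  ∃ f : ℝ → Plane, Continuous f ∧ Function.Periodic f 1 ∧
    Set.InjOn f (Set.Ico 0 1) ∧ f '' (Set.Ico 0 1) = O

/-- The dendroid `X` is smooth at `p`: there is a choice `arcTo x` of the unique arc
from `x` to `p` (reduced to `{p}` for `x = p`) such that `xₙ → x` in `X` implies
`arcTo xₙ → arcTo x` in the Hausdorff distance. -/
def DendroidSmoothAt (X : Set Plane) (p : Plane) : Prop :=
  p ∈ X ∧ ∃ arcTo : Plane → Set Plane,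
    arcTo p = {p} ∧
    (∀ x ∈ X, x ≠ p → arcTo x ⊆ X ∧ IsArcWithEndpoints (arcTo x) x p) ∧
    (∀ (xs : ℕ → Plane) (x : Plane), (∀ n, xs n ∈ X) → x ∈ X →
      Filter.Tendsto xs Filter.atTop (nhds x) →
      Filter.Tendsto (fun n => EMetric.hausdorffEdist (arcTo (xs n)) (arcTo x))
        Filter.atTop (nhds 0))

/-- A space is zero-dimensional if it has a basis of clopen sets. -/
def IsZeroDimensionalSpace (β : Type*) [TopologicalSpace β] : Prop :=
  ∀ (x : β) (U : Set β), IsOpen U → x ∈ U → ∃ V : Set β, IsClopen V ∧ x ∈ V ∧ V ⊆ U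

/-- A space is almost zero-dimensional if it has a neighborhood basis of sets
which are intersections of clopen sets. -/
def IsAlmostZeroDimensionalSpace (β : Type*) [TopologicalSpace β] : Prop :=
  ∀ (x : β) (U : Set β), IsOpen U → x ∈ U →
    ∃ V : Set β, V ∈ nhds x ∧ V ⊆ U ∧
      ∃ 𝒞 : Set (Set β), (∀ C ∈ 𝒞, IsClopen C) ∧ V = ⋂₀ 𝒞

/-- The union of `W` with all of the bounded connected components of its complement. -/
def boundedComplementaryFill (W : Set Plane) : Set Plane :=
  W ∪ ⋃₀ {K | (∃ x ∈ Wᶜ, K = connectedComponentIn Wᶜ x) ∧ Bornology.IsBounded K}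

/-- A Bellamy dendroid: a (non-degenerate) smooth plane dendroid whose endpoint
set is connected. -/
def IsBellamyDendroid (K : Set Plane) : Prop :=
  IsDendroid K ∧ K.Nontrivial ∧ (∃ q, DendroidSmoothAt K q) ∧ IsConnected (Endpoints K)

/-- The middle-thirds Cantor set. -/
noncomputable def cantorC : Set ℝ :=
  {x | ∃ a : ℕ → Bool, x = ∑' i, (if a i then (2 : ℝ) else 0) / 3 ^ (i + 1)}

/-- A continuous logarithm of `f` on `K`. -/
def HasLog (K : Set ℂ) (f : ℂ → ℂ) : Prop :=
  ∃ l : ℂ → ℂ, ContinuousOn l K ∧ ∀ z ∈ K, Complex.exp (l z) = f z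

lemma eq_of_exp_eq_one {α : Type*} [TopologicalSpace α] {S : Set α} (hS : IsPreconnected S)
    {d : α → ℂ} (hd : ContinuousOn d S) (h1 : ∀ z ∈ S, Complex.exp (d z) = 1)
    {x y : α} (hx : x ∈ S) (hy : y ∈ S) : d x = d y := by
  have key : ∀ z ∈ S, ∃ n : ℤ, d z = n * (2 * Real.pi * Complex.I) := fun z hz =>
    Complex.exp_eq_one_iff.1 (h1 z hz)
  have hpi := Real.pi_pos
  have him : ∀ z ∈ S, ∃ n : ℤ, (d z).im / (2 * Real.pi) = n ∧
      d z = n * (2 * Real.pi * Complex.I) := by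
    intro z hz
    obtain ⟨n, hn⟩ := key z hz
    refine ⟨n, ?_, hn⟩
    rw [hn]
    have : ((n : ℂ) * (2 * Real.pi * Complex.I)).im = n * (2 * Real.pi) := by simp
    rw [this]; field_simp
  have hT : IsDiscrete (Set.range ((↑) : ℤ → ℝ)) := by
    have := Int.isClosedEmbedding_coe_real.isEmbedding
    exact this.isInducing.isDiscrete_range
  have hmap : MapsTo (fun z => (d z).im / (2 * Real.pi)) S (Set.range ((↑) : ℤ → ℝ)) := by
    intro z hz
    obtain ⟨n, hn, -⟩ := him z hz
    exact ⟨n, hn.symm⟩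
  have hcont : ContinuousOn (fun z => (d z).im / (2 * Real.pi)) S :=
    (Complex.continuous_im.comp_continuousOn hd).div_const _
  have := hS.constant_of_mapsTo hT hcont hmap hx hy
  obtain ⟨n, hn, hn'⟩ := him x hx
  obtain ⟨m, hm, hm'⟩ := him y hy
  have hnm : (n : ℝ) = m := by rw [← hn, ← hm]; exact this
  have : n = m := by exact_mod_cast hnm
  rw [hn', hm', this]

lemma log_sub_eq {α : Type*} [TopologicalSpace α] {S : Set α} (hS : IsPreconnected S)
    {k l : α → ℂ} (hk : ContinuousOn k S) (hl : ContinuousOn l S)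
    (h : ∀ z ∈ S, Complex.exp (k z) = Complex.exp (l z))
    {x y : α} (hx : x ∈ S) (hy : y ∈ S) : k x - l x = k y - l y :=
  eq_of_exp_eq_one hS (d := fun z => k z - l z) (hk.sub hl) (fun z hz => by
    rw [Complex.exp_sub, h z hz, div_self (Complex.exp_ne_zero _)]) hx hy

lemma exists_continuous_extension {K : Set ℂ} (hK : IsClosed K) {l : ℂ → ℂ}
    (hl : ContinuousOn l K) : ∃ m : ℂ → ℂ, Continuous m ∧ ∀ z ∈ K, m z = l z := by
  obtain ⟨m, hm⟩ := ContinuousMap.exists_restrict_eq hK ⟨_, hl.domRestrict⟩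
  exact ⟨m, m.continuous, fun z hz => congrArg (fun q : C(K, ℂ) => q ⟨z, hz⟩) hm⟩

namespace HasLog

variable {K L : Set ℂ} {f g : ℂ → ℂ}

lemma mono (h : HasLog K f) (hL : L ⊆ K) : HasLog L f := by
  obtain ⟨l, hl, he⟩ := h
  exact ⟨l, hl.mono hL, fun z hz => he z (hL hz)⟩

lemma congr (h : HasLog K f) (hg : ∀ z ∈ K, g z = f z) : HasLog K g := by
  obtain ⟨l, hl, he⟩ := h
  exact ⟨l, hl, fun z hz => (he z hz).trans (hg z hz).symm⟩

lemma mul (hf : HasLog K f) (hg : HasLog K g) : HasLog K (fun z => f z * g z) := by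
  obtain ⟨l, hl, he⟩ := hf
  obtain ⟨l', hl', he'⟩ := hg
  exact ⟨fun z => l z + l' z, hl.add hl', fun z hz => by
    rw [Complex.exp_add, he z hz, he' z hz]⟩

lemma inv (hf : HasLog K f) : HasLog K (fun z => (f z)⁻¹) := by
  obtain ⟨l, hl, he⟩ := hf
  exact ⟨fun z => -l z, hl.neg, fun z hz => by rw [Complex.exp_neg, he z hz]⟩

lemma div (hf : HasLog K f) (hg : HasLog K g) : HasLog K (fun z => f z / g z) := by
  simpa only [div_eq_mul_inv] using hf.mul hg.inv

lemma of_slitPlane (hf : ContinuousOn f K) (h : ∀ z ∈ K, f z ∈ Complex.slitPlane) :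
    HasLog K f :=
  ⟨fun z => Complex.log (f z), hf.clog h, fun z hz =>
    Complex.exp_log (Complex.slitPlane_ne_zero (h z hz))⟩

lemma const {c : ℂ} (hc : c ≠ 0) : HasLog K (fun _ => c) :=
  ⟨fun _ => Complex.log c, continuousOn_const, fun _ _ => Complex.exp_log hc⟩

lemma glue (hK : IsClosed K) (hL : IsClosed L) {k l : ℂ → ℂ} (hk : ContinuousOn k K)
    (hek : ∀ z ∈ K, Complex.exp (k z) = f z) (hl : ContinuousOn l L)
    (hel : ∀ z ∈ L, Complex.exp (l z) = f z)
    (h : ∀ x ∈ K ∩ L, ∀ y ∈ K ∩ L, k x - l x = k y - l y) : HasLog (K ∪ L) f := by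
  classical
  obtain ⟨c, hc1, hc⟩ : ∃ c : ℂ, Complex.exp c = 1 ∧ ∀ z ∈ K ∩ L, k z = l z + c := by
    rcases (K ∩ L).eq_empty_or_nonempty with h0 | ⟨x, hx⟩
    · exact ⟨0, by simp, by simp [h0]⟩
    · refine ⟨k x - l x, ?_, fun z hz => ?_⟩
      · rw [Complex.exp_sub, hek x hx.1, ← hel x hx.2, div_self (Complex.exp_ne_zero _)]
      · rw [h x hx z hz]; ring
  refine ⟨fun z => if z ∈ K then k z else l z + c, ?_, ?_⟩
  · refine ContinuousOn.union_of_isClosed ?_ ?_ hK hL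
    · exact hk.congr fun z hz => by simp [hz]
    · refine (hl.add continuousOn_const : ContinuousOn (fun z => l z + c) L).congr fun z hz => ?_
      by_cases h : z ∈ K
      · simp [h, hc z ⟨h, hz⟩]
      · simp [h]
  · intro z hz
    by_cases h : z ∈ K
    · simp [h, hek z h]
    · have hz' : z ∈ L := hz.resolve_left h
      simp [h, Complex.exp_add, hc1, hel z hz']

/-- Logarithms on two closed sets with connected intersection can be glued. -/
lemma union (hK : IsClosed K) (hL : IsClosed L) (hKL : IsPreconnected (K ∩ L))
    (hfK : HasLog K f) (hfL : HasLog L f) : HasLog (K ∪ L) f := by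
  obtain ⟨k, hk, hek⟩ := hfK
  obtain ⟨l, hl, hel⟩ := hfL
  exact glue hK hL hk hek hl hel fun x hx y hy =>
    log_sub_eq hKL (hk.mono inter_subset_left) (hl.mono inter_subset_right)
      (fun z hz => by rw [hek z hz.1, hel z hz.2]) hx hy

/-- A logarithm on a compact set extends to a neighbourhood. -/
lemma exists_thickening (hK : IsCompact K) (hf : Continuous f) (h : HasLog K f) :
    ∃ η > 0, HasLog (Metric.thickening η K) f := by
  obtain ⟨l, hl, he⟩ := h
  obtain ⟨m, hmc, hmK⟩ := exists_continuous_extension hK.isClosed hl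
  have hg : Continuous fun z => f z * Complex.exp (-m z) := by fun_prop
  obtain ⟨η, hη, hs⟩ := hK.exists_thickening_subset_open
    (Complex.isOpen_slitPlane.preimage hg) (fun z hz => by
      have : f z * Complex.exp (-m z) = 1 := by
        rw [hmK z hz, ← he z hz, ← Complex.exp_add]; simp
      simp [this])
  refine ⟨η, hη, ?_⟩
  have h1 : HasLog (Metric.thickening η K) fun z => f z * Complex.exp (-m z) :=
    of_slitPlane hg.continuousOn hs
  have h2 : HasLog (Metric.thickening η K) fun z => Complex.exp (m z) :=
    ⟨m, hmc.continuousOn, fun _ _ => rfl⟩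
  refine (h1.mul h2).congr fun z _ => ?_
  rw [mul_assoc, ← Complex.exp_add]; simp

lemma div_sub_of_near {a b : ℂ} (h : ∀ z ∈ K, dist a b < dist z b) :
    HasLog K (fun z => (z - a) / (z - b)) := by
  have hne : ∀ z ∈ K, z - b ≠ 0 := fun z hz h0 => by
    have := h z hz
    rw [dist_eq_norm z b, h0, norm_zero] at this
    exact absurd this (not_lt.2 dist_nonneg)
  refine of_slitPlane (ContinuousOn.div (by fun_prop) (by fun_prop) hne) fun z hz => ?_
  have h0 := hne z hz
  have : (z - a) / (z - b) = 1 + (b - a) / (z - b) := by field_simp; ring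
  rw [this]
  apply Complex.mem_slitPlane_of_norm_lt_one
  rw [norm_div, div_lt_one (norm_pos_iff.2 h0), ← dist_eq_norm, ← dist_eq_norm, dist_comm b a]
  exact h z hz

lemma sub_of_large {a : ℂ} (h : ∀ z ∈ K, ‖z‖ < ‖a‖) : HasLog K (fun z => z - a) := by
  rcases K.eq_empty_or_nonempty with rfl | ⟨x, hx⟩
  · exact ⟨0, by simp, by simp⟩
  have ha : a ≠ 0 := by
    rintro rfl
    exact absurd (h x hx) (by simp)
  have h1 : HasLog K (fun z => 1 + -z / a) := by
    refine of_slitPlane (by fun_prop) fun z hz => ?_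
    apply Complex.mem_slitPlane_of_norm_lt_one
    rw [norm_div, norm_neg, div_lt_one (norm_pos_iff.2 ha)]
    exact h z hz
  refine (h1.mul (const (neg_ne_zero.2 ha))).congr fun z _ => ?_
  field_simp; ring

/-- Points in a connected set missing `K` are not separated by `K`. -/
lemma of_isPreconnected (hK : IsCompact K) {S : Set ℂ} (hS : IsPreconnected S)
    (hd : Disjoint K S) {a b : ℂ} (ha : a ∈ S) (hb : b ∈ S) :
    HasLog K (fun z => (z - a) / (z - b)) := by
  have hne : ∀ x ∈ S, ∀ z ∈ K, z - x ≠ 0 := fun x hx z hz h0 =>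
    disjoint_left.1 hd hz (by rwa [sub_eq_zero.1 h0])
  refine hS.induction₂ (fun a b => HasLog K (fun z => (z - a) / (z - b))) ?_ ?_ ?_ ha hb
  · intro x hx
    have hxK : x ∉ K := fun h => disjoint_left.1 hd h hx
    obtain ⟨r, hr, hball⟩ := Metric.isOpen_iff.1 hK.isClosed.isOpen_compl x hxK
    filter_upwards [mem_nhdsWithin_of_mem_nhds (Metric.ball_mem_nhds x (half_pos hr))] with y hy
    refine div_sub_of_near fun z hz => ?_
    have h1 : r ≤ dist z x := not_lt.1 fun h => hball h hz
    have h2 : dist z x ≤ dist z y + dist y x := dist_triangle _ _ _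
    rw [Metric.mem_ball] at hy
    rw [dist_comm x y]
    linarith
  · intro x y z hx hy hz h1 h2
    refine (h1.mul h2).congr fun w hw => ?_
    have := hne y hy w hw
    have := hne z hz w hw
    field_simp
  · intro x y hx hy h1
    refine h1.inv.congr fun w hw => ?_
    rw [inv_div]

lemma uniform_thickening (hK : IsCompact K) (h : ∀ t ∉ K, HasLog K (fun z => z - t))
    {ε : ℝ} (hε : 0 < ε) : ∃ η > 0, ∀ t ∉ Metric.thickening ε K,
      HasLog (Metric.thickening η K) (fun z => z - t) := by
  obtain ⟨R, hR⟩ := hK.isBounded.subset_ball 0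
  have hcpt : IsCompact (Metric.closedBall (0 : ℂ) (R + ε) \ Metric.thickening ε K) :=
    (isCompact_closedBall _ _).diff Metric.isOpen_thickening
  have main : ∃ η > 0, ∀ t ∈ Metric.closedBall (0 : ℂ) (R + ε) \ Metric.thickening ε K,
      HasLog (Metric.thickening η K) (fun z => z - t) := by
    refine hcpt.induction_on (p := fun s => ∃ η > 0, ∀ t ∈ s,
      HasLog (Metric.thickening η K) (fun z => z - t)) ⟨1, one_pos, by simp⟩ ?_ ?_ ?_
    · rintro s t hst ⟨η, hη, h⟩
      exact ⟨η, hη, fun x hx => h x (hst hx)⟩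
    · rintro s t ⟨η, hη, h⟩ ⟨η', hη', h'⟩
      refine ⟨min η η', lt_min hη hη', ?_⟩
      rintro x (hx | hx)
      · exact (h x hx).mono (Metric.thickening_mono (min_le_left _ _) _)
      · exact (h' x hx).mono (Metric.thickening_mono (min_le_right _ _) _)
    · intro t ht
      have htK : t ∉ K := fun hh => ht.2 (Metric.self_subset_thickening hε _ hh)
      obtain ⟨η, hη, hl⟩ := (h t htK).exists_thickening hK (by fun_prop)
      refine ⟨Metric.ball t (ε / 4), mem_nhdsWithin_of_mem_nhds
        (Metric.ball_mem_nhds t (by positivity)), min η (ε / 2), by positivity, ?_⟩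
      intro s hs
      have h1 := hl.mono (Metric.thickening_mono (min_le_left η (ε / 2)) K)
      have hfar : ∀ z ∈ Metric.thickening (min η (ε / 2)) K, ε / 2 < dist z t := by
        intro z hz
        obtain ⟨k, hk, hzk⟩ := Metric.mem_thickening_iff.1 hz
        have : ε ≤ dist t k := not_lt.1 fun hlt =>
          ht.2 (Metric.mem_thickening_iff.2 ⟨k, hk, hlt⟩)
        have h3 := dist_triangle t z k
        have h4 := min_le_right η (ε / 2)
        rw [dist_comm t z] at h3
        linarith
      have h2 : HasLog (Metric.thickening (min η (ε / 2)) K) (fun z => (z - s) / (z - t)) := by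
        refine div_sub_of_near fun z hz => ?_
        have := hfar z hz
        rw [Metric.mem_ball] at hs
        linarith
      refine (h2.mul h1).congr fun z hz => ?_
      have : z - t ≠ 0 := by
        have := hfar z hz
        rw [dist_eq_norm] at this
        exact norm_pos_iff.1 (by linarith)
      field_simp
  obtain ⟨η, hη, hm⟩ := main
  refine ⟨min η ε, by positivity, fun t ht => ?_⟩
  by_cases hb : t ∈ Metric.closedBall (0 : ℂ) (R + ε)
  · exact (hm t ⟨hb, ht⟩).mono (Metric.thickening_mono (min_le_left _ _) _)
  · refine sub_of_large fun z hz => ?_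
    obtain ⟨k, hk, hzk⟩ := Metric.mem_thickening_iff.1 hz
    have h1 := hR hk
    simp only [Metric.mem_closedBall, Metric.mem_ball, dist_zero_right, not_le] at hb h1
    have h2 : ‖z‖ ≤ ‖k‖ + dist z k := by
      rw [dist_eq_norm]
      simpa using norm_add_le k (z - k)
    have := min_le_right η ε
    linarith

end HasLog

lemma not_log_circle (a : ℂ) {R : ℝ} (hR : 0 < R) {l : ℂ → ℂ}
    (hl : ContinuousOn l (Metric.sphere a R))
    (h : ∀ z ∈ Metric.sphere a R, Complex.exp (l z) = z - a) : False := by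
  have hm : ∀ θ : ℝ, circleMap a R θ ∈ Metric.sphere a R := circleMap_mem_sphere a hR.le
  have hc : Continuous fun θ : ℝ => l (circleMap a R θ) :=
    hl.comp_continuous (continuous_circleMap a R) hm
  have hc2 : Continuous fun θ : ℝ => (θ : ℂ) * Complex.I + Complex.log R := by fun_prop
  have hRC : (R : ℂ) ≠ 0 := by exact_mod_cast hR.ne'
  have := log_sub_eq isPreconnected_univ hc.continuousOn hc2.continuousOn (fun θ _ => by
    rw [h _ (hm θ), Complex.exp_add, Complex.exp_log hRC, circleMap]; ring)
    (mem_univ (0 : ℝ)) (mem_univ (2 * Real.pi))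
  have e : circleMap a R (2 * Real.pi) = circleMap a R 0 := by
    simp [circleMap, Complex.exp_two_pi_mul_I]
  rw [e] at this
  have h2 : (2 * Real.pi : ℂ) * Complex.I = 0 := by
    have h3 := sub_right_inj.1 this
    push_cast at h3
    simpa using h3.symm
  simp [Real.pi_ne_zero] at h2

lemma exists_global_log {g : ℂ → ℂ} (hg : Continuous g) (h0 : ∀ z, g z ≠ 0) :
    ∃ l : ℂ → ℂ, Continuous l ∧ ∀ z, Complex.exp (l z) = g z := by
  have hs : IsSimplyConnected (univ : Set ℂ) := by
    have := (Homeomorph.Set.univ ℂ).contractibleSpace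
    exact (inferInstance : SimplyConnectedSpace (univ : Set ℂ))
  obtain ⟨l, hl, he⟩ := Complex.exists_continuousOn_eqOn_exp_comp hs isOpen_univ hg.continuousOn
    (by rintro ⟨z, -, hz⟩; exact h0 z hz)
  exact ⟨l, continuousOn_univ.1 hl, fun z => he (mem_univ z)⟩

/-- A bounded open set whose frontier lies in `K` obstructs logarithms on `K`. -/
lemma not_hasLog_of_frontier {K Q : Set ℂ} (hK : IsCompact K) (hQ : IsOpen Q)
    (hb : Bornology.IsBounded Q) (hfr : frontier Q ⊆ K) {a : ℂ} (ha : a ∈ Q) {h : ℂ → ℂ}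
    (hc : ContinuousOn h (closure Q)) (hne : ∀ z ∈ closure Q, h z ≠ 0) :
    ¬ HasLog K (fun z => (z - a) / h z) := by
  classical
  rintro ⟨l, hl, he⟩
  obtain ⟨m, hmc, hmK⟩ := exists_continuous_extension hK.isClosed hl
  set g : ℂ → ℂ := fun z => if z ∈ Q then Complex.exp (m z) * h z else z - a with hg
  have hgc : ∀ z ∈ closure Q, g z = Complex.exp (m z) * h z := by
    intro z hz
    by_cases hzQ : z ∈ Q
    · simp [hg, hzQ]
    · have hzf : z ∈ K := hfr (by rw [hQ.frontier_eq]; exact ⟨hz, hzQ⟩)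
      have := hne z hz
      simp only [hg, hzQ, if_false, hmK z hzf, he z hzf]
      field_simp
  have hcont : Continuous g := by
    have hun : closure Q ∪ Qᶜ = univ := by
      refine eq_univ_of_univ_subset ?_
      rw [← union_compl_self Q]
      exact union_subset_union_left _ subset_closure
    rw [← continuousOn_univ, ← hun]
    refine ContinuousOn.union_of_isClosed ?_ ?_ isClosed_closure hQ.isClosed_compl
    · refine ContinuousOn.congr ?_ hgc
      exact (Complex.continuous_exp.comp hmc).continuousOn.mul hc
    · refine ContinuousOn.congr (f := fun z => z - a) (by fun_prop) fun z hz => ?_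
      have : z ∉ Q := hz
      simp [hg, this]
  have hg0 : ∀ z, g z ≠ 0 := by
    intro z
    by_cases hz : z ∈ Q
    · rw [hgc z (subset_closure hz)]
      exact mul_ne_zero (Complex.exp_ne_zero _) (hne z (subset_closure hz))
    · simp only [hg, hz, if_false]
      exact fun h0 => hz (by rwa [sub_eq_zero.1 h0])
  obtain ⟨L, hL, hLe⟩ := exists_global_log hcont hg0
  obtain ⟨R, hR⟩ := hb.subset_ball a
  have hR0 : 0 < R := Metric.pos_of_mem_ball (hR ha)
  refine not_log_circle a hR0 hL.continuousOn fun z hz => ?_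
  have hzQ : z ∉ Q := fun hz' => (Metric.mem_ball.1 (hR hz')).ne (Metric.mem_sphere.1 hz)
  rw [hLe]; simp [hg, hzQ]

lemma frontier_connectedComponentIn_subset {U : Set ℂ} (hU : IsOpen U) (x : ℂ) :
    frontier (connectedComponentIn U x) ⊆ Uᶜ := by
  intro z hz hzU
  have hopen : IsOpen (connectedComponentIn U x) := hU.connectedComponentIn
  rw [hopen.frontier_eq] at hz
  have h1 : connectedComponentIn U z ∈ 𝓝 z :=
    (hU.connectedComponentIn).mem_nhds (mem_connectedComponentIn hzU)
  obtain ⟨y, hy1, hy2⟩ := mem_closure_iff_nhds.1 hz.1 _ h1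
  have e1 := connectedComponentIn_eq hy1
  have e2 := connectedComponentIn_eq hy2
  exact hz.2 (by rw [e2, ← e1]; exact mem_connectedComponentIn hzU)

lemma isPreconnected_compl_closedBall (c : ℂ) {r : ℝ} (hr : 0 ≤ r) :
    IsPreconnected ((Metric.closedBall c r)ᶜ) := by
  have key : (Metric.closedBall c r)ᶜ =
      (fun q : ℝ × ℝ => circleMap c q.1 q.2) '' (Ioi r ×ˢ univ) := by
    ext z
    constructor
    · intro hz
      have hz' : r < dist z c := by simpa using hz
      have h1 : z ∈ range (circleMap c (dist z c)) := by
        rw [range_circleMap, abs_of_nonneg dist_nonneg]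
        exact Metric.mem_sphere.2 rfl
      obtain ⟨θ, hθ⟩ := h1
      exact ⟨(dist z c, θ), ⟨hz', mem_univ _⟩, hθ⟩
    · rintro ⟨⟨s, θ⟩, ⟨hs, -⟩, rfl⟩
      have hs' : r < s := hs
      have := circleMap_mem_sphere c (hr.trans hs'.le) θ
      rw [Metric.mem_sphere] at this
      simp only [mem_compl_iff, Metric.mem_closedBall, this, not_le]
      exact hs'
  rw [key]
  refine (isPreconnected_Ioi.prod isPreconnected_univ).image _ ?_
  unfold circleMap
  fun_prop

lemma mem_component_of_not_isBounded {K : Set ℂ} (hK : IsCompact K) {a b : ℂ} (hb : b ∉ K)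
    (h1 : ¬ Bornology.IsBounded (connectedComponentIn Kᶜ a))
    (h2 : ¬ Bornology.IsBounded (connectedComponentIn Kᶜ b)) :
    b ∈ connectedComponentIn Kᶜ a := by
  obtain ⟨R₀, hR₀⟩ := hK.isBounded.subset_closedBall 0
  set R := max R₀ 0
  have hR := hR₀.trans (Metric.closedBall_subset_closedBall (le_max_left R₀ 0))
  have hext : (Metric.closedBall (0 : ℂ) R)ᶜ ⊆ Kᶜ := compl_subset_compl.2 hR
  have hmeet : ∀ x, ¬ Bornology.IsBounded (connectedComponentIn Kᶜ x) →
      ∃ y ∈ (Metric.closedBall (0 : ℂ) R)ᶜ, y ∈ connectedComponentIn Kᶜ x := by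
    intro x hx
    by_contra hcon
    push Not at hcon
    exact hx (Metric.isBounded_closedBall.subset fun y hy => by
      by_contra hy'
      exact hcon y hy' hy)
  obtain ⟨y, hy, hya⟩ := hmeet a h1
  obtain ⟨y', hy', hyb⟩ := hmeet b h2
  have h4 := (isPreconnected_compl_closedBall (0 : ℂ) (le_max_right R₀ 0))
    |>.subset_connectedComponentIn hy hext hy'
  rw [connectedComponentIn_eq hya, connectedComponentIn_eq h4, ← connectedComponentIn_eq hyb]
  exact mem_connectedComponentIn hb

lemma mem_component_of_hasLog {K : Set ℂ} (hK : IsCompact K) {a b : ℂ} (ha : a ∉ K) (hb : b ∉ K)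
    (h : HasLog K (fun z => (z - a) / (z - b))) : b ∈ connectedComponentIn Kᶜ a := by
  have hKo : IsOpen Kᶜ := hK.isClosed.isOpen_compl
  have key : ∀ a b, a ∉ K → b ∉ K → HasLog K (fun z => (z - a) / (z - b)) →
      Bornology.IsBounded (connectedComponentIn Kᶜ a) → b ∈ connectedComponentIn Kᶜ a := by
    intro a b ha hb h hbd
    by_contra hcon
    have hfr : frontier (connectedComponentIn Kᶜ a) ⊆ K := by
      simpa using frontier_connectedComponentIn_subset hKo a
    refine not_hasLog_of_frontier hK hKo.connectedComponentIn hbd hfr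
      (mem_connectedComponentIn ha) (h := fun z => z - b) (by fun_prop) ?_ h
    intro z hz h0
    rw [sub_eq_zero] at h0
    subst h0
    rw [closure_eq_self_union_frontier] at hz
    rcases hz with hz | hz
    · exact hcon hz
    · exact hb (hfr hz)
  by_cases h1 : Bornology.IsBounded (connectedComponentIn Kᶜ a)
  · exact key a b ha hb h h1
  by_cases h2 : Bornology.IsBounded (connectedComponentIn Kᶜ b)
  · have h3 := key b a hb ha (h.inv.congr fun z _ => by rw [inv_div]) h2
    rw [← connectedComponentIn_eq h3]
    exact mem_connectedComponentIn hb
  exact mem_component_of_not_isBounded hK hb h1 h2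

lemma not_hasLog_of_bounded_component {K : Set ℂ} (hK : IsCompact K) {a : ℂ} (ha : a ∉ K)
    (hb : Bornology.IsBounded (connectedComponentIn Kᶜ a)) : ¬ HasLog K (fun z => z - a) := by
  have hKo : IsOpen Kᶜ := hK.isClosed.isOpen_compl
  intro h
  refine not_hasLog_of_frontier hK hKo.connectedComponentIn hb
    (by simpa using frontier_connectedComponentIn_subset hKo a)
    (mem_connectedComponentIn ha) (h := fun _ => 1) continuousOn_const (by simp) ?_
  simpa using h

/-- A compact plane set `X` with a root `p`, a continuous choice of arcs `A x` from `x` to `p`, and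
a hereditarily disconnected set `E` of ends. -/
structure RootedArcs (X E : Set ℂ) (p : ℂ) (A : ℂ → Set ℂ) : Prop where
  isCompact : IsCompact X
  root_mem : p ∈ X
  arc_subset : ∀ x ∈ X, A x ⊆ X
  arc_isCompact : ∀ x ∈ X, IsCompact (A x)
  arc_isPreconnected : ∀ x ∈ X, IsPreconnected (A x)
  self_mem_arc : ∀ x ∈ X, x ∈ A x
  root_mem_arc : ∀ x ∈ X, p ∈ A x
  upper : ∀ x ∈ X, ∀ ε > 0, ∀ᶠ y in 𝓝[X] x, A y ⊆ Metric.thickening ε (A x)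
  lower : ∀ x ∈ X, ∀ ε > 0, ∀ᶠ y in 𝓝[X] x, A x ⊆ Metric.thickening ε (A y)
  arc_hasLog : ∀ x ∈ X, ∀ a ∉ A x, HasLog (A x) (fun z => z - a)
  inter_isPreconnected : ∀ x ∈ X, ∀ y ∈ X, IsPreconnected (A x ∩ A y)
  arc_trans : ∀ x ∈ X, ∀ y ∈ A x, A y ⊆ A x
  arc_antisymm : ∀ x ∈ X, ∀ y ∈ A x, x ∈ A y → x = y
  ends_subset : E ⊆ X
  eq_of_end_mem : ∀ e ∈ E, ∀ x ∈ X, e ∈ A x → e = x ∨ e = p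
  join : ∀ x ∈ X \ E, ∀ y ∈ X \ E, ∃ B, IsCompact B ∧ IsPreconnected B ∧ x ∈ B ∧ y ∈ B ∧
    B ⊆ A x ∪ A y ∧ Disjoint B E
  ends_hd : ∀ S ⊆ E, IsPreconnected S → S.Subsingleton

namespace RootedArcs

variable {X E : Set ℂ} {p : ℂ} {A : ℂ → Set ℂ}

lemma union_arc_isPreconnected (h : RootedArcs X E p A) {x y : ℂ} (hx : x ∈ X) (hy : y ∈ X) :
    IsPreconnected (A x ∪ A y) :=
  (h.arc_isPreconnected x hx).union p (h.root_mem_arc x hx) (h.root_mem_arc y hy)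
    (h.arc_isPreconnected y hy)

lemma union_arc_hasLog (h : RootedArcs X E p A) {x y a : ℂ} (hx : x ∈ X) (hy : y ∈ X)
    (ha : a ∉ A x ∪ A y) : HasLog (A x ∪ A y) (fun z => z - a) :=
  HasLog.union (h.arc_isCompact x hx).isClosed (h.arc_isCompact y hy).isClosed
    (h.inter_isPreconnected x hx y hy) (h.arc_hasLog x hx a fun h' => ha (Or.inl h'))
    (h.arc_hasLog y hy a fun h' => ha (Or.inr h'))

lemma isPreconnected (h : RootedArcs X E p A) : IsPreconnected X :=
  isPreconnected_of_forall p fun y hy =>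
    ⟨A y, h.arc_subset y hy, h.root_mem_arc y hy, h.self_mem_arc y hy, h.arc_isPreconnected y hy⟩

lemma hasLog (h : RootedArcs X E p A) {a : ℂ} (ha : a ∉ X) : HasLog X (fun z => z - a) := by
  have hp0 : p - a ≠ 0 := fun h0 => ha (by rw [← sub_eq_zero.1 h0]; exact h.root_mem)
  set c := Complex.log (p - a)
  have hc : Complex.exp c = p - a := Complex.exp_log hp0
  have norm : ∀ K : Set ℂ, p ∈ K → HasLog K (fun z => z - a) →
      ∃ l : ℂ → ℂ, ContinuousOn l K ∧ (∀ z ∈ K, Complex.exp (l z) = z - a) ∧ l p = c := by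
    rintro K hpK ⟨l, hl, he⟩
    refine ⟨fun z => l z + (c - l p), hl.add continuousOn_const, fun z hz => ?_, by ring⟩
    rw [Complex.exp_add, Complex.exp_sub, hc, he z hz, he p hpK, div_self hp0, mul_one]
  have hex : ∀ x, ∃ l : ℂ → ℂ, x ∈ X → ContinuousOn l (A x) ∧
      (∀ z ∈ A x, Complex.exp (l z) = z - a) ∧ l p = c := by
    intro x
    by_cases hx : x ∈ X
    · obtain ⟨l, hl⟩ := norm (A x) (h.root_mem_arc x hx)
        (h.arc_hasLog x hx a fun h' => ha (h.arc_subset x hx h'))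
      exact ⟨l, fun _ => hl⟩
    · exact ⟨0, fun h' => absurd h' hx⟩
  choose l hl using hex
  refine ⟨fun x => l x x, ?_, fun x hx => (hl x hx).2.1 x (h.self_mem_arc x hx)⟩
  intro x hx
  obtain ⟨η, hη, hlog⟩ := (h.arc_hasLog x hx a fun h' =>
    ha (h.arc_subset x hx h')).exists_thickening (h.arc_isCompact x hx) (by fun_prop)
  have hsub := Metric.self_subset_thickening hη (A x)
  obtain ⟨m, hm, hme, hmp⟩ := norm _ (hsub (h.root_mem_arc x hx)) hlog
  have heq : ∀ y ∈ X, A y ⊆ Metric.thickening η (A x) → l y y = m y := by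
    intro y hy hyA
    obtain ⟨h1, h2, h3⟩ := hl y hy
    have := log_sub_eq (h.arc_isPreconnected y hy) h1 (hm.mono hyA)
      (fun z hz => by rw [h2 z hz, hme z (hyA hz)]) (h.self_mem_arc y hy) (h.root_mem_arc y hy)
    rw [h3, hmp, sub_self] at this
    exact sub_eq_zero.1 this
  have hcm : ContinuousWithinAt m X x :=
    (hm.continuousAt (Metric.isOpen_thickening.mem_nhds
      (hsub (h.self_mem_arc x hx)))).continuousWithinAt
  refine hcm.congr_of_eventuallyEq ?_ (heq x hx hsub)
  filter_upwards [h.upper x hx η hη, self_mem_nhdsWithin] with y hy hyX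
  exact heq y hyX hy

lemma exists_arc_subset_thickening (h : RootedArcs X E p A) {ε : ℝ} (hε : 0 < ε) :
    ∃ δ > 0, ∀ a ∈ X, ∀ v ∈ X, v ∈ Metric.thickening δ (A a) →
      A v ⊆ Metric.thickening ε (A a) := by
  by_contra hcon
  push Not at hcon
  have hpos : ∀ n : ℕ, (0 : ℝ) < 1 / (n + 1) := fun n => by positivity
  choose a ha v hv hav hnot using fun n : ℕ => hcon (1 / (n + 1)) (hpos n)
  obtain ⟨⟨a₀, v₀⟩, ⟨ha₀, hv₀⟩, φ, hφ, hlim⟩ :=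
    (h.isCompact.prod h.isCompact).tendsto_subseq (x := fun n => (a n, v n))
      fun n => ⟨ha n, hv n⟩
  have hla : Tendsto (fun n => a (φ n)) atTop (𝓝[X] a₀) :=
    tendsto_nhdsWithin_iff.2 ⟨(continuous_fst.tendsto _).comp hlim,
      Eventually.of_forall fun n => ha _⟩
  have hlv : Tendsto (fun n => v (φ n)) atTop (𝓝[X] v₀) :=
    tendsto_nhdsWithin_iff.2 ⟨(continuous_snd.tendsto _).comp hlim,
      Eventually.of_forall fun n => hv _⟩
  have hzero : Tendsto (fun n => (1 : ℝ) / ((φ n : ℝ) + 1)) atTop (𝓝 0) :=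
    (tendsto_one_div_add_atTop_nhds_zero_nat (𝕜 := ℝ)).comp hφ.tendsto_atTop
  have hmem : v₀ ∈ A a₀ := by
    have hcl : v₀ ∈ closure (A a₀) := by
      rw [Metric.mem_closure_iff]
      intro r hr
      have e1 := hla.eventually (h.upper a₀ ha₀ (r / 3) (by positivity))
      have e2 := hzero.eventually (gt_mem_nhds (show (0 : ℝ) < r / 3 by positivity))
      have e3 := (hlv.mono_right nhdsWithin_le_nhds).eventually
        (Metric.ball_mem_nhds v₀ (show (0 : ℝ) < r / 3 by positivity))
      obtain ⟨n, h1, h2, h3⟩ := (e1.and (e2.and e3)).exists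
      obtain ⟨u, hu, hvu⟩ := Metric.mem_thickening_iff.1 (hav (φ n))
      obtain ⟨u', hu', huu'⟩ := Metric.mem_thickening_iff.1 (h1 hu)
      refine ⟨u', hu', ?_⟩
      have := dist_triangle4 v₀ (v (φ n)) u u'
      rw [dist_comm] at h3
      linarith
    rwa [(h.arc_isCompact a₀ ha₀).isClosed.closure_eq] at hcl
  have e1 := hlv.eventually (h.upper v₀ hv₀ (ε / 2) (by positivity))
  have e2 := hla.eventually (h.lower a₀ ha₀ (ε / 2) (by positivity))
  obtain ⟨n, h1, h2⟩ := (e1.and e2).exists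
  refine hnot (φ n) fun z hz => ?_
  obtain ⟨u, hu, hzu⟩ := Metric.mem_thickening_iff.1 (h1 hz)
  obtain ⟨u', hu', huu'⟩ := Metric.mem_thickening_iff.1 (h2 (h.arc_trans a₀ ha₀ v₀ hmem hu))
  exact Metric.mem_thickening_iff.2 ⟨u', hu', by linarith [dist_triangle z u u']⟩

/-- Bounded domains cut off by small crosscuts near `v` are close to the arc `A v`. -/
lemma exists_enclosure (h : RootedArcs X E p A) {v : ℂ} (hv : v ∈ X) {ε : ℝ} (hε : 0 < ε) :
    ∃ η > 0, ∀ V : Set ℂ, ∀ b b' : ℂ, IsCompact V → V ⊆ Metric.ball v η → V ∩ X = {b, b'} →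
      ∀ t ∉ X ∪ V, Bornology.IsBounded (connectedComponentIn (X ∪ V)ᶜ t) →
        t ∈ Metric.thickening ε (A v) := by
  obtain ⟨η₀, hη₀, hlog⟩ :=
    HasLog.uniform_thickening (h.arc_isCompact v hv) (h.arc_hasLog v hv) hε
  obtain ⟨η₁, hη₁, hsub⟩ := Metric.mem_nhdsWithin_iff.1 (h.upper v hv η₀ hη₀)
  refine ⟨min η₀ η₁, lt_min hη₀ hη₁, fun V b b' hVc hVb hVX t ht hbd => ?_⟩
  by_contra hcon
  have hbV : b ∈ V ∩ X := by rw [hVX]; simp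
  have hbV' : b' ∈ V ∩ X := by rw [hVX]; simp
  have hA : ∀ c ∈ V ∩ X, A c ⊆ Metric.thickening η₀ (A v) := fun c hc =>
    hsub ⟨Metric.ball_subset_ball (min_le_right _ _) (hVb hc.1), hc.2⟩
  have hV : V ⊆ Metric.thickening η₀ (A v) := fun z hz =>
    Metric.mem_thickening_iff.2 ⟨v, h.self_mem_arc v hv,
      (Metric.mem_ball.1 (hVb hz)).trans_le (min_le_left _ _)⟩
  have hS : HasLog (V ∪ (A b ∪ A b')) (fun z => z - t) :=
    (hlog t hcon).mono (union_subset hV (union_subset (hA b hbV) (hA b' hbV')))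
  have hAX : A b ∪ A b' ⊆ X := union_subset (h.arc_subset b hbV.2) (h.arc_subset b' hbV'.2)
  have hcap : X ∩ (V ∪ (A b ∪ A b')) = A b ∪ A b' := by
    rw [inter_union_distrib_left, inter_comm X V, hVX, inter_eq_right.2 hAX]
    refine union_eq_self_of_subset_left ?_
    rintro z (rfl | rfl)
    · exact Or.inl (h.self_mem_arc _ hbV.2)
    · exact Or.inr (h.self_mem_arc _ hbV'.2)
  have hlogX := h.hasLog (a := t) fun h' => ht (Or.inl h')
  have hclA : IsClosed (A b ∪ A b') :=
    ((h.arc_isCompact b hbV.2).union (h.arc_isCompact b' hbV'.2)).isClosed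
  have := HasLog.union h.isCompact.isClosed (hVc.isClosed.union hclA)
    (by rw [hcap]; exact h.union_arc_isPreconnected hbV.2 hbV'.2) hlogX hS
  exact not_hasLog_of_bounded_component (h.isCompact.union hVc) ht hbd
    (this.mono (union_subset_union_right _ subset_union_left))

lemma exists_hasLog_of_ends (h : RootedArcs X E p A) {x₀ e e' : ℂ} (hx₀ : x₀ ∈ X \ E)
    (he : e ∈ E) (he' : e' ∈ E) (hep : e ≠ p) (hep' : e' ≠ p) (hne : e ≠ e') :
    ∃ ε > 0, ∀ a ∈ X, HasLog (Metric.thickening ε (A a ∪ A x₀)) (fun z => z - e) ∨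
      HasLog (Metric.thickening ε (A a ∪ A x₀)) (fun z => z - e') := by
  refine h.isCompact.induction_on (p := fun s => ∃ ε > 0, ∀ a ∈ s,
      HasLog (Metric.thickening ε (A a ∪ A x₀)) (fun z => z - e) ∨
      HasLog (Metric.thickening ε (A a ∪ A x₀)) (fun z => z - e')) ⟨1, one_pos, by simp⟩ ?_ ?_ ?_
  · rintro s t hst ⟨η, hη, h⟩
    exact ⟨η, hη, fun x hx => h x (hst hx)⟩
  · rintro s t ⟨η, hη, h⟩ ⟨η', hη', h'⟩
    refine ⟨min η η', lt_min hη hη', ?_⟩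
    rintro x (hx | hx)
    · exact (h x hx).imp (fun q => q.mono (Metric.thickening_mono (min_le_left _ _) _))
        (fun q => q.mono (Metric.thickening_mono (min_le_left _ _) _))
    · exact (h' x hx).imp (fun q => q.mono (Metric.thickening_mono (min_le_right _ _) _))
        (fun q => q.mono (Metric.thickening_mono (min_le_right _ _) _))
  · intro a ha
    have hcpt := (h.arc_isCompact a ha).union (h.arc_isCompact x₀ hx₀.1)
    have hend : ∀ f ∈ E, f ≠ p → f ∈ A a ∪ A x₀ → f = a := by
      rintro f hf hfp (hfa | hfx)
      · exact (h.eq_of_end_mem f hf a ha hfa).resolve_right hfp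
      · rcases h.eq_of_end_mem f hf x₀ hx₀.1 hfx with rfl | h1
        · exact absurd hf hx₀.2
        · exact absurd h1 hfp
    have hloc : ∀ f, f ∉ A a ∪ A x₀ → ∃ t ∈ 𝓝[X] a, ∃ ε > 0, ∀ y ∈ t,
        HasLog (Metric.thickening ε (A y ∪ A x₀)) (fun z => z - f) := by
      intro f hf
      obtain ⟨η, hη, hlog⟩ := (h.union_arc_hasLog ha hx₀.1 hf).exists_thickening hcpt
        (by fun_prop)
      refine ⟨_, h.upper a ha (η / 2) (by positivity), η / 2, by positivity, fun y hy => ?_⟩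
      refine hlog.mono fun z hz => ?_
      obtain ⟨u, hu, hzu⟩ := Metric.mem_thickening_iff.1 hz
      rcases hu with hu | hu
      · obtain ⟨u', hu', huu'⟩ := Metric.mem_thickening_iff.1 (hy hu)
        exact Metric.mem_thickening_iff.2
          ⟨u', Or.inl hu', by linarith [dist_triangle z u u']⟩
      · exact Metric.mem_thickening_iff.2 ⟨u, Or.inr hu, by linarith⟩
    by_cases h1 : e ∈ A a ∪ A x₀
    · have h2 : e' ∉ A a ∪ A x₀ := fun h2 =>
        hne ((hend e he hep h1).trans (hend e' he' hep' h2).symm)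
      obtain ⟨t, ht, ε, hε, hl⟩ := hloc e' h2
      exact ⟨t, ht, ε, hε, fun y hy => Or.inr (hl y hy)⟩
    · obtain ⟨t, ht, ε, hε, hl⟩ := hloc e h1
      exact ⟨t, ht, ε, hε, fun y hy => Or.inl (hl y hy)⟩

end RootedArcs

/-- The points of `X` nearest to `z`. -/
def nearest (X : Set ℂ) (z : ℂ) : Set ℂ := {b | b ∈ X ∧ dist z b = Metric.infDist z X}

lemma nearest_nonempty {X : Set ℂ} (hX : IsCompact X) (hne : X.Nonempty) (z : ℂ) :
    (nearest X z).Nonempty := by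
  obtain ⟨b, hb, h⟩ := hX.exists_infDist_eq_dist hne z
  exact ⟨b, hb, h.symm⟩

lemma nearest_of_mem_segment {X : Set ℂ} {w b z : ℂ} (hb : b ∈ nearest X w)
    (hz : z ∈ segment ℝ b w) : b ∈ nearest X z := by
  refine ⟨hb.1, le_antisymm ?_ (Metric.infDist_le_dist_of_mem hb.1)⟩
  rw [Metric.le_infDist ⟨b, hb.1⟩]
  intro c hc
  have h1 := dist_add_dist_of_mem_segment hz
  have h2 : dist w b ≤ dist w c := hb.2.trans_le (Metric.infDist_le_dist_of_mem hc)
  have h3 := dist_triangle w z c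
  rw [dist_comm b z, dist_comm z w, dist_comm b w] at h1
  linarith

lemma mem_segment_of_dist_eq {w b c z : ℂ} (hzw : z ≠ w) (hb : z ∈ segment ℝ b w)
    (hc : dist w c = dist w z + dist z c) (hbc : dist z c = dist z b) : c = b := by
  have h1 : Wbtw ℝ w z c := dist_add_dist_eq_iff.1 hc.symm
  have h2 : Wbtw ℝ w z b := by
    have := mem_segment_iff_wbtw.1 hb
    exact this.symm
  have h3 : dist w b = dist w z + dist z b := (dist_add_dist_eq_iff.2 h2).symm
  obtain ⟨s, hs, hs'⟩ := h1
  obtain ⟨t, ht, ht'⟩ := h2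
  rw [AffineMap.lineMap_apply, vsub_eq_sub, vadd_eq_add] at hs' ht'
  have hd : ‖c - w‖ = ‖b - w‖ := by
    rw [← dist_eq_norm, ← dist_eq_norm, dist_comm c w, dist_comm b w, hc, hbc, h3]
  have e : s • (c - w) = t • (b - w) := by
    have := hs'.trans ht'.symm
    exact add_right_cancel this
  have hsne : s ≠ 0 := by
    rintro rfl
    apply hzw
    rw [← hs']; simp
  have hbne : ‖b - w‖ ≠ 0 := by
    intro h0
    rw [norm_eq_zero] at h0
    apply hzw
    rw [← ht', h0]; simp
  have hst : s = t := by
    have := congrArg norm e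
    rw [norm_smul, norm_smul, hd, Real.norm_of_nonneg hs.1, Real.norm_of_nonneg ht.1] at this
    exact mul_right_cancel₀ hbne this
  rw [hst] at e hsne
  have := smul_right_injective ℂ hsne e
  exact sub_left_inj.1 this

lemma nearest_unique {X : Set ℂ} {w b c z : ℂ} (hb : b ∈ nearest X w)
    (hz : z ∈ segment ℝ b w) (hzw : z ≠ w) (hc : c ∈ nearest X z) : c = b := by
  have h0 := nearest_of_mem_segment hb hz
  have hbc : dist z c = dist z b := hc.2.trans h0.2.symm
  refine mem_segment_of_dist_eq hzw hz ?_ hbc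
  have h1 := dist_add_dist_of_mem_segment hz
  have h2 : dist w b ≤ dist w c := hb.2.trans_le (Metric.infDist_le_dist_of_mem hc.1)
  have h3 := dist_triangle w z c
  rw [dist_comm b z, dist_comm z w, dist_comm b w] at h1
  linarith

lemma eq_of_mem_segment_of_mem {X : Set ℂ} {w b z : ℂ} (hb : b ∈ nearest X w)
    (hz : z ∈ segment ℝ b w) (hzX : z ∈ X) : z = b := by
  have h0 := (nearest_of_mem_segment hb hz).2
  rwa [Metric.infDist_zero_of_mem hzX, dist_eq_zero] at h0

lemma segment_inter_eq {X : Set ℂ} {w b : ℂ} (hb : b ∈ nearest X w) :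
    segment ℝ b w ∩ X = {b} := by
  ext z
  constructor
  · exact fun hz => eq_of_mem_segment_of_mem hb hz.1 hz.2
  · rintro rfl
    exact ⟨left_mem_segment _ _ _, hb.1⟩

lemma isOpen_nearest_subset {X U : Set ℂ} (hX : IsCompact X) (hU : IsOpen U) :
    IsOpen {z | nearest X z ⊆ U} := by
  rcases (X \ U).eq_empty_or_nonempty with h0 | hne
  · have : {z | nearest X z ⊆ U} = univ :=
      eq_univ_of_forall fun z b hb => sdiff_eq_empty.1 h0 hb.1
    rw [this]; exact isOpen_univ
  · have : {z | nearest X z ⊆ U} = {z | Metric.infDist z X < Metric.infDist z (X \ U)} := by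
      ext z
      constructor
      · intro hz
        obtain ⟨c, hc, hd⟩ := (hX.diff hU).exists_infDist_eq_dist hne z
        refine lt_of_le_of_ne (Metric.infDist_le_infDist_of_subset sdiff_subset hne) fun heq => ?_
        exact hc.2 (hz ⟨hc.1, by rw [heq, hd]⟩)
      · intro hz b hb
        by_contra hbU
        have := Metric.infDist_le_dist_of_mem (x := z) (show b ∈ X \ U from ⟨hb.1, hbU⟩)
        rw [hb.2] at this
        exact absurd hz (not_lt.2 this)
    rw [this]
    exact isOpen_lt (Metric.continuous_infDist_pt _) (Metric.continuous_infDist_pt _)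

/-- If the nearest points to a connected set `O` split into two separated classes, then some point
of `O` has nearest points in both classes. -/
lemma exists_nearest_split {X O Z U U' : Set ℂ} (hX : IsCompact X) (hne : X.Nonempty)
    (hO : IsPreconnected O) (hZ : ∀ z ∈ O, nearest X z ⊆ Z) (hU : IsOpen U) (hU' : IsOpen U')
    (hcov : Z ⊆ U ∪ U') (hdisj : Z ∩ (U ∩ U') = ∅)
    (h1 : ∃ z ∈ O, (nearest X z ∩ U).Nonempty) (h2 : ∃ z ∈ O, (nearest X z ∩ U').Nonempty) :
    ∃ z ∈ O, (nearest X z ∩ U).Nonempty ∧ (nearest X z ∩ U').Nonempty := by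
  by_contra hcon
  push Not at hcon
  have hex : ∀ b ∈ Z, b ∈ U → b ∈ U' → False := fun b hb h h' => by
    have : b ∈ Z ∩ (U ∩ U') := ⟨hb, h, h'⟩
    rw [hdisj] at this; exact this
  have hsub : ∀ z ∈ O, (nearest X z ∩ U).Nonempty → nearest X z ⊆ U := fun z hz hzU b hb => by
    have h0 := hcon z hz hzU
    rcases hcov (hZ z hz hb) with h | h
    · exact h
    · exact absurd (show b ∈ nearest X z ∩ U' from ⟨hb, h⟩) (by rw [h0]; simp)
  have hsub' : ∀ z ∈ O, (nearest X z ∩ U').Nonempty → nearest X z ⊆ U' := fun z hz hzU b hb => by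
    rcases hcov (hZ z hz hb) with h | h
    · have h0 := hcon z hz ⟨b, hb, h⟩
      rw [h0] at hzU
      exact absurd hzU (by simp)
    · exact h
  obtain ⟨z1, hz1, hn1⟩ := h1
  obtain ⟨z2, hz2, hn2⟩ := h2
  obtain ⟨z, hz, hzU, hzU'⟩ := hO _ _ (isOpen_nearest_subset hX hU) (isOpen_nearest_subset hX hU')
    (fun z hz => by
      obtain ⟨b, hb⟩ := nearest_nonempty hX hne z
      rcases hcov (hZ z hz hb) with h | h
      · exact Or.inl (hsub z hz ⟨b, hb, h⟩)
      · exact Or.inr (hsub' z hz ⟨b, hb, h⟩))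
    ⟨z1, hz1, hsub z1 hz1 hn1⟩ ⟨z2, hz2, hsub' z2 hz2 hn2⟩
  obtain ⟨b, hb⟩ := nearest_nonempty hX hne z
  exact hex b (hZ z hz hb) (hzU hb) (hzU' hb)

lemma nearest_near {X : Set ℂ} {v z b : ℂ} (hv : v ∈ X) (hb : b ∈ nearest X z) :
    dist b v ≤ 2 * dist z v := by
  have h1 := Metric.infDist_le_dist_of_mem (x := z) hv
  have h2 := dist_triangle b z v
  have h3 := hb.2
  rw [dist_comm] at h3
  linarith

lemma hasLog_of_convex {K : Set ℂ} (hK : Convex ℝ K) (hc : IsClosed K) {a : ℂ} (ha : a ∉ K) :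
    HasLog K (fun z => z - a) := by
  obtain ⟨f, u, hf, hu⟩ := geometric_hahn_banach_closed_point hK hc ha
  set c : ℂ := -((f 1 : ℝ) - (f Complex.I : ℝ) * Complex.I) with hcdef
  have hfc : ∀ w : ℂ, (c * w).re = -f w := by
    intro w
    have : f w = w.re * f 1 + w.im * f Complex.I := by
      conv_lhs => rw [show w = w.re • (1 : ℂ) + w.im • Complex.I by
        simp [Complex.re_add_im]]
      rw [map_add, map_smul, map_smul]; simp
    rw [this]
    simp [hcdef]; ring
  have hre : ∀ z ∈ K, 0 < (c * (z - a)).re := by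
    intro z hz
    rw [hfc, map_sub]
    have := hf z hz
    linarith
  rcases K.eq_empty_or_nonempty with h0 | ⟨k, hk⟩
  · exact ⟨0, by simp [h0], by simp [h0]⟩
  have hc0 : c ≠ 0 := by
    intro h0
    have := hre k hk
    rw [h0] at this
    simp at this
  have h1 : HasLog K (fun z => c * (z - a)) :=
    HasLog.of_slitPlane (by fun_prop) fun z hz => Or.inl (hre z hz)
  refine (h1.mul (HasLog.const (inv_ne_zero hc0))).congr fun z _ => ?_
  field_simp

lemma isCompact_segment (a b : ℂ) : IsCompact (segment ℝ a b) := by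
  rw [segment_eq_image_lineMap]
  exact isCompact_Icc.image (by fun_prop)

/-- Two segments joining `w` to nearest points `b` and `b'`. -/
def spokes (w b b' : ℂ) : Set ℂ := segment ℝ b w ∪ segment ℝ b' w

/-- The segments from `w` to `b` and `b'` form a crosscut of the complement of `X`. -/
structure IsCrosscut (X : Set ℂ) (w b b' : ℂ) : Prop where
  notMem : w ∉ X
  left : b ∈ nearest X w
  right : b' ∈ nearest X w
  ne : b ≠ b'

lemma spokes_comm (w b b' : ℂ) : spokes w b b' = spokes w b' b := union_comm _ _

lemma isCompact_spokes (w b b' : ℂ) : IsCompact (spokes w b b') :=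
  (isCompact_segment _ _).union (isCompact_segment _ _)

lemma isPreconnected_spokes (w b b' : ℂ) : IsPreconnected (spokes w b b') :=
  (convex_segment _ _).isPreconnected.union w (right_mem_segment _ _ _) (right_mem_segment _ _ _)
    (convex_segment _ _).isPreconnected

lemma spokes_subset_ball {v w b b' : ℂ} {r : ℝ} (hw : w ∈ Metric.ball v r)
    (hb : b ∈ Metric.ball v r) (hb' : b' ∈ Metric.ball v r) :
    spokes w b b' ⊆ Metric.ball v r :=
  union_subset ((convex_ball v r).segment_subset hb hw) ((convex_ball v r).segment_subset hb' hw)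

lemma dist_eq_of_mem_segment {b w z v : ℂ} (hz : z ∈ segment ℝ b w) (hv : v ∈ segment ℝ b w) :
    dist z v = |dist z b - dist v b| := by
  rw [segment_eq_image_lineMap] at hz hv
  obtain ⟨s, hs, rfl⟩ := hz
  obtain ⟨t, ht, rfl⟩ := hv
  rw [dist_lineMap_lineMap, dist_lineMap_left, dist_lineMap_left, Real.norm_of_nonneg hs.1,
    Real.norm_of_nonneg ht.1, ← sub_mul, abs_mul, abs_of_nonneg (dist_nonneg (x := b)),
    Real.dist_eq]

namespace IsCrosscut

variable {X : Set ℂ} {w b b' : ℂ}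

lemma symm (h : IsCrosscut X w b b') : IsCrosscut X w b' b :=
  ⟨h.notMem, h.right, h.left, h.ne.symm⟩

lemma spokes_inter (h : IsCrosscut X w b b') : spokes w b b' ∩ X = {b, b'} := by
  rw [spokes, union_inter_distrib_right, segment_inter_eq h.left, segment_inter_eq h.right]
  rfl

lemma segments_inter (h : IsCrosscut X w b b') : segment ℝ b w ∩ segment ℝ b' w = {w} := by
  ext z
  constructor
  · rintro ⟨h1, h2⟩
    by_contra hzw
    exact h.ne (nearest_unique h.left h1 hzw (nearest_of_mem_segment h.right h2)).symm
  · rintro rfl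
    exact ⟨right_mem_segment _ _ _, right_mem_segment _ _ _⟩

lemma infDist_pos (h : IsCrosscut X w b b') : 0 < Metric.infDist w X := by
  rw [← h.left.2, dist_pos]
  rintro rfl
  exact h.notMem h.left.1

lemma hasLog_spokes (h : IsCrosscut X w b b') {a : ℂ} (ha : a ∉ spokes w b b') :
    HasLog (spokes w b b') (fun z => z - a) :=
  HasLog.union (isCompact_segment _ _).isClosed (isCompact_segment _ _).isClosed
    (by rw [h.segments_inter]; exact isPreconnected_singleton)
    (hasLog_of_convex (convex_segment _ _) (isCompact_segment _ _).isClosed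
      fun h' => ha (Or.inl h'))
    (hasLog_of_convex (convex_segment _ _) (isCompact_segment _ _).isClosed
      fun h' => ha (Or.inr h'))

end IsCrosscut

lemma not_isBounded_compl_closedBall (R : ℝ) :
    ¬ Bornology.IsBounded ((Metric.closedBall (0 : ℂ) R)ᶜ) := by
  intro hb
  have := hb.union (Metric.isBounded_closedBall (x := (0 : ℂ)) (r := R))
  rw [compl_union_self] at this
  exact NormedSpace.unbounded_univ ℝ ℂ this

lemma exists_unbounded_component {K : Set ℂ} (hK : IsCompact K) :
    ∃ s ∉ K, ¬ Bornology.IsBounded (connectedComponentIn Kᶜ s) := by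
  obtain ⟨R₀, hR₀⟩ := hK.isBounded.subset_closedBall 0
  set R := max R₀ 0
  have hR := hR₀.trans (Metric.closedBall_subset_closedBall (le_max_left R₀ 0))
  have hne : ((Metric.closedBall (0 : ℂ) R)ᶜ).Nonempty := by
    by_contra hcon
    rw [not_nonempty_iff_eq_empty] at hcon
    exact not_isBounded_compl_closedBall R (by rw [hcon]; exact Bornology.isBounded_empty)
  obtain ⟨s, hs⟩ := hne
  refine ⟨s, fun h => hs (hR h), fun hb => not_isBounded_compl_closedBall R (hb.subset ?_)⟩
  exact (isPreconnected_compl_closedBall 0 (le_max_right R₀ 0)).subset_connectedComponentIn hs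
    (compl_subset_compl.2 hR)

lemma frontier_inter_nonempty {S G : Set ℂ} (hS : IsPreconnected S) {x y : ℂ} (hx : x ∈ S)
    (hxG : x ∈ G) (hy : y ∈ S) (hyG : y ∉ G) : (S ∩ frontier G).Nonempty := by
  by_contra hcon
  rw [not_nonempty_iff_eq_empty] at hcon
  have hd : ∀ z ∈ S, z ∉ frontier G := fun z hz hf => by
    have : z ∈ S ∩ frontier G := ⟨hz, hf⟩
    rw [hcon] at this; exact this
  have hxi : x ∈ interior G := by
    by_contra h'
    exact hd x hx ⟨subset_closure hxG, h'⟩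
  have hyi : y ∈ (closure G)ᶜ := fun h' => hd y hy ⟨h', fun h'' => hyG (interior_subset h'')⟩
  obtain ⟨z, -, hz1, hz2⟩ := hS _ _ isOpen_interior isClosed_closure.isOpen_compl
    (fun z hz => by
      by_cases hzc : z ∈ closure G
      · exact Or.inl (by_contra fun h' => hd z hz ⟨hzc, h'⟩)
      · exact Or.inr hzc) ⟨x, hx, hxi⟩ ⟨y, hy, hyi⟩
  exact hz2 (interior_subset.trans subset_closure hz1)

lemma hasLog_ratio_of_forall {K : Set ℂ} (h : ∀ a ∉ K, HasLog K (fun z => z - a)) {a b : ℂ}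
    (ha : a ∉ K) (hb : b ∉ K) : HasLog K (fun z => (z - a) / (z - b)) :=
  (h a ha).div (h b hb)

section

variable {X E : Set ℂ} {p : ℂ} {A : ℂ → Set ℂ} {w b b' : ℂ}

namespace RootedArcs

/-- A small open piece of a spoke can be removed without separating the plane. -/
lemma openSegment_subset_closure (h : RootedArcs X E p A) (hc : IsCrosscut X w b b') {t s : ℂ}
    (ht : t ∉ X ∪ spokes w b b') (hs : s ∉ X ∪ spokes w b b')
    (hst : s ∉ connectedComponentIn (X ∪ spokes w b b')ᶜ t) :
    openSegment ℝ b w ⊆ closure (connectedComponentIn (X ∪ spokes w b b')ᶜ t) := by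
  intro v hv
  by_contra hvG
  set G := connectedComponentIn (X ∪ spokes w b b')ᶜ t with hG
  have hbw : b ≠ w := by rintro rfl; exact hc.notMem hc.left.1
  have hvs : v ∈ segment ℝ b w := openSegment_subset_segment _ _ _ hv
  have hvb : v ≠ b := fun h' => hbw (left_mem_openSegment_iff.1 (h' ▸ hv))
  have hvw : v ≠ w := fun h' => hbw (right_mem_openSegment_iff.1 (h' ▸ hv))
  obtain ⟨κ₀, hκ₀, hball⟩ := Metric.isOpen_iff.1 isClosed_closure.isOpen_compl v hvG
  have hvb' := dist_pos.2 hvb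
  have hvw' := dist_pos.2 hvw
  set κ := min κ₀ (min (dist v b) (dist v w)) with hκ
  have hκpos : 0 < κ := by positivity
  have hκ1 : κ ≤ κ₀ := min_le_left _ _
  have hκ2 : κ ≤ dist v b := (min_le_right _ _).trans (min_le_left _ _)
  have hκ3 : κ ≤ dist v w := (min_le_right _ _).trans (min_le_right _ _)
  set L₁ := segment ℝ b w ∩ Metric.closedBall b (dist v b - κ) with hL₁
  set L₂ := segment ℝ b w ∩ Metric.closedBall w (dist v w - κ) with hL₂
  set L₃ := segment ℝ b' w with hL₃
  have hconv1 : Convex ℝ L₁ := (convex_segment _ _).inter (convex_closedBall _ _)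
  have hconv2 : Convex ℝ L₂ := (convex_segment _ _).inter (convex_closedBall _ _)
  have hconv3 : Convex ℝ L₃ := convex_segment _ _
  have hcl1 : IsClosed L₁ := (isCompact_segment _ _).isClosed.inter Metric.isClosed_closedBall
  have hcl2 : IsClosed L₂ := (isCompact_segment _ _).isClosed.inter Metric.isClosed_closedBall
  have hcl3 : IsClosed L₃ := (isCompact_segment _ _).isClosed
  have hw2 : w ∈ L₂ := ⟨right_mem_segment _ _ _, by simpa using hκ3⟩
  have hb1 : b ∈ L₁ := ⟨left_mem_segment _ _ _, by simpa using hκ2⟩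
  have hsum : ∀ z ∈ segment ℝ b w, dist z b + dist z w = dist b w := fun z hz => by
    have := dist_add_dist_of_mem_segment hz
    rwa [dist_comm b z] at this
  have h12 : ∀ z ∈ L₁, z ∉ L₂ := by
    intro z hz1 hz2
    have h1 := hsum z hz1.1
    have h2 := hsum v hvs
    have h3 := Metric.mem_closedBall.1 hz1.2
    have h4 := Metric.mem_closedBall.1 hz2.2
    linarith
  have h13 : ∀ z ∈ L₁, z ∉ L₃ := by
    intro z hz1 hz3
    have : z ∈ ({w} : Set ℂ) := by rw [← hc.segments_inter]; exact ⟨hz1.1, hz3⟩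
    rw [mem_singleton_iff] at this
    exact h12 z hz1 (this ▸ hw2)
  have h23 : L₂ ∩ L₃ = {w} := by
    refine Subset.antisymm ?_ ?_
    · rw [← hc.segments_inter]
      exact inter_subset_inter_left _ inter_subset_left
    · rintro z rfl
      exact ⟨hw2, right_mem_segment _ _ _⟩
  have hlog23 : ∀ a ∉ L₂ ∪ L₃, HasLog (L₂ ∪ L₃) (fun z => z - a) := fun a ha =>
    HasLog.union hcl2 hcl3 (by rw [h23]; exact isPreconnected_singleton)
      (hasLog_of_convex hconv2 hcl2 fun h' => ha (Or.inl h'))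
      (hasLog_of_convex hconv3 hcl3 fun h' => ha (Or.inr h'))
  have hX1 : X ∩ L₁ = {b} := by
    refine Subset.antisymm ?_ ?_
    · rw [← segment_inter_eq hc.left, inter_comm]
      exact inter_subset_inter_left _ inter_subset_left
    · rintro z rfl
      exact ⟨hc.left.1, hb1⟩
  have hX23 : (X ∪ L₁) ∩ (L₂ ∪ L₃) = {b'} := by
    refine Subset.antisymm ?_ ?_
    · rintro z ⟨hzX | hz1, hz2 | hz3⟩
      · have := eq_of_mem_segment_of_mem hc.left hz2.1 hzX
        subst this
        exact absurd hz2 (h12 z hb1)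
      · exact eq_of_mem_segment_of_mem hc.right hz3 hzX
      · exact absurd hz2 (h12 z hz1)
      · exact absurd hz3 (h13 z hz1)
    · rintro z rfl
      exact ⟨Or.inl hc.right.1, Or.inr (left_mem_segment _ _ _)⟩
  have hlog : ∀ a ∉ (X ∪ L₁) ∪ (L₂ ∪ L₃), HasLog ((X ∪ L₁) ∪ (L₂ ∪ L₃)) (fun z => z - a) := by
    intro a ha
    refine HasLog.union (h.isCompact.isClosed.union hcl1) (hcl2.union hcl3)
      (by rw [hX23]; exact isPreconnected_singleton) ?_ (hlog23 a fun h' => ha (Or.inr h'))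
    exact HasLog.union h.isCompact.isClosed hcl1
      (by rw [hX1]; exact isPreconnected_singleton) (h.hasLog fun h' => ha (Or.inl (Or.inl h')))
      (hasLog_of_convex hconv1 hcl1 fun h' => ha (Or.inl (Or.inr h')))
  have hsub : (X ∪ L₁) ∪ (L₂ ∪ L₃) ⊆ X ∪ spokes w b b' := by
    rintro z ((hz | hz) | (hz | hz))
    · exact Or.inl hz
    · exact Or.inr (Or.inl hz.1)
    · exact Or.inr (Or.inl hz.1)
    · exact Or.inr (Or.inr hz)
  have hcomp : IsCompact ((X ∪ L₁) ∪ (L₂ ∪ L₃)) :=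
    (h.isCompact.union (isCompact_spokes w b b')).of_isClosed_subset
      ((h.isCompact.isClosed.union hcl1).union (hcl2.union hcl3)) hsub
  have hmem := mem_component_of_hasLog hcomp (fun h' => ht (hsub h')) (fun h' => hs (hsub h'))
    (hasLog_ratio_of_forall hlog (fun h' => ht (hsub h')) (fun h' => hs (hsub h')))
  obtain ⟨z, hz, hzf⟩ := frontier_inter_nonempty isPreconnected_connectedComponentIn
    (mem_connectedComponentIn (show t ∈ ((X ∪ L₁) ∪ (L₂ ∪ L₃))ᶜ from fun h' => ht (hsub h')))
    (mem_connectedComponentIn (show t ∈ (X ∪ spokes w b b')ᶜ from ht)) hmem hst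
  have hzn := connectedComponentIn_subset _ _ hz
  have hzX : z ∈ X ∪ spokes w b b' := by
    have := frontier_connectedComponentIn_subset
      (h.isCompact.union (isCompact_spokes w b b')).isClosed.isOpen_compl t hzf
    rwa [compl_compl] at this
  rcases hzX with hzX | hz1 | hz3
  · exact hzn (Or.inl (Or.inl hzX))
  · have hzb : dist v b - κ < dist z b := not_le.1 fun h' => hzn (Or.inl (Or.inr ⟨hz1, h'⟩))
    have hzw : dist v w - κ < dist z w := not_le.1 fun h' => hzn (Or.inr (Or.inl ⟨hz1, h'⟩))
    have h1 := hsum z hz1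
    have h2 := hsum v hvs
    have hzv : dist z v < κ := by
      rw [dist_eq_of_mem_segment hz1 hvs, abs_lt]
      constructor <;> linarith
    exact hball (Metric.mem_ball.2 (hzv.trans_le hκ1)) (frontier_subset_closure hzf)
  · exact hzn (Or.inr (Or.inr hz3))

lemma spokes_subset_closure (h : RootedArcs X E p A) (hc : IsCrosscut X w b b') {t s : ℂ}
    (ht : t ∉ X ∪ spokes w b b') (hs : s ∉ X ∪ spokes w b b')
    (hst : s ∉ connectedComponentIn (X ∪ spokes w b b')ᶜ t) :
    spokes w b b' ⊆ closure (connectedComponentIn (X ∪ spokes w b b')ᶜ t) := by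
  have h1 := closure_minimal (h.openSegment_subset_closure hc ht hs hst) isClosed_closure
  have e := spokes_comm w b b'
  rw [e] at ht hs hst
  have h2 := closure_minimal (h.openSegment_subset_closure hc.symm ht hs hst) isClosed_closure
  rw [closure_openSegment] at h1 h2
  rw [← e] at h2
  exact union_subset h1 h2

end RootedArcs

/-- A bounded complementary domain of `X ∪ V`. -/
def IsLobe (X V G : Set ℂ) : Prop :=
  Bornology.IsBounded G ∧ G.Nonempty ∧ ∀ t ∈ G, t ∉ X ∪ V ∧ G = connectedComponentIn (X ∪ V)ᶜ t

lemma isLobe_of_component {X V : Set ℂ} {t : ℂ} (ht : t ∉ X ∪ V)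
    (hb : Bornology.IsBounded (connectedComponentIn (X ∪ V)ᶜ t)) :
    IsLobe X V (connectedComponentIn (X ∪ V)ᶜ t) :=
  ⟨hb, ⟨t, mem_connectedComponentIn ht⟩, fun _ hs =>
    ⟨connectedComponentIn_subset _ _ hs, connectedComponentIn_eq hs⟩⟩

namespace IsLobe

variable {V G : Set ℂ}

lemma isPreconnected (hG : IsLobe X V G) : IsPreconnected G := by
  obtain ⟨t, ht⟩ := hG.2.1
  rw [(hG.2.2 t ht).2]
  exact isPreconnected_connectedComponentIn

lemma isOpen (hG : IsLobe X V G) (hX : IsCompact X) (hV : IsCompact V) : IsOpen G := by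
  obtain ⟨t, ht⟩ := hG.2.1
  rw [(hG.2.2 t ht).2]
  exact (hX.union hV).isClosed.isOpen_compl.connectedComponentIn

lemma notMem (hG : IsLobe X V G) {t : ℂ} (ht : t ∈ G) : t ∉ X := fun h' =>
  (hG.2.2 t ht).1 (Or.inl h')

lemma notMem_cut (hG : IsLobe X V G) {t : ℂ} (ht : t ∈ G) : t ∉ V := fun h' =>
  (hG.2.2 t ht).1 (Or.inr h')

lemma subset_of_isPreconnected (hG : IsLobe X V G) {S : Set ℂ} (hS : IsPreconnected S) {t : ℂ}
    (htS : t ∈ S) (htG : t ∈ G) (hd : ∀ z ∈ S, z ∉ X ∪ V) : S ⊆ G := by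
  rw [(hG.2.2 t htG).2]
  exact hS.subset_connectedComponentIn htS hd

end IsLobe

namespace RootedArcs

lemma spokes_subset_closure_lobe (h : RootedArcs X E p A) (hc : IsCrosscut X w b b') {G : Set ℂ}
    (hG : IsLobe X (spokes w b b') G) : spokes w b b' ⊆ closure G := by
  obtain ⟨s, hs, hsu⟩ := exists_unbounded_component (h.isCompact.union (isCompact_spokes w b b'))
  obtain ⟨t, ht⟩ := hG.2.1
  obtain ⟨ht1, ht2⟩ := hG.2.2 t ht
  rw [ht2]
  refine h.spokes_subset_closure hc ht1 hs fun h' => hsu ?_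
  rw [← connectedComponentIn_eq h', ← ht2]
  exact hG.1

/-- Points of a lobe close to `X` can be joined inside the lobe close to `X`. -/
lemma isPreconnected_lobe_inter_thickening (h : RootedArcs X E p A) (hc : IsCrosscut X w b b')
    {G : Set ℂ} (hG : IsLobe X (spokes w b b') G) {δ : ℝ} (hδ : 0 < δ)
    (hδw : δ ≤ Metric.infDist w X) : IsPreconnected (G ∩ Metric.thickening δ X) := by
  set V := spokes w b b' with hV
  have hXne : X.Nonempty := ⟨p, h.root_mem⟩
  refine isPreconnected_of_forall_pair fun x hx y hy => ?_
  have hbd : Bornology.IsBounded (insert w (Metric.thickening δ X)) :=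
    h.isCompact.isBounded.thickening.insert w
  obtain ⟨R, hwR⟩ := hbd.subset_ball (0 : ℂ)
  have hR : Metric.thickening δ X ⊆ Metric.ball 0 R := (subset_insert _ _).trans hwR
  set M := Metric.closedBall (0 : ℂ) R \ Metric.thickening δ X with hM
  have hMc : IsCompact M := (isCompact_closedBall _ _).diff Metric.isOpen_thickening
  have hVc : IsCompact V := isCompact_spokes w b b'
  have hMX : ∀ z ∈ X, z ∉ M := fun z hz hzM => hzM.2 (Metric.self_subset_thickening hδ _ hz)
  set f : ℂ → ℂ := fun z => (z - x) / (z - y) with hf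
  have hK : HasLog (X ∪ V) f :=
    HasLog.of_isPreconnected (h.isCompact.union hVc) hG.isPreconnected
      (disjoint_left.2 fun z hz hzG => (hG.2.2 z hzG).1 hz) hx.1 hy.1
  have hinf : ∀ z, z ∈ Metric.thickening δ X ↔ Metric.infDist z X < δ := fun z => by
    rw [Metric.mem_thickening_iff, ← Metric.infDist_lt_iff hXne]
  have hsp : ∀ z ∈ Metric.thickening δ X, ∃ S ⊆ Metric.thickening δ X, IsPreconnected S ∧
      X ⊆ S ∧ z ∈ S := by
    intro z hz
    obtain ⟨a, ha⟩ := nearest_nonempty h.isCompact hXne z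
    refine ⟨X ∪ segment ℝ a z, union_subset (Metric.self_subset_thickening hδ _) ?_, ?_,
      subset_union_left, Or.inr (right_mem_segment _ _ _)⟩
    · intro u hu
      have h1 := nearest_of_mem_segment ha hu
      have h2 := dist_add_dist_of_mem_segment hu
      rw [hinf] at hz ⊢
      rw [← h1.2]
      rw [← ha.2, dist_comm z a] at hz
      rw [dist_comm u a]
      linarith [dist_nonneg (x := u) (y := z)]
    · exact h.isPreconnected.union a ha.1 (left_mem_segment _ _ _)
        (convex_segment _ _).isPreconnected
  have hMf : HasLog M f := by
    obtain ⟨S, hS, hSp, hSX, hxS⟩ := hsp x hx.2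
    obtain ⟨S', hS', hSp', hSX', hyS⟩ := hsp y hy.2
    refine HasLog.of_isPreconnected hMc (hSp.union p (hSX h.root_mem) (hSX' h.root_mem) hSp')
      (disjoint_left.2 ?_) (Or.inl hxS) (Or.inr hyS)
    rintro z hz (hz' | hz')
    · exact hz.2 (hS hz')
    · exact hz.2 (hS' hz')
  have hVf : HasLog V f :=
    (hc.hasLog_spokes (hG.notMem_cut hx.1)).div (hc.hasLog_spokes (hG.notMem_cut hy.1))
  have hMV : IsPreconnected (M ∩ V) := by
    have hwM : ∀ c ∈ nearest X w, M ∩ segment ℝ c w =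
        Metric.closedBall 0 R ∩ (segment ℝ c w ∩ Metric.closedBall w (dist c w - δ)) := by
      intro c hcn
      ext z
      constructor
      · rintro ⟨⟨hz1, hz2⟩, hz3⟩
        refine ⟨hz1, hz3, ?_⟩
        rw [hinf, ← (nearest_of_mem_segment hcn hz3).2, not_lt] at hz2
        have := dist_add_dist_of_mem_segment hz3
        rw [Metric.mem_closedBall]
        rw [dist_comm c z] at this
        linarith
      · rintro ⟨hz1, hz3, hz2⟩
        refine ⟨⟨hz1, ?_⟩, hz3⟩
        rw [hinf, ← (nearest_of_mem_segment hcn hz3).2, not_lt]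
        have := dist_add_dist_of_mem_segment hz3
        rw [Metric.mem_closedBall] at hz2
        rw [dist_comm c z] at this
        linarith
    have hpre : ∀ c ∈ nearest X w, IsPreconnected (M ∩ segment ℝ c w) := fun c hcn => by
      rw [hwM c hcn]
      exact ((convex_closedBall _ _).inter
        ((convex_segment _ _).inter (convex_closedBall _ _))).isPreconnected
    rw [hV, spokes, inter_union_distrib_left]
    have hwM : w ∈ M := ⟨Metric.ball_subset_closedBall (hwR (mem_insert _ _)), by
      rw [hinf, not_lt]; exact hδw⟩
    exact (hpre b hc.left).union w ⟨hwM, right_mem_segment _ _ _⟩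
      ⟨hwM, right_mem_segment _ _ _⟩ (hpre b' hc.right)
  have hMVf : HasLog (M ∪ V) f := HasLog.union hMc.isClosed hVc.isClosed hMV hMf hVf
  have hcap : (X ∪ V) ∩ (M ∪ V) = V := by
    refine Subset.antisymm ?_ fun z hz => ⟨Or.inr hz, Or.inr hz⟩
    rintro z ⟨hz1 | hz1, hz2 | hz2⟩
    · exact absurd hz2 (hMX z hz1)
    all_goals assumption
  have hall : HasLog ((X ∪ V) ∪ (M ∪ V)) f :=
    HasLog.union (h.isCompact.union hVc).isClosed (hMc.union hVc).isClosed
      (by rw [hcap]; exact isPreconnected_spokes w b b') hK hMVf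
  have hn : ∀ z ∈ G ∩ Metric.thickening δ X, z ∉ (X ∪ V) ∪ (M ∪ V) := by
    rintro z hz (h1 | h1 | h1)
    · exact (hG.2.2 z hz.1).1 h1
    · exact h1.2 hz.2
    · exact hG.notMem_cut hz.1 h1
  have hmem := mem_component_of_hasLog ((h.isCompact.union hVc).union (hMc.union hVc)) (hn x hx)
    (hn y hy) hall
  refine ⟨connectedComponentIn ((X ∪ V) ∪ (M ∪ V))ᶜ x, ?_, mem_connectedComponentIn (hn x hx),
    hmem, isPreconnected_connectedComponentIn⟩
  have hcs := connectedComponentIn_subset ((X ∪ V) ∪ (M ∪ V))ᶜ x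
  refine subset_inter ?_ ?_
  · exact hG.subset_of_isPreconnected isPreconnected_connectedComponentIn
      (mem_connectedComponentIn (hn x hx)) hx.1 fun z hz h' => hcs hz (Or.inl h')
  · refine isPreconnected_connectedComponentIn.subset_left_of_subset_union
      Metric.isOpen_thickening Metric.isClosed_closedBall.isOpen_compl
      (v := (Metric.closedBall (0 : ℂ) R)ᶜ) ?_ ?_ ⟨x, mem_connectedComponentIn (hn x hx), hx.2⟩
    · exact disjoint_left.2 fun z hz hz' => hz' (Metric.ball_subset_closedBall (hR hz))
    · intro z hz
      by_contra hcon
      simp only [mem_union, mem_compl_iff, not_or, not_not] at hcon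
      exact hcs hz (Or.inr (Or.inl ⟨hcon.2, hcon.1⟩))

end RootedArcs
end

lemma ratio_mem_slitPlane {η : ℝ} (hη : 0 < η) {ζ : ℂ} (h : ζ.re ≠ 0 ∨ η < ‖ζ‖) :
    (ζ - η * Complex.I) / (ζ + η * Complex.I) ∈ Complex.slitPlane := by
  have hne : ζ + η * Complex.I ≠ 0 := by
    intro h0
    have h1 : ζ = -(η * Complex.I) := eq_neg_of_add_eq_zero_left h0
    rcases h with h | h
    · exact h (by rw [h1]; simp)
    · rw [h1, norm_neg, norm_mul, Complex.norm_I, mul_one, Complex.norm_real,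
        Real.norm_of_nonneg hη.le] at h
      exact lt_irrefl _ h
  have hns : 0 < Complex.normSq (ζ + η * Complex.I) := Complex.normSq_pos.2 hne
  by_cases hre : ζ.re = 0
  · left
    have h2 : η < ‖ζ‖ := h.resolve_left (by simpa using hre)
    have h3 : ‖ζ‖ ^ 2 = ζ.im ^ 2 := by
      rw [← Complex.normSq_eq_norm_sq, Complex.normSq_apply, hre]; ring
    have h4 : η ^ 2 < ζ.im ^ 2 := by rw [← h3]; gcongr
    rw [Complex.div_re, ← add_div]
    refine div_pos ?_ hns
    simp [hre]
    nlinarith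
  · right
    rw [Complex.div_im, ← sub_div]
    refine div_ne_zero ?_ hns.ne'
    simp only [Complex.sub_im, Complex.mul_im, Complex.ofReal_re, Complex.I_im, mul_one,
      Complex.ofReal_im, Complex.I_re, mul_zero, add_zero, Complex.add_re, Complex.mul_re,
      sub_zero, Complex.sub_re, Complex.add_im, sub_self]
    have : (ζ.im - η) * ζ.re - ζ.re * (ζ.im + η) = -2 * η * ζ.re := by ring
    rw [this]
    exact mul_ne_zero (mul_ne_zero (by norm_num) hη.ne') hre

lemma not_continuousAt_log_ratio {η : ℝ} (hη : 0 < η) {g : ℝ → ℂ}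
    (hg : ContinuousAt g 0) {r : ℝ} (hr : 0 < r)
    (h : ∀ x : ℝ, x ≠ 0 → |x| < r →
      g x = Complex.log ((x - η * Complex.I) / (x + η * Complex.I))) : False := by
  set q : ℝ → ℂ := fun x => (x - η * Complex.I) / (x + η * Complex.I) with hq
  have hηC : (η : ℂ) * Complex.I ≠ 0 := mul_ne_zero (by exact_mod_cast hη.ne') Complex.I_ne_zero
  have hq0 : q 0 = -1 := by
    simp only [hq, Complex.ofReal_zero, zero_sub, zero_add]
    rw [neg_div, div_self hηC]
  have hqc : ContinuousAt q 0 := by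
    refine ContinuousAt.div (by fun_prop) (by fun_prop) ?_
    simpa using hηC
  have hqt : Tendsto q (𝓝 0) (𝓝 (-1)) := by rw [← hq0]; exact hqc
  have him : ∀ x : ℝ, (q x).im = -2 * η * x / Complex.normSq (x + η * Complex.I) := by
    intro x
    simp only [hq]
    rw [Complex.div_im, ← sub_div]
    congr 1
    simp; ring
  have hns : ∀ x : ℝ, x ≠ 0 → 0 < Complex.normSq (x + η * Complex.I) := by
    intro x hx
    rw [Complex.normSq_pos]
    intro h0
    apply hx
    have := congrArg Complex.re h0
    simpa using this
  have hev : ∀ᶠ x : ℝ in 𝓝 0, |x| < r := by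
    filter_upwards [Metric.ball_mem_nhds (0 : ℝ) hr] with x hx
    simpa using hx
  have hneg : Tendsto g (𝓝[>] 0) (𝓝 (-(Real.pi * Complex.I))) := by
    have h1 := Complex.tendsto_log_nhdsWithin_im_neg_of_re_neg_of_im_zero
      (z := -1) (by simp) (by simp)
    have h2 : Tendsto q (𝓝[>] 0) (𝓝[{z : ℂ | z.im < 0}] (-1)) := by
      refine tendsto_nhdsWithin_iff.2 ⟨hqt.mono_left nhdsWithin_le_nhds, ?_⟩
      filter_upwards [self_mem_nhdsWithin] with x hx
      have hx' : (0 : ℝ) < x := hx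
      change _ < (0 : ℝ)
      rw [him]
      refine div_neg_of_neg_of_pos ?_ (hns x hx'.ne')
      nlinarith
    have h3 := h1.comp h2
    simp only [norm_neg, norm_one, Real.log_one, Complex.ofReal_zero, zero_sub] at h3
    refine h3.congr' ?_
    filter_upwards [self_mem_nhdsWithin, nhdsWithin_le_nhds hev] with x hx hxr
    exact (h x (ne_of_gt hx) hxr).symm
  have hpos : Tendsto g (𝓝[<] 0) (𝓝 (Real.pi * Complex.I)) := by
    have h1 := Complex.tendsto_log_nhdsWithin_im_nonneg_of_re_neg_of_im_zero
      (z := -1) (by simp) (by simp)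
    have h2 : Tendsto q (𝓝[<] 0) (𝓝[{z : ℂ | 0 ≤ z.im}] (-1)) := by
      refine tendsto_nhdsWithin_iff.2 ⟨hqt.mono_left nhdsWithin_le_nhds, ?_⟩
      filter_upwards [self_mem_nhdsWithin] with x hx
      have hx' : x < (0 : ℝ) := hx
      change (0 : ℝ) ≤ _
      rw [him]
      refine div_nonneg ?_ (hns x hx'.ne).le
      nlinarith
    have h3 := h1.comp h2
    simp only [norm_neg, norm_one, Real.log_one, Complex.ofReal_zero, zero_add] at h3
    refine h3.congr' ?_
    filter_upwards [self_mem_nhdsWithin, nhdsWithin_le_nhds hev] with x hx hxr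
    exact (h x (ne_of_lt hx) hxr).symm
  have e1 := tendsto_nhds_unique hneg (hg.tendsto.mono_left nhdsWithin_le_nhds)
  have e2 := tendsto_nhds_unique hpos (hg.tendsto.mono_left nhdsWithin_le_nhds)
  have e3 := e1.trans e2.symm
  have := congrArg Complex.im e3
  simp at this
  linarith [Real.pi_pos]

lemma isPreconnected_segment_diff (a z : ℂ) : IsPreconnected (segment ℝ a z \ {a}) := by
  rcases eq_or_ne a z with rfl | hne
  · simp [segment_same, isPreconnected_empty]
  · refine (convex_openSegment (𝕜 := ℝ) a z).isPreconnected.subset_closure ?_ ?_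
    · intro u hu
      refine ⟨openSegment_subset_segment _ _ _ hu, ?_⟩
      rintro rfl
      exact hne (left_mem_openSegment_iff.1 hu)
    · rw [closure_openSegment]
      exact sdiff_subset

lemma mem_segment_of_common {a z w u : ℂ} (hu : u ∈ segment ℝ a z) (hu' : u ∈ segment ℝ a w)
    (hne : u ≠ a) (hd : dist z a ≤ dist w a) : z ∈ segment ℝ a w := by
  rw [segment_eq_image_lineMap] at hu hu' ⊢
  obtain ⟨s, hs, rfl⟩ := hu
  obtain ⟨t, ht, hts⟩ := hu'
  rw [AffineMap.lineMap_apply, vsub_eq_sub, vadd_eq_add] at hne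
  rw [AffineMap.lineMap_apply, AffineMap.lineMap_apply, vsub_eq_sub, vsub_eq_sub, vadd_eq_add,
    vadd_eq_add] at hts
  have hs0 : s ≠ 0 := by rintro rfl; simp at hne
  have hspos : 0 < s := lt_of_le_of_ne hs.1 hs0.symm
  have e : t • (w - a) = s • (z - a) := add_right_cancel hts
  have hwa : 0 < ‖w - a‖ := by
    rw [norm_pos_iff]
    intro h0
    rw [h0, smul_zero] at e
    apply hne
    rw [← e, zero_add]
  have e2 : t * ‖w - a‖ = s * ‖z - a‖ := by
    have := congrArg norm e
    rwa [norm_smul, norm_smul, Real.norm_of_nonneg hs.1, Real.norm_of_nonneg ht.1] at this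
  rw [dist_eq_norm, dist_eq_norm] at hd
  refine ⟨t / s, ⟨div_nonneg ht.1 hs.1, ?_⟩, ?_⟩
  · rw [div_le_one hspos]
    by_contra hlt
    push Not at hlt
    nlinarith
  · rw [AffineMap.lineMap_apply, vsub_eq_sub, vadd_eq_add, div_eq_inv_mul, mul_smul, e, smul_smul,
      inv_mul_cancel₀ hs0, one_smul, sub_add_cancel]

/-- The points of `X` accessible from `G` by a continuum. -/
def accessible (X G : Set ℂ) : Set ℂ :=
  {v | v ∈ X ∧ ∃ R, IsCompact R ∧ IsPreconnected R ∧ v ∈ R ∧ R \ {v} ⊆ G ∧ (R \ {v}).Nonempty}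

lemma accessible_mono {X G G' : Set ℂ} (h : G ⊆ G') : accessible X G ⊆ accessible X G' := by
  rintro v ⟨hv, R, h1, h2, h3, h4, h5⟩
  exact ⟨hv, R, h1, h2, h3, h4.trans h, h5⟩

lemma accessible_subset_closure {X G : Set ℂ} : accessible X G ⊆ closure G := by
  rintro v ⟨hv, R, h1, h2, h3, h4, h5⟩
  refine closure_mono h4 ?_
  have hR : R.Nontrivial := by
    obtain ⟨z, hz⟩ := h5
    exact ⟨v, h3, z, hz.1, fun h => hz.2 h.symm⟩
  by_contra hcon
  rw [mem_closure_iff_nhds] at hcon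
  push Not at hcon
  obtain ⟨t, ht, he⟩ := hcon
  obtain ⟨O, hOt, hO, hvO⟩ := mem_nhds_iff.1 ht
  obtain ⟨z, hz⟩ := h5
  obtain ⟨y, hy, hy1, hy2⟩ := h2 O {v}ᶜ hO isOpen_compl_singleton
    (fun y hy => by
      by_cases hyv : y = v
      · exact Or.inl (hyv ▸ hvO)
      · exact Or.inr hyv) ⟨v, h3, hvO⟩ ⟨z, hz.1, hz.2⟩
  have : y ∈ t ∩ (R \ {v}) := ⟨hOt hy1, hy, hy2⟩
  rw [he] at this
  exact this

section

variable {X E : Set ℂ} {p : ℂ} {A : ℂ → Set ℂ} {w b b' : ℂ}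

namespace RootedArcs

/-- Every crosscut cuts off a bounded domain. -/
lemma exists_lobe (h : RootedArcs X E p A) (hc : IsCrosscut X w b b') :
    ∃ G, IsLobe X (spokes w b b') G := by
  have hcpt := h.isCompact.union (isCompact_spokes w b b')
  suffices hsuff : ∃ t₁ t₂, t₁ ∉ X ∪ spokes w b b' ∧ t₂ ∉ X ∪ spokes w b b' ∧
      ¬ HasLog (X ∪ spokes w b b') (fun z => (z - t₁) / (z - t₂)) by
    obtain ⟨t₁, t₂, h1, h2, h3⟩ := hsuff
    by_cases hb1 : Bornology.IsBounded (connectedComponentIn (X ∪ spokes w b b')ᶜ t₁)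
    · exact ⟨_, isLobe_of_component h1 hb1⟩
    by_cases hb2 : Bornology.IsBounded (connectedComponentIn (X ∪ spokes w b b')ᶜ t₂)
    · exact ⟨_, isLobe_of_component h2 hb2⟩
    refine absurd (HasLog.of_isPreconnected hcpt isPreconnected_connectedComponentIn ?_
      (mem_connectedComponentIn h1) (mem_component_of_not_isBounded hcpt h2 hb1 hb2)) h3
    exact disjoint_left.2 fun z hz hz' => connectedComponentIn_subset _ _ hz' hz
  have hbw : b ≠ w := by rintro rfl; exact hc.notMem hc.left.1
  set u := w - b with hu
  have hu0 : u ≠ 0 := sub_ne_zero.2 hbw.symm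
  have hun : 0 < ‖u‖ := norm_pos_iff.2 hu0
  set m := b + u / 2 with hm
  set γ : ℝ → ℂ := fun x => m + x * u with hγ
  have hγc : Continuous γ := by fun_prop
  have hγseg : ∀ x : ℝ, x ∈ Icc (-1 / 2 : ℝ) (1 / 2) → γ x ∈ segment ℝ b w := by
    intro x hx
    rw [segment_eq_image_lineMap]
    refine ⟨x + 1 / 2, ⟨by linarith [hx.1], by linarith [hx.2]⟩, ?_⟩
    rw [AffineMap.lineMap_apply]
    simp only [hγ, hm, hu, vsub_eq_sub, vadd_eq_add, Complex.real_smul]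
    push_cast
    ring
  have hsegγ : ∀ z ∈ segment ℝ b w, ∃ x : ℝ, z = γ x := by
    intro z hz
    rw [segment_eq_image_lineMap] at hz
    obtain ⟨s, hs, rfl⟩ := hz
    refine ⟨s - 1 / 2, ?_⟩
    rw [AffineMap.lineMap_apply]
    simp only [hγ, hm, hu, vsub_eq_sub, vadd_eq_add, Complex.real_smul]
    push_cast
    ring
  have hγb : γ (-1 / 2) = b := by simp only [hγ, hm]; push_cast; ring
  have hγw : γ (1 / 2) = w := by simp only [hγ, hm, hu]; push_cast; ring
  have hγ0 : γ 0 = m := by simp [hγ]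
  have hγinj : ∀ x y : ℝ, γ x = γ y → x = y := by
    intro x y hxy
    have : (x : ℂ) * u = y * u := add_left_cancel hxy
    exact_mod_cast mul_right_cancel₀ hu0 this
  have hms : m ∈ segment ℝ b w := by rw [← hγ0]; exact hγseg 0 (by norm_num)
  have hmb : m ≠ b := by
    rw [← hγ0, ← hγb]; intro h'; have := hγinj _ _ h'; norm_num at this
  have hmw : m ≠ w := by
    rw [← hγ0, ← hγw]; intro h'; have := hγinj _ _ h'; norm_num at this
  have hmX : m ∉ X := fun h' => hmb (eq_of_mem_segment_of_mem hc.left hms h')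
  have hms' : m ∉ segment ℝ b' w := fun h' => hmw (by
    have : m ∈ ({w} : Set ℂ) := by rw [← hc.segments_inter]; exact ⟨hms, h'⟩
    exact this)
  obtain ⟨r, hr, hball⟩ := Metric.isOpen_iff.1
    (h.isCompact.union (isCompact_segment b' w)).isClosed.isOpen_compl m
    (by rintro (h' | h'); exacts [hmX h', hms' h'])
  set η := r / (2 * ‖u‖) with hη
  have hηpos : 0 < η := by positivity
  have hηu : η * ‖u‖ = r / 2 := by rw [hη]; field_simp
  have hfar : ∀ z, z ∈ X ∪ segment ℝ b' w → η < ‖(z - m) / u‖ := by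
    intro z hz
    have : r ≤ dist z m := not_lt.1 fun h' => hball h' hz
    rw [norm_div, lt_div_iff₀ hun, hηu, ← dist_eq_norm]
    linarith
  have hreal : ∀ x : ℝ, (γ x - m) / u = x := by
    intro x
    simp only [hγ]
    field_simp
    ring
  set t₁ := m + η * Complex.I * u with ht₁
  set t₂ := m - η * Complex.I * u with ht₂
  have hnot : ∀ t : ℂ, ‖(t - m) / u‖ = η → ((t - m) / u).im ≠ 0 → t ∉ X ∪ spokes w b b' := by
    rintro t h1 h2 (h3 | h3 | h3)
    · exact (hfar t (Or.inl h3)).ne' h1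
    · obtain ⟨x, rfl⟩ := hsegγ t h3
      rw [hreal] at h2
      simp at h2
    · exact (hfar t (Or.inr h3)).ne' h1
  have e₁ : (t₁ - m) / u = η * Complex.I := by rw [ht₁]; field_simp; ring
  have e₂ : (t₂ - m) / u = -(η * Complex.I) := by rw [ht₂]; field_simp; ring
  refine ⟨t₁, t₂, hnot t₁ ?_ ?_, hnot t₂ ?_ ?_, ?_⟩
  · rw [e₁]; simp [abs_of_pos hηpos]
  · rw [e₁]; simp [hηpos.ne']
  · rw [e₂]; simp [abs_of_pos hηpos]
  · rw [e₂]; simp [hηpos.ne']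
  rintro ⟨l, hl, hle⟩
  set f : ℂ → ℂ := fun z => (z - t₁) / (z - t₂) with hf
  have hfeq : ∀ z, f z = ((z - m) / u - η * Complex.I) / ((z - m) / u + η * Complex.I) := by
    intro z
    have a1 : z - t₁ = u * ((z - m) / u - η * Complex.I) := by rw [ht₁]; field_simp; ring
    have a2 : z - t₂ = u * ((z - m) / u + η * Complex.I) := by rw [ht₂]; field_simp; ring
    simp only [hf]
    rw [a1, a2, mul_div_mul_left _ _ hu0]
  set S := (X ∪ γ '' Ico (-1 / 2) 0) ∪ (segment ℝ b' w ∪ γ '' Ioc 0 (1 / 2)) with hS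
  have hSp : IsPreconnected S := by
    refine IsPreconnected.union b' (Or.inl hc.right.1) (Or.inl (left_mem_segment _ _ _)) ?_ ?_
    · exact h.isPreconnected.union b hc.left.1 ⟨-1 / 2, by norm_num, hγb⟩
        (isPreconnected_Ico.image _ hγc.continuousOn)
    · exact (convex_segment _ _).isPreconnected.union w (right_mem_segment _ _ _)
        ⟨1 / 2, by norm_num, hγw⟩ (isPreconnected_Ioc.image _ hγc.continuousOn)
  have hSV : S ⊆ X ∪ spokes w b b' := by
    rintro z ((hz | ⟨x, hx, rfl⟩) | (hz | ⟨x, hx, rfl⟩))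
    · exact Or.inl hz
    · exact Or.inr (Or.inl (hγseg x ⟨hx.1, by linarith [hx.2]⟩))
    · exact Or.inr (Or.inr hz)
    · exact Or.inr (Or.inl (hγseg x ⟨by linarith [hx.1], hx.2⟩))
  have hslit : ∀ z ∈ S, f z ∈ Complex.slitPlane := by
    intro z hz
    rw [hfeq]
    refine ratio_mem_slitPlane hηpos ?_
    rcases hz with ((hz | ⟨x, hx, rfl⟩) | (hz | ⟨x, hx, rfl⟩))
    · exact Or.inr (hfar z (Or.inl hz))
    · rw [hreal]; left; simpa using hx.2.ne
    · exact Or.inr (hfar z (Or.inr hz))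
    · rw [hreal]; left; simpa using hx.1.ne'
  have hfc : ContinuousOn f S := by
    refine ContinuousOn.div (by fun_prop) (by fun_prop) fun z hz h0 => ?_
    have := Complex.slitPlane_ne_zero (hslit z hz)
    apply this
    simp [hf, h0]
  have hconst := fun x y (hx : x ∈ S) (hy : y ∈ S) => log_sub_eq hSp (hl.mono hSV)
    (hfc.clog hslit) (fun z hz => by
      rw [hle z (hSV hz), Complex.exp_log (Complex.slitPlane_ne_zero (hslit z hz))]) hx hy
  set c := l b - Complex.log (f b) with hcdef
  have hbS : b ∈ S := Or.inl (Or.inl hc.left.1)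
  have hgc : ContinuousOn (fun x => l (γ x) - c) (Icc (-1 / 2 : ℝ) (1 / 2)) :=
    (hl.comp hγc.continuousOn fun x hx => Or.inr (Or.inl (hγseg x hx))).sub continuousOn_const
  refine not_continuousAt_log_ratio hηpos
    (hgc.continuousAt (Icc_mem_nhds (by norm_num) (by norm_num))) (r := 1 / 2) (by norm_num) ?_
  intro x hx hxr
  rw [abs_lt] at hxr
  have hxS : γ x ∈ S := by
    rcases lt_or_gt_of_ne hx with hx' | hx'
    · exact Or.inl (Or.inr ⟨x, ⟨by linarith [hxr.1], hx'⟩, rfl⟩)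
    · exact Or.inr (Or.inr ⟨x, ⟨hx', by linarith [hxr.2]⟩, rfl⟩)
  have := hconst _ _ hxS hbS
  have h2 := hfeq (γ x)
  rw [hreal] at h2
  rw [← h2, hcdef, ← this]
  ring

lemma segment_diff_subset_lobe (hc : IsCrosscut X w b b') {G : Set ℂ}
    (hG : IsLobe X (spokes w b b') G) {z a : ℂ} (hz : z ∈ G) (ha : a ∈ nearest X z)
    (hzw : Metric.infDist z X ≤ Metric.infDist w X) : segment ℝ a z \ {a} ⊆ G := by
  have hza : z ≠ a := by rintro rfl; exact hG.notMem hz ha.1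
  refine hG.subset_of_isPreconnected (isPreconnected_segment_diff a z)
    ⟨right_mem_segment _ _ _, hza⟩ hz ?_
  have key : ∀ c ∈ nearest X w, segment ℝ c w ⊆ spokes w b b' →
      ∀ u ∈ segment ℝ a z \ {a}, u ∉ segment ℝ c w := by
    intro c hcn hcs u hu hcu
    by_cases huz : u = z
    · subst huz
      exact hG.notMem_cut hz (hcs hcu)
    · have hca : c = a := nearest_unique ha hu.1 huz (nearest_of_mem_segment hcn hcu)
      subst hca
      exact hG.notMem_cut hz (hcs (mem_segment_of_common hu.1 hcu hu.2
        (by rw [ha.2, hcn.2]; exact hzw)))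
  rintro u hu (h1 | h1 | h1)
  · exact hu.2 (eq_of_mem_segment_of_mem ha hu.1 h1)
  · exact key b hc.left subset_union_left u hu h1
  · exact key b' hc.right subset_union_right u hu h1

lemma nearest_subset_accessible (hc : IsCrosscut X w b b') {G : Set ℂ}
    (hG : IsLobe X (spokes w b b') G) {z : ℂ} (hz : z ∈ G)
    (hzw : Metric.infDist z X ≤ Metric.infDist w X) : nearest X z ⊆ accessible X G := by
  intro a ha
  refine ⟨ha.1, segment ℝ a z, isCompact_segment _ _, (convex_segment _ _).isPreconnected,
    left_mem_segment _ _ _, segment_diff_subset_lobe hc hG hz ha hzw, z,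
      right_mem_segment _ _ _, ?_⟩
  rintro rfl
  exact hG.notMem hz ha.1

/-- Lobes of crosscuts inside a lobe are contained in it. -/
lemma lobe_subset_lobe (h : RootedArcs X E p A) (hc : IsCrosscut X w b b') {G : Set ℂ}
    (hG : IsLobe X (spokes w b b') G) {V G₁ : Set ℂ} (hVG : ∀ z ∈ V, z ∉ X → z ∈ G)
    (hG₁ : IsLobe X V G₁) : G₁ ⊆ G := by
  intro t ht
  by_contra htG
  obtain ⟨s, hs, hsu⟩ := exists_unbounded_component (h.isCompact.union (isCompact_spokes w b b'))
  obtain ⟨g, hg⟩ := hG.2.1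
  have htX : t ∉ X := hG₁.notMem ht
  have hwV : w ∈ spokes w b b' \ X := ⟨Or.inl (right_mem_segment _ _ _), hc.notMem⟩
  have key : ∀ q, q ∉ X ∪ spokes w b b' → q ∉ G → ∃ W, IsPreconnected W ∧ w ∈ W ∧
      connectedComponentIn (X ∪ spokes w b b')ᶜ q ⊆ W ∧ spokes w b b' \ X ⊆ W ∧
      ∀ z ∈ W, z ∉ X ∪ V := by
    intro q hq hqG
    have hgq : g ∉ connectedComponentIn (X ∪ spokes w b b')ᶜ q := fun h' => hqG (by
      rw [(hG.2.2 g hg).2, ← connectedComponentIn_eq h']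
      exact mem_connectedComponentIn hq)
    refine ⟨connectedComponentIn (X ∪ spokes w b b')ᶜ q ∪ (spokes w b b' \ X), ?_, Or.inr hwV,
      subset_union_left, subset_union_right, ?_⟩
    · refine isPreconnected_connectedComponentIn.subset_closure subset_union_left
        (union_subset subset_closure ?_)
      exact sdiff_subset.trans (h.spokes_subset_closure hc hq (hG.2.2 g hg).1 hgq)
    · rintro z (hz | hz) (hz' | hz')
      · exact connectedComponentIn_subset _ _ hz (Or.inl hz')
      · have hzX : z ∉ X := fun h' => connectedComponentIn_subset _ _ hz (Or.inl h')
        have hzG := hVG z hz' hzX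
        apply hgq
        rw [connectedComponentIn_eq hz, ← (hG.2.2 z hzG).2]
        exact hg
      · exact hz.2 hz'
      · exact hG.notMem_cut (hVG z hz' hz.2) hz.1
  have hsG : s ∉ G := fun h' => hsu (by rw [← (hG.2.2 s h').2]; exact hG.1)
  obtain ⟨W, hW, hwW, hsW, hVW, hWn⟩ := key s hs hsG
  have hfin : ∃ S, IsPreconnected S ∧ t ∈ S ∧ W ⊆ S ∧ ∀ z ∈ S, z ∉ X ∪ V := by
    by_cases htV : t ∈ spokes w b b'
    · exact ⟨W, hW, hVW ⟨htV, htX⟩, Subset.rfl, hWn⟩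
    · have htn : t ∉ X ∪ spokes w b b' := by rintro (h' | h'); exacts [htX h', htV h']
      obtain ⟨W', hW', hwW', htW', -, hWn'⟩ := key t htn htG
      refine ⟨W ∪ W', hW.union w hwW hwW' hW', Or.inr (htW' (mem_connectedComponentIn htn)),
        subset_union_left, ?_⟩
      rintro z (hz | hz)
      exacts [hWn z hz, hWn' z hz]
  obtain ⟨S, hS, htS, hWS, hSn⟩ := hfin
  exact hsu (hG₁.1.subset ((hsW.trans hWS).trans (hG₁.subset_of_isPreconnected hS htS ht hSn)))

/-- The next crosscut inside a lobe whose accessible points split into two classes. -/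
lemma exists_inner_crosscut (h : RootedArcs X E p A) (hc : IsCrosscut X w b b') {G : Set ℂ}
    (hG : IsLobe X (spokes w b b') G) {U U' Z : Set ℂ} (hU : IsOpen U) (hU' : IsOpen U')
    (hZ : {b, b'} ∪ accessible X G ⊆ Z) (hcov : Z ⊆ U ∪ U') (hdisj : Z ∩ (U ∩ U') = ∅)
    (h1 : (({b, b'} ∪ accessible X G) ∩ U).Nonempty)
    (h2 : (({b, b'} ∪ accessible X G) ∩ U').Nonempty) {δ : ℝ} (hδ : 0 < δ) :
    ∃ w₁ c d G₁, IsCrosscut X w₁ c d ∧ w₁ ∈ G ∧ Metric.infDist w₁ X < δ ∧ c ∈ U ∧ d ∈ U' ∧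
      (∀ z ∈ spokes w₁ c d, z ∉ X → z ∈ G) ∧ IsLobe X (spokes w₁ c d) G₁ ∧ G₁ ⊆ G ∧
      {c, d} ∪ accessible X G₁ ⊆ {b, b'} ∪ accessible X G := by
  have hXne : X.Nonempty := ⟨p, h.root_mem⟩
  set κ := min δ (Metric.infDist w X) with hκ
  have hκpos : 0 < κ := lt_min hδ hc.infDist_pos
  have hcon := h.isPreconnected_lobe_inter_thickening hc hG hκpos (min_le_right _ _)
  have hinf : ∀ z, z ∈ Metric.thickening κ X ↔ Metric.infDist z X < κ := fun z => by
    rw [Metric.mem_thickening_iff, ← Metric.infDist_lt_iff hXne]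
  have hnear : ∀ z ∈ G ∩ Metric.thickening κ X, nearest X z ⊆ accessible X G := fun z hz =>
    nearest_subset_accessible hc hG hz.1 (((hinf z).1 hz.2).le.trans (min_le_right _ _))
  have hcl : ∀ v ∈ {b, b'} ∪ accessible X G, v ∈ X ∧ v ∈ closure G := by
    rintro v ((rfl | rfl) | hv)
    · exact ⟨hc.left.1, h.spokes_subset_closure_lobe hc hG (Or.inl (left_mem_segment _ _ _))⟩
    · exact ⟨hc.right.1, h.spokes_subset_closure_lobe hc hG (Or.inr (left_mem_segment _ _ _))⟩
    · exact ⟨hv.1, accessible_subset_closure hv⟩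
  have hhit : ∀ O, IsOpen O → (({b, b'} ∪ accessible X G) ∩ O).Nonempty →
      ∃ z ∈ G ∩ Metric.thickening κ X, (nearest X z ∩ O).Nonempty := by
    rintro O hO ⟨v, hv, hvO⟩
    obtain ⟨hvX, hvG⟩ := hcl v hv
    obtain ⟨r, hr, hrO⟩ := Metric.isOpen_iff.1 hO v hvO
    obtain ⟨z, hz, hvz⟩ := Metric.mem_closure_iff.1 hvG (min κ (r / 2)) (by positivity)
    rw [dist_comm] at hvz
    have hz1 := hvz.trans_le (min_le_left _ _)
    have hz2 := hvz.trans_le (min_le_right _ _)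
    obtain ⟨a, ha⟩ := nearest_nonempty h.isCompact hXne z
    refine ⟨z, ⟨hz, Metric.mem_thickening_iff.2 ⟨v, hvX, hz1⟩⟩, a, ha, hrO ?_⟩
    have := nearest_near hvX ha
    rw [Metric.mem_ball]
    linarith
  obtain ⟨w₁, hw₁, ⟨c, hc1, hcU⟩, ⟨d, hd1, hdU⟩⟩ := exists_nearest_split h.isCompact hXne hcon
    (fun z hz => (hnear z hz).trans (subset_union_right.trans hZ)) hU hU' hcov hdisj
    (hhit U hU h1) (hhit U' hU' h2)
  have hcut : IsCrosscut X w₁ c d := by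
    refine ⟨hG.notMem hw₁.1, hc1, hd1, ?_⟩
    rintro rfl
    have : c ∈ Z ∩ (U ∩ U') := ⟨hZ (Or.inr (hnear _ hw₁ hc1)), hcU, hdU⟩
    rw [hdisj] at this
    exact this
  have hVG : ∀ z ∈ spokes w₁ c d, z ∉ X → z ∈ G := by
    have hle := ((hinf w₁).1 hw₁.2).le.trans (min_le_right _ _)
    rintro z (hz | hz) hzX
    · exact segment_diff_subset_lobe hc hG hw₁.1 hc1 hle
        ⟨hz, by rintro rfl; exact hzX hc1.1⟩
    · exact segment_diff_subset_lobe hc hG hw₁.1 hd1 hle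
        ⟨hz, by rintro rfl; exact hzX hd1.1⟩
  obtain ⟨G₁, hG₁⟩ := h.exists_lobe hcut
  have hsub := h.lobe_subset_lobe hc hG hVG hG₁
  refine ⟨w₁, c, d, G₁, hcut, hw₁.1, ((hinf w₁).1 hw₁.2).trans_le (min_le_left _ _), hcU, hdU,
    hVG, hG₁, hsub, ?_⟩
  rintro v ((rfl | rfl) | hv)
  · exact Or.inr (hnear _ hw₁ hc1)
  · exact Or.inr (hnear _ hw₁ hd1)
  · exact Or.inr (accessible_mono hsub hv)

end RootedArcs
end

lemma IsOpen.exists_isCompact_isPreconnected {O : Set ℂ} (hO : IsOpen O) (hc : IsPreconnected O)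
    {a b : ℂ} (ha : a ∈ O) (hb : b ∈ O) :
    ∃ K ⊆ O, IsCompact K ∧ IsPreconnected K ∧ a ∈ K ∧ b ∈ K := by
  have hp := hO.isConnected_iff_isPathConnected.1 ⟨⟨a, ha⟩, hc⟩
  obtain ⟨γ, hγ⟩ := hp.joinedIn a ha b hb
  exact ⟨range γ, range_subset_iff.2 hγ, isCompact_range γ.continuous,
    isPreconnected_range γ.continuous, ⟨0, γ.source⟩, ⟨1, γ.target⟩⟩

/-- If two points of a disc cannot be joined inside the disc off `X`, then an arc of the bounding
circle together with the arcs from its endpoints to the root separates them. -/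
lemma RootedArcs.exists_circle_cut {X E : Set ℂ} {p : ℂ} {A : ℂ → Set ℂ}
    (h : RootedArcs X E p A) {v w w' : ℂ} {r : ℝ} (hw : w ∈ Metric.ball v r)
    (hw' : w' ∈ Metric.ball v r) (hwX : w ∉ X) (hwX' : w' ∉ X)
    (hno : ¬ ∃ K ⊆ Metric.ball v r \ X, IsCompact K ∧ IsPreconnected K ∧ w ∈ K ∧ w' ∈ K) :
    ∃ s ∈ Icc 0 (2 * Real.pi), ∃ t ∈ Icc 0 (2 * Real.pi), s < t ∧ circleMap v r s ∈ X ∧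
      circleMap v r t ∈ X ∧ (∀ u ∈ Ioo s t, circleMap v r u ∉ X) ∧
      ∀ S, IsPreconnected S → w ∈ S → w' ∈ S → (S ∩ (circleMap v r '' Icc s t ∪
        (A (circleMap v r s) ∪ A (circleMap v r t)))).Nonempty := by
  have hr : 0 < r := Metric.pos_of_mem_ball hw
  set γ := circleMap v r with hγ
  have hγc : Continuous γ := continuous_circleMap v r
  have hγS : ∀ u, γ u ∈ Metric.sphere v r := circleMap_mem_sphere v hr.le
  have hSball : Disjoint (Metric.sphere v r) (Metric.ball v r) := Metric.sphere_disjoint_ball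
  have hScpt : IsCompact (Metric.sphere v r) := isCompact_sphere v r
  set f : ℂ → ℂ := fun z => (z - w) / (z - w') with hf
  have hwS : w ∉ X ∪ Metric.sphere v r := by
    rintro (h' | h'); exacts [hwX h', disjoint_left.1 hSball h' hw]
  have hwS' : w' ∉ X ∪ Metric.sphere v r := by
    rintro (h' | h'); exacts [hwX' h', disjoint_left.1 hSball h' hw']
  have hopen : IsOpen (X ∪ Metric.sphere v r)ᶜ := (h.isCompact.union hScpt).isClosed.isOpen_compl
  have hlog : ¬ HasLog (X ∪ Metric.sphere v r) f := by
    intro hl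
    have hmem := mem_component_of_hasLog (h.isCompact.union hScpt) hwS hwS' hl
    obtain ⟨K, hK, hKc, hKp, h1, h2⟩ := hopen.connectedComponentIn
      |>.exists_isCompact_isPreconnected isPreconnected_connectedComponentIn
      (mem_connectedComponentIn hwS) hmem
    have hKd : ∀ z ∈ K, z ∉ X ∪ Metric.sphere v r := fun z hz =>
      connectedComponentIn_subset _ _ (hK hz)
    refine hno ⟨K, fun z hz => ⟨?_, fun h' => hKd z hz (Or.inl h')⟩, hKc, hKp, h1, h2⟩
    by_contra hzb
    obtain ⟨u, hu, huf⟩ := frontier_inter_nonempty hKp h1 hw hz hzb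
    rw [frontier_ball _ hr.ne'] at huf
    exact hKd u hu (Or.inr huf)
  obtain ⟨k, hk, hek⟩ : HasLog X f := (h.hasLog hwX).div (h.hasLog hwX')
  obtain ⟨l, hl, hel⟩ : HasLog (Metric.sphere v r) f :=
    HasLog.of_isPreconnected hScpt (convex_ball v r).isPreconnected hSball hw hw'
  set g : ℝ → ℂ := fun u => k (γ u) - l (γ u) with hg
  set T := Icc 0 (2 * Real.pi) ∩ γ ⁻¹' X with hT
  have hTc : IsCompact T := isCompact_Icc.inter_right (h.isCompact.isClosed.preimage hγc)
  have hgc : ContinuousOn g T :=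
    (hk.comp hγc.continuousOn fun u hu => hu.2).sub
      (hl.comp hγc.continuousOn fun u _ => hγS u)
  have hgexp : ∀ u ∈ T, Complex.exp (g u) = 1 := fun u hu => by
    rw [hg]
    simp only
    rw [Complex.exp_sub, hek _ hu.2, ← hel _ (hγS u), div_self (Complex.exp_ne_zero _)]
  have hgap : ∀ u ∈ T, ∀ u' ∈ T, g u ≠ g u' → 1 ≤ ‖g u - g u'‖ := by
    intro u hu u' hu' hne
    have hexp : Complex.exp (g u - g u') = 1 := by
      rw [Complex.exp_sub, hgexp u hu, hgexp u' hu', div_one]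
    obtain ⟨n, hn⟩ := Complex.exp_eq_one_iff.1 hexp
    have hn0 : n ≠ 0 := by
      rintro rfl
      rw [Int.cast_zero, zero_mul, sub_eq_zero] at hn
      exact hne hn
    rw [hn]
    have h1 : (1 : ℝ) ≤ |(n : ℝ)| := by exact_mod_cast Int.one_le_abs hn0
    have h2 := Real.pi_gt_three
    simp only [norm_mul, Complex.norm_intCast, Complex.norm_real, Complex.norm_I,
      Complex.norm_ofNat, mul_one, Real.norm_eq_abs, abs_of_pos Real.pi_pos]
    nlinarith
  set P := (T ×ˢ T) ∩ {q : ℝ × ℝ | 1 ≤ ‖g q.1 - g q.2‖} with hP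
  have hPc : IsCompact P := by
    refine (hTc.prod hTc).of_isClosed_subset ?_ inter_subset_left
    have hcont : ContinuousOn (fun q : ℝ × ℝ => ‖g q.1 - g q.2‖) (T ×ˢ T) :=
      ((hgc.comp continuousOn_fst fun q hq => hq.1).sub
        (hgc.comp continuousOn_snd fun q hq => hq.2)).norm
    exact hcont.preimage_isClosed_of_isClosed (hTc.prod hTc).isClosed isClosed_Ici
  have hPne : P.Nonempty := by
    by_contra hemp
    refine hlog (HasLog.glue h.isCompact.isClosed hScpt.isClosed hk hek hl hel ?_)
    intro x hx y hy
    by_contra hne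
    have hsurj : ∀ z ∈ Metric.sphere v r, ∃ u ∈ Icc 0 (2 * Real.pi), γ u = z := by
      intro z hz
      rw [← abs_of_pos hr, ← image_circleMap_Ioc] at hz
      obtain ⟨u, hu, rfl⟩ := hz
      exact ⟨u, Ioc_subset_Icc_self hu, rfl⟩
    obtain ⟨a, ha, rfl⟩ := hsurj x hx.2
    obtain ⟨b, hb, rfl⟩ := hsurj y hy.2
    exact hemp ⟨(a, b), ⟨⟨ha, hx.1⟩, ⟨hb, hy.1⟩⟩, hgap a ⟨ha, hx.1⟩ b ⟨hb, hy.1⟩ hne⟩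
  obtain ⟨⟨s₀, t₀⟩, hst₀, hmin₀⟩ := hPc.exists_isMinOn hPne
    (f := fun q : ℝ × ℝ => dist q.1 q.2) (by fun_prop)
  obtain ⟨s, t, hle, hst, hmin⟩ : ∃ s t, s ≤ t ∧ (s, t) ∈ P ∧ ∀ q ∈ P, dist s t ≤ dist q.1 q.2 := by
    rcases le_total s₀ t₀ with hle | hle
    · exact ⟨s₀, t₀, hle, hst₀, fun q hq => hmin₀ hq⟩
    · refine ⟨t₀, s₀, hle, ⟨⟨hst₀.1.2, hst₀.1.1⟩, ?_⟩, fun q hq => ?_⟩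
      · have := hst₀.2
        simp only [mem_ofPred_eq] at this ⊢
        rwa [norm_sub_rev]
      · rw [dist_comm]; exact hmin₀ hq
  obtain ⟨⟨hs, ht⟩, hgst⟩ := hst
  change 1 ≤ ‖g s - g t‖ at hgst
  have hgne : g s ≠ g t := by
    intro h'
    rw [h', sub_self, norm_zero] at hgst
    linarith
  have hlt : s < t := lt_of_le_of_ne hle fun h' => hgne (by rw [h'])
  refine ⟨s, hs.1, t, ht.1, hlt, hs.2, ht.2, ?_, ?_⟩
  · intro u hu huX
    have huT : u ∈ T := ⟨⟨hs.1.1.trans hu.1.le, hu.2.le.trans ht.1.2⟩, huX⟩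
    by_cases hgu : g s = g u
    · have hne : g u ≠ g t := hgu ▸ hgne
      have h2 := hmin (u, t) ⟨⟨huT, ht⟩, hgap u huT t ht hne⟩
      simp only [Real.dist_eq] at h2
      rw [abs_of_neg (by linarith [hu.1, hu.2]), abs_of_neg (by linarith [hu.1, hu.2])] at h2
      linarith [hu.1]
    · have h2 := hmin (s, u) ⟨⟨hs, huT⟩, hgap s hs u huT hgu⟩
      simp only [Real.dist_eq] at h2
      rw [abs_of_neg (by linarith [hu.1, hu.2]), abs_of_neg (by linarith [hu.1, hu.2])] at h2
      linarith [hu.2]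
  · intro S hS hwS hwS'
    by_contra hemp
    rw [not_nonempty_iff_eq_empty] at hemp
    have hA : A (γ s) ∪ A (γ t) ⊆ X := union_subset (h.arc_subset _ hs.2) (h.arc_subset _ ht.2)
    have hcpt : IsCompact (γ '' Icc s t ∪ (A (γ s) ∪ A (γ t))) :=
      (isCompact_Icc.image hγc).union ((h.arc_isCompact _ hs.2).union (h.arc_isCompact _ ht.2))
    obtain ⟨m, hm, hem⟩ := HasLog.of_isPreconnected hcpt hS
      (by rw [disjoint_iff_inter_eq_empty, inter_comm]; exact hemp) hwS hwS'
    have hIS : γ '' Icc s t ⊆ Metric.sphere v r := by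
      rintro _ ⟨u, -, rfl⟩; exact hγS u
    have e1 := log_sub_eq (isPreconnected_Icc.image γ hγc.continuousOn)
      (hm.mono subset_union_left) (hl.mono hIS)
      (fun z hz => by rw [hem z (Or.inl hz), hel z (hIS hz)])
      (mem_image_of_mem γ (left_mem_Icc.2 hle)) (mem_image_of_mem γ (right_mem_Icc.2 hle))
    have e2 := log_sub_eq (h.union_arc_isPreconnected hs.2 ht.2)
      (hm.mono subset_union_right) (hk.mono hA)
      (fun z hz => by rw [hem z (Or.inr hz), hek z (hA hz)])
      (Or.inl (h.self_mem_arc _ hs.2)) (Or.inr (h.self_mem_arc _ ht.2))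
    apply hgne
    simp only [hg]
    linear_combination e1 - e2

lemma eventually_spokes_subset_ball {X : Set ℂ} {w c d : ℕ → ℂ}
    (hc : ∀ n, IsCrosscut X (w n) (c n) (d n)) {v : ℂ} (hv : v ∈ X)
    (hlim : Tendsto w atTop (𝓝 v)) {ρ : ℝ} (hρ : 0 < ρ) :
    ∀ᶠ n in atTop, spokes (w n) (c n) (d n) ⊆ Metric.ball v ρ := by
  filter_upwards [hlim.eventually (Metric.ball_mem_nhds v (half_pos hρ))] with n hn
  have h1 := nearest_near hv (hc n).left
  have h2 := nearest_near hv (hc n).right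
  refine spokes_subset_ball ?_ ?_ ?_ <;> rw [Metric.mem_ball] <;> linarith

namespace RootedArcs

variable {X E : Set ℂ} {p : ℂ} {A : ℂ → Set ℂ}

/-- Vertices of a convergent nested sequence of crosscuts can eventually be joined off `X` near
the limit. -/
lemma eventually_joined (h : RootedArcs X E p A) {w c d : ℕ → ℂ} {G : ℕ → Set ℂ}
    (hc : ∀ n, IsCrosscut X (w n) (c n) (d n))
    (hG : ∀ n, IsLobe X (spokes (w n) (c n) (d n)) (G n)) (hw : ∀ n, w (n + 1) ∈ G n)
    (hmono : ∀ n, G (n + 1) ⊆ G n) {v : ℂ} (hv : v ∈ X) (hlim : Tendsto w atTop (𝓝 v))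
    {r : ℝ} (hr : 0 < r) :
    ∀ᶠ n in atTop, ∃ K ⊆ Metric.ball v r \ X, IsCompact K ∧ IsPreconnected K ∧
      w (n + 1) ∈ K ∧ w (n + 2) ∈ K := by
  by_contra hcon
  have hlim1 : Tendsto (fun n => w (n + 1)) atTop (𝓝 v) := (tendsto_add_atTop_iff_nat 1).2 hlim
  have hlim2 : Tendsto (fun n => w (n + 2)) atTop (𝓝 v) := (tendsto_add_atTop_iff_nat 2).2 hlim
  obtain ⟨φ, hφ, hbad⟩ := extraction_of_frequently_atTop
    ((not_eventually.1 hcon).and_eventually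
    ((hlim1.eventually (Metric.ball_mem_nhds v hr)).and
      ((hlim2.eventually (Metric.ball_mem_nhds v hr)).and
        (eventually_spokes_subset_ball hc hv hlim hr))))
  choose s hs t ht hst hsX htX hoff hcut using fun k => h.exists_circle_cut (hbad k).2.1
    (hbad k).2.2.1 (hc _).notMem (hc _).notMem (hbad k).1
  set γ := circleMap v r with hγ
  have hγc : Continuous γ := continuous_circleMap v r
  have hγS : ∀ u, γ u ∈ Metric.sphere v r := circleMap_mem_sphere v hr.le
  have hIG : ∀ k, γ '' Ioo (s k) (t k) ⊆ G (φ k) := by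
    intro k
    obtain ⟨z, hzG, hz⟩ := hcut k (G (φ k)) (hG _).isPreconnected (hw _) (hmono _ (hw _))
    have hzX := (hG _).notMem hzG
    have hzI : z ∈ γ '' Ioo (s k) (t k) := by
      rcases hz with ⟨u, hu, rfl⟩ | hz | hz
      · refine ⟨u, ⟨lt_of_le_of_ne hu.1 ?_, lt_of_le_of_ne hu.2 ?_⟩, rfl⟩
        · rintro rfl; exact hzX (hsX k)
        · rintro rfl; exact hzX (htX k)
      · exact absurd (h.arc_subset _ (hsX k) hz) hzX
      · exact absurd (h.arc_subset _ (htX k) hz) hzX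
    refine (hG _).subset_of_isPreconnected (isPreconnected_Ioo.image γ hγc.continuousOn) hzI hzG ?_
    rintro _ ⟨u, hu, rfl⟩ (h' | h')
    · exact hoff k u hu h'
    · exact disjoint_left.1 Metric.sphere_disjoint_ball (hγS u) ((hbad k).2.2.2 h')
  have hthick : ∀ ε > 0, ∀ᶠ k in atTop, G (φ k) ⊆ Metric.thickening ε (A v) := by
    intro ε hε
    obtain ⟨η, hη, henc⟩ := h.exists_enclosure hv hε
    filter_upwards [hφ.tendsto_atTop.eventually
      (eventually_spokes_subset_ball hc hv hlim hη)] with k hk z hz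
    refine henc _ _ _ (isCompact_spokes _ _ _) hk (hc _).spokes_inter z ((hG _).2.2 z hz).1 ?_
    rw [← ((hG _).2.2 z hz).2]
    exact (hG _).1
  have hAc : IsClosed (A v) := (h.arc_isCompact v hv).isClosed
  have hmemA : ∀ (z : ℕ → ℂ) (y : ℂ) (ψ : ℕ → ℕ), Tendsto ψ atTop atTop →
      Tendsto z atTop (𝓝 y) → (∀ᶠ k in atTop, z k ∈ G (φ (ψ k))) → y ∈ A v := by
    intro z y ψ hψ hz hzG
    rw [← hAc.closure_eq, Metric.mem_closure_iff]
    intro ε hε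
    obtain ⟨k, h1, h2, h3⟩ := (hzG.and ((hψ.eventually (hthick (ε / 2) (half_pos hε))).and
      (hz.eventually (Metric.ball_mem_nhds y (half_pos hε))))).exists
    obtain ⟨a, ha, haz⟩ := Metric.mem_thickening_iff.1 (h2 h1)
    refine ⟨a, ha, ?_⟩
    have := dist_triangle_left y a (z k)
    linarith
  obtain ⟨⟨s₀, t₀⟩, -, ψ, hψ, hψl⟩ := (isCompact_Icc.prod isCompact_Icc).tendsto_subseq
    (x := fun k => (s k, t k)) (fun k => ⟨hs k, ht k⟩)
  have hsl : Tendsto (fun k => s (ψ k)) atTop (𝓝 s₀) := (continuous_fst.tendsto _).comp hψl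
  have htl : Tendsto (fun k => t (ψ k)) atTop (𝓝 t₀) := (continuous_snd.tendsto _).comp hψl
  have hst₀ : s₀ ≤ t₀ := le_of_tendsto_of_tendsto' hsl htl fun k => (hst _).le
  have hmidl : Tendsto (fun k => γ ((s (ψ k) + t (ψ k)) / 2)) atTop (𝓝 (γ ((s₀ + t₀) / 2))) :=
    (hγc.tendsto _).comp ((hsl.add htl).div_const 2)
  have hmidA : γ ((s₀ + t₀) / 2) ∈ A v := hmemA _ _ ψ hψ.tendsto_atTop hmidl
    (Eventually.of_forall fun k => hIG _ ⟨_, ⟨by linarith [hst (ψ k)], by linarith [hst (ψ k)]⟩,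
      rfl⟩)
  rcases hst₀.lt_or_eq with hlt | rfl
  · obtain ⟨k, h1, h2⟩ := ((hsl.eventually (gt_mem_nhds (show s₀ < (s₀ + t₀) / 2 by linarith))).and
      (htl.eventually (lt_mem_nhds (show (s₀ + t₀) / 2 < t₀ by linarith)))).exists
    exact hoff _ _ ⟨h1, h2⟩ (h.arc_subset v hv hmidA)
  · rw [add_self_div_two] at hmidA
    set y := γ s₀ with hy
    have hyX : y ∈ X := h.arc_subset v hv hmidA
    have hvy : v ≠ y := by
      intro h'
      have := hγS s₀
      rw [← hy, ← h', mem_sphere_iff_norm, sub_self, norm_zero] at this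
      exact hr.ne this
    have hvA : v ∉ A y := fun h' => hvy (h.arc_antisymm v hv y hmidA h')
    obtain ⟨ρ, hρ, hball⟩ := Metric.isOpen_iff.1 (h.arc_isCompact y hyX).isClosed.isOpen_compl v hvA
    have hup := h.upper y hyX (ρ / 2) (half_pos hρ)
    have hsy : Tendsto (fun k => γ (s (ψ k))) atTop (𝓝[X] y) := tendsto_nhdsWithin_iff.2
      ⟨(hγc.tendsto _).comp hsl, Eventually.of_forall fun k => hsX _⟩
    have hty : Tendsto (fun k => γ (t (ψ k))) atTop (𝓝[X] y) := tendsto_nhdsWithin_iff.2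
      ⟨(hγc.tendsto _).comp htl, Eventually.of_forall fun k => htX _⟩
    have hρ' : 0 < min (ρ / 2) r := lt_min (half_pos hρ) hr
    have hφψ := hφ.tendsto_atTop.comp hψ.tendsto_atTop
    obtain ⟨k, h1, h2, h3, h4⟩ := ((hsy.eventually hup).and ((hty.eventually hup).and
      ((hφψ.eventually (hlim1.eventually (Metric.ball_mem_nhds v hρ'))).and
      (hφψ.eventually (hlim2.eventually (Metric.ball_mem_nhds v hρ')))))).exists
    obtain ⟨z, hz, hz'⟩ := hcut (ψ k) _ (convex_ball v _).isPreconnected h3 h4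
    rw [Metric.mem_ball, lt_min_iff] at hz
    have hzA : z ∉ Metric.thickening (ρ / 2) (A y) := by
      intro h'
      obtain ⟨a, ha, haz⟩ := Metric.mem_thickening_iff.1 h'
      refine hball (Metric.mem_ball.2 ?_) ha
      have := dist_triangle_left a v z
      linarith [hz.1]
    rcases hz' with ⟨u, -, rfl⟩ | hz' | hz'
    · have := hγS u
      rw [Metric.mem_sphere] at this
      exact hz.2.ne this
    · exact hzA (h1 hz')
    · exact hzA (h2 hz')

end RootedArcs

/-- A chain of continua converging to a point forms a continuum together with that point. -/
lemma isCompact_insert_iUnion {v : ℂ} {K : ℕ → Set ℂ} (hK : ∀ n, IsCompact (K n))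
    (hlim : ∀ r > 0, ∀ᶠ n in atTop, K n ⊆ Metric.ball v r) : IsCompact (insert v (⋃ n, K n)) := by
  have hfin : ∀ r > 0, ∃ L, IsCompact L ∧ (⋃ n, K n) ⊆ Metric.ball v r ∪ L ∧ L ⊆ ⋃ n, K n := by
    intro r hr
    obtain ⟨N, hN⟩ := eventually_atTop.1 (hlim r hr)
    refine ⟨⋃ n ∈ Finset.range N, K n, (Finset.range N).isCompact_biUnion fun n _ => hK n, ?_,
      iUnion₂_subset fun n _ => subset_iUnion K n⟩
    refine iUnion_subset fun n z hz => ?_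
    rcases lt_or_ge n N with hn | hn
    · exact Or.inr (mem_biUnion (Finset.mem_coe.2 (Finset.mem_range.2 hn)) hz)
    · exact Or.inl (hN n hn hz)
  rw [Metric.isCompact_iff_isClosed_bounded]
  constructor
  · refine isClosed_of_closure_subset fun z hz => ?_
    by_cases hzv : z = v
    · exact Or.inl hzv
    have hd : 0 < dist z v := dist_pos.2 hzv
    obtain ⟨L, hL, hcov, hLK⟩ := hfin (dist z v / 2) (half_pos hd)
    have hsub : insert v (⋃ n, K n) ⊆ Metric.closedBall v (dist z v / 2) ∪ L := by
      refine insert_subset (Or.inl (Metric.mem_closedBall_self (half_pos hd).le)) ?_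
      exact hcov.trans (union_subset_union_left _ Metric.ball_subset_closedBall)
    rcases closure_minimal hsub (Metric.isClosed_closedBall.union hL.isClosed) hz with h' | h'
    · rw [Metric.mem_closedBall] at h'; linarith
    · exact Or.inr (hLK h')
  · obtain ⟨L, hL, hcov, -⟩ := hfin 1 one_pos
    exact ((Metric.isBounded_ball.union hL.isBounded).subset hcov).insert v

lemma exists_tendsto_zero {P : ℕ → ℝ → Prop} (hP : ∀ r > 0, ∀ᶠ n in atTop, P n r) :
    ∃ N : ℕ, ∃ ρ : ℕ → ℝ, Tendsto ρ atTop (𝓝 0) ∧ ∀ n ≥ N, P n (ρ n) := by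
  obtain ⟨N, hN⟩ := eventually_atTop.1 (hP 1 one_pos)
  set S : ℕ → Set ℝ := fun n => {r | 0 < r ∧ P n r} with hS
  have hbd : ∀ n, BddBelow (S n) := fun n => ⟨0, fun r hr => hr.1.le⟩
  have hex : ∀ n, ∃ ρ, n ≥ N → ρ ∈ S n ∧ ρ < sInf (S n) + 1 / (n + 1) := by
    intro n
    by_cases hn : n ≥ N
    · obtain ⟨ρ, hρ, hlt⟩ := exists_lt_of_csInf_lt (s := S n) ⟨1, one_pos, hN n hn⟩
        (show sInf (S n) < sInf (S n) + 1 / ((n : ℝ) + 1) by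
          have : (0 : ℝ) < 1 / (n + 1) := by positivity
          linarith)
      exact ⟨ρ, fun _ => ⟨hρ, hlt⟩⟩
    · exact ⟨0, fun h' => absurd h' hn⟩
  choose ρ hρ using hex
  refine ⟨N, ρ, ?_, fun n hn => (hρ n hn).1.2⟩
  rw [Metric.tendsto_nhds]
  intro ε hε
  filter_upwards [hP (ε / 2) (half_pos hε), eventually_ge_atTop N,
    tendsto_one_div_add_atTop_nhds_zero_nat.eventually (gt_mem_nhds (half_pos hε))]
    with n h1 h2 h3
  obtain ⟨h4, h5⟩ := hρ n h2
  have h6 := csInf_le (hbd n) (show ε / 2 ∈ S n from ⟨half_pos hε, h1⟩)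
  rw [Real.dist_eq, sub_zero, abs_of_pos h4.1]
  linarith

namespace RootedArcs

variable {X E : Set ℂ} {p : ℂ} {A : ℂ → Set ℂ}

/-- The limit of a nested sequence of crosscuts is accessible from the first lobe. -/
lemma limit_mem_accessible (h : RootedArcs X E p A) {w c d : ℕ → ℂ} {G : ℕ → Set ℂ}
    (hc : ∀ n, IsCrosscut X (w n) (c n) (d n))
    (hG : ∀ n, IsLobe X (spokes (w n) (c n) (d n)) (G n)) (hw : ∀ n, w (n + 1) ∈ G n)
    (hmono : ∀ n, G (n + 1) ⊆ G n) {v : ℂ} (hv : v ∈ X) (hlim : Tendsto w atTop (𝓝 v)) :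
    v ∈ {c 0, d 0} ∪ accessible X (G 0) := by
  by_cases hvV : v ∈ spokes (w 0) (c 0) (d 0)
  · left
    rw [← (hc 0).spokes_inter]
    exact ⟨hvV, hv⟩
  right
  obtain ⟨r₀, hr₀, hball⟩ := Metric.isOpen_iff.1
    (isCompact_spokes _ _ _).isClosed.isOpen_compl v hvV
  have hG0 : ∀ n, G n ⊆ G 0 := fun n => (antitone_nat_of_succ_le hmono) (Nat.zero_le n)
  obtain ⟨N, ρ, hρ, hP⟩ := exists_tendsto_zero (fun r hr => h.eventually_joined hc hG hw hmono hv
    hlim hr)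
  obtain ⟨M, hM⟩ := eventually_atTop.1 (hρ.eventually (gt_mem_nhds hr₀))
  choose K hK hKc hKp hK1 hK2 using fun n => hP (n + (N + M)) (by omega)
  have hρ' := (tendsto_add_atTop_iff_nat (N + M)).2 hρ
  have hsub : (insert v (⋃ n, K n)) \ {v} = ⋃ n, K n := by
    rw [insert_sdiff_of_mem _ (mem_singleton v), sdiff_singleton_eq_self]
    rintro hvK
    obtain ⟨n, hn⟩ := mem_iUnion.1 hvK
    exact (hK n hn).2 hv
  have hpre : IsPreconnected (⋃ n, K n) := IsPreconnected.iUnion_of_chain hKp fun n =>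
    ⟨_, hK2 n, by
      have := hK1 (n + 1)
      rwa [show n + 1 + (N + M) + 1 = n + (N + M) + 2 by ring] at this⟩
  refine ⟨hv, insert v (⋃ n, K n), isCompact_insert_iUnion hKc ?_, ?_, mem_insert _ _, ?_, ?_⟩
  · intro r hr
    filter_upwards [hρ'.eventually (gt_mem_nhds hr)] with n hn
    exact (hK n).trans (sdiff_subset.trans (Metric.ball_subset_ball hn.le))
  · refine hpre.subset_closure (subset_insert _ _) (insert_subset ?_ subset_closure)
    refine mem_closure_of_tendsto
      ((tendsto_add_atTop_iff_nat (N + M + 1)).2 hlim) (Eventually.of_forall fun n => ?_)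
    exact mem_iUnion.2 ⟨n, hK1 n⟩
  · rw [hsub]
    refine (hG 0).subset_of_isPreconnected hpre (mem_iUnion.2 ⟨0, hK1 0⟩) (hG0 _ (hw _)) ?_
    rintro z hz (h' | h')
    · obtain ⟨n, hn⟩ := mem_iUnion.1 hz
      exact (hK n hn).2 h'
    · obtain ⟨n, hn⟩ := mem_iUnion.1 hz
      exact hball (Metric.ball_subset_ball (hM _ (by omega)).le (hK n hn).1) h'
  · rw [hsub]
    exact ⟨_, mem_iUnion.2 ⟨0, hK1 0⟩⟩

end RootedArcs

lemma exists_seq_of_step {σ : Type*} {P : σ → Prop} {R : ℕ → σ → σ → Prop} {a : σ} (ha : P a)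
    (h : ∀ n x, P x → ∃ y, P y ∧ R n x y) :
    ∃ q : ℕ → σ, q 0 = a ∧ ∀ n, P (q n) ∧ R n (q n) (q (n + 1)) := by
  choose! f hf using h
  let q : ℕ → σ := fun n => Nat.rec a (fun n x => f n x) n
  have hq : ∀ n, P (q n) := by
    intro n
    induction n with
    | zero => exact ha
    | succ n ih => exact (hf n _ ih).1
  exact ⟨q, rfl, fun n => ⟨hq n, (hf n _ (hq n)).2⟩⟩

namespace RootedArcs

variable {X E : Set ℂ} {p : ℂ} {A : ℂ → Set ℂ}

lemma exists_nested_crosscuts (h : RootedArcs X E p A) {w b b' : ℂ} (hc : IsCrosscut X w b b')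
    {G Z U U' : Set ℂ} (hG : IsLobe X (spokes w b b') G) (hU : IsOpen U) (hU' : IsOpen U')
    (hZ : {b, b'} ∪ accessible X G ⊆ Z) (hcov : Z ⊆ U ∪ U') (hdisj : Z ∩ (U ∩ U') = ∅)
    (h1 : (({b, b'} ∪ accessible X G) ∩ U).Nonempty)
    (h2 : (({b, b'} ∪ accessible X G) ∩ U').Nonempty) :
    ∃ (w' c d : ℕ → ℂ) (H : ℕ → Set ℂ), (∀ n, IsCrosscut X (w' n) (c n) (d n)) ∧
      (∀ n, IsLobe X (spokes (w' n) (c n) (d n)) (H n)) ∧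
      (∀ n, {c n, d n} ∪ accessible X (H n) ⊆ Z) ∧ (∀ n, w' (n + 1) ∈ H n) ∧
      (∀ n, Metric.infDist (w' (n + 1)) X < 1 / (n + 1)) ∧ (∀ n, c (n + 1) ∈ U) ∧
      (∀ n, d (n + 1) ∈ U') ∧ (∀ n, H (n + 1) ⊆ H n) := by
  obtain ⟨q, -, hq⟩ := exists_seq_of_step (a := (w, b, b', G))
    (P := fun q : ℂ × ℂ × ℂ × Set ℂ => IsCrosscut X q.1 q.2.1 q.2.2.1 ∧
      IsLobe X (spokes q.1 q.2.1 q.2.2.1) q.2.2.2 ∧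
      {q.2.1, q.2.2.1} ∪ accessible X q.2.2.2 ⊆ Z ∧
      (({q.2.1, q.2.2.1} ∪ accessible X q.2.2.2) ∩ U).Nonempty ∧
      (({q.2.1, q.2.2.1} ∪ accessible X q.2.2.2) ∩ U').Nonempty)
    (R := fun n q q' => q'.1 ∈ q.2.2.2 ∧ Metric.infDist q'.1 X < 1 / (n + 1) ∧ q'.2.1 ∈ U ∧
      q'.2.2.1 ∈ U' ∧ q'.2.2.2 ⊆ q.2.2.2) ⟨hc, hG, hZ, h1, h2⟩ (by
    rintro n ⟨w, b, b', G⟩ ⟨h1, h2, h3, h4, h5⟩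
    obtain ⟨w₁, c, d, G₁, k1, k2, k3, k4, k5, -, k7, k8, k9⟩ := h.exists_inner_crosscut h1 h2 hU hU'
      h3 hcov hdisj h4 h5 (show (0 : ℝ) < 1 / (n + 1) by positivity)
    exact ⟨⟨w₁, c, d, G₁⟩, ⟨k1, k7, k9.trans h3, ⟨c, by simp, k4⟩, ⟨d, by simp, k5⟩⟩,
      k2, k3, k4, k5, k8⟩)
  exact ⟨fun n => (q n).1, fun n => (q n).2.1, fun n => (q n).2.2.1, fun n => (q n).2.2.2,
    fun n => (hq n).1.1, fun n => (hq n).1.2.1, fun n => (hq n).1.2.2.1, fun n => (hq n).2.1,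
    fun n => (hq n).2.2.1, fun n => (hq n).2.2.2.1, fun n => (hq n).2.2.2.2.1,
    fun n => (hq n).2.2.2.2.2⟩

/-- A lobe of a crosscut has an accessible point outside of `E`, or one of the ends of the crosscut
lies outside of `E`. -/
theorem not_subset_ends (h : RootedArcs X E p A) {w b b' : ℂ} (hc : IsCrosscut X w b b')
    {G : Set ℂ} (hG : IsLobe X (spokes w b b') G) :
    ¬ {b, b'} ∪ accessible X G ⊆ E := by
  intro hE
  have hXne : X.Nonempty := ⟨p, h.root_mem⟩
  set Z := {b, b'} ∪ accessible X G with hZ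
  have hnp : ¬ IsPreconnected Z := fun hp => hc.ne (h.ends_hd Z hE hp (by simp [hZ]) (by simp [hZ]))
  rw [IsPreconnected] at hnp
  push Not at hnp
  obtain ⟨U, U', hU, hU', hcov, hne, hne', hdisj⟩ := hnp
  obtain ⟨w', c, d, H, hc', hH, hHZ, hwH, hinf, hcU, hdU, hmono⟩ :=
    h.exists_nested_crosscuts hc hG hU hU' Subset.rfl hcov hdisj hne hne'
  have hanti : Antitone H := antitone_nat_of_succ_le hmono
  have hmemH : ∀ m n, m < n → w' n ∈ H m := by
    intro m n hmn
    obtain ⟨k, rfl⟩ := Nat.exists_eq_add_of_lt hmn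
    exact hanti (Nat.le_add_right m k) (hwH _)
  obtain ⟨v, -, φ, hφ, hlim⟩ := (hH 0).1.isCompact_closure.tendsto_subseq
    (x := fun n => w' (n + 1)) fun n => subset_closure (hmemH 0 (n + 1) n.succ_pos)
  have hφ1 : ∀ n, φ n < φ (n + 1) := fun n => hφ n.lt_succ_self
  have hinf0 : Tendsto (fun n => Metric.infDist (w' (φ n + 1)) X) atTop (𝓝 0) :=
    squeeze_zero (fun n => Metric.infDist_nonneg) (fun n => (hinf _).le)
      (tendsto_one_div_add_atTop_nhds_zero_nat.comp hφ.tendsto_atTop)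
  have hv : v ∈ X := by
    rw [h.isCompact.isClosed.mem_iff_infDist_zero hXne]
    exact tendsto_nhds_unique (((Metric.continuous_infDist_pt X).tendsto v).comp hlim) hinf0
  have hvZ : v ∈ Z := hHZ _ (h.limit_mem_accessible (w := fun n => w' (φ n + 1))
    (c := fun n => c (φ n + 1)) (d := fun n => d (φ n + 1)) (G := fun n => H (φ n + 1))
    (fun n => hc' _) (fun n => hH _) (fun n => hmemH _ _ (by have := hφ1 n; omega))
    (fun n => hanti (by have := hφ1 n; omega)) hv hlim)
  have hcl : ∀ z : ℕ → ℂ, (∀ n, z n ∈ nearest X (w' (φ n + 1))) → Tendsto z atTop (𝓝 v) := by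
    intro z hz
    rw [tendsto_iff_dist_tendsto_zero] at hlim ⊢
    have := hlim.const_mul 2
    rw [mul_zero] at this
    exact squeeze_zero (fun n => dist_nonneg) (fun n => nearest_near hv (hz n)) this
  rcases hcov hvZ with hvU | hvU
  · obtain ⟨n, hn⟩ := ((hcl (fun n => d (φ n + 1)) fun n => (hc' _).right).eventually
      (hU.mem_nhds hvU)).exists
    exact (hdisj.subset ⟨hHZ (φ n + 1) (by simp), hn, hdU _⟩ :)
  · obtain ⟨n, hn⟩ := ((hcl (fun n => c (φ n + 1)) fun n => (hc' _).left).eventually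
      (hU'.mem_nhds hvU)).exists
    exact (hdisj.subset ⟨hHZ (φ n + 1) (by simp), hcU _, hn⟩ :)

end RootedArcs

lemma isPreconnected_ball_diff_center (a : ℂ) (r : ℝ) : IsPreconnected (Metric.ball a r \ {a}) := by
  have : Metric.ball a r \ {a} = (fun q : ℝ × ℝ => circleMap a q.1 q.2) '' Ioo 0 r ×ˢ univ := by
    ext z
    constructor
    · rintro ⟨hz, hza⟩
      have hz' : z ∈ Metric.sphere a |dist z a| := by simp [dist_eq_norm]
      rw [← range_circleMap] at hz'
      obtain ⟨θ, hθ⟩ := hz'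
      exact ⟨(dist z a, θ), ⟨⟨dist_pos.2 hza, hz⟩, mem_univ _⟩, hθ⟩
    · rintro ⟨⟨s, θ⟩, ⟨hs, -⟩, rfl⟩
      have := circleMap_mem_sphere a hs.1.le θ
      rw [Metric.mem_sphere] at this
      exact ⟨this.trans_lt hs.2, circleMap_ne_center hs.1.ne'⟩
  rw [this]
  refine (isPreconnected_Ioo.prod isPreconnected_univ).image _ (Continuous.continuousOn ?_)
  unfold circleMap
  fun_prop

/-- Near a point of a nondegenerate continuum, complementary points do not all have that point as
their only nearest point. -/
lemma not_forall_nearest_eq {X : Set ℂ} (hX : IsCompact X) (hXp : IsPreconnected X)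
    (hXn : X.Nontrivial) {a t : ℂ} (ha : a ∈ X) {ρ : ℝ} (ht : t ∈ Metric.ball a ρ \ X) :
    ∃ w ∈ connectedComponentIn (Metric.ball a ρ \ X) t, ∃ b ∈ nearest X w, b ≠ a := by
  by_contra! hcon
  have hρ : 0 < ρ := Metric.pos_of_mem_ball ht.1
  have hopen : IsOpen (Metric.ball a ρ \ X) := Metric.isOpen_ball.sdiff hX.isClosed
  set O := connectedComponentIn (Metric.ball a ρ \ X) t with hO
  have hfr : ∀ u ∈ frontier O, u ∈ Metric.ball a ρ → u = a := by
    intro u hu hub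
    have huX : u ∈ X := by
      by_contra huX
      exact frontier_connectedComponentIn_subset hopen t hu ⟨hub, huX⟩
    have hcl : u ∈ closure {w | dist w a = Metric.infDist w X} := by
      refine closure_mono (fun w hw => ?_) (frontier_subset_closure hu)
      obtain ⟨b, hb⟩ := nearest_nonempty hX ⟨a, ha⟩ w
      have := hcon w hw b hb
      subst this
      exact hb.2
    rw [(isClosed_eq (by fun_prop) (Metric.continuous_infDist_pt X)).closure_eq] at hcl
    have : dist u a = Metric.infDist u X := hcl
    rwa [Metric.infDist_zero_of_mem huX, dist_eq_zero] at this
  have hta : t ≠ a := by rintro rfl; exact ht.2 ha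
  have hsub : Metric.ball a ρ \ {a} ⊆ O := by
    intro u hu
    by_contra huO
    obtain ⟨x, hx, hxf⟩ := frontier_inter_nonempty (isPreconnected_ball_diff_center a ρ)
      ⟨ht.1, hta⟩ (mem_connectedComponentIn ht) hu huO
    exact hx.2 (hfr x hxf hx.1)
  obtain ⟨y, hy, hya⟩ := hXn.exists_ne a
  set κ := min (ρ / 2) (dist y a) with hκ
  have hκ0 : 0 < κ := lt_min (half_pos hρ) (dist_pos.2 hya)
  obtain ⟨x, hx, hxf⟩ := frontier_inter_nonempty hXp ha (Metric.mem_ball_self hκ0) hy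
    (fun h' => (not_lt.2 (min_le_right (ρ / 2) (dist y a))) h')
  rw [frontier_ball _ hκ0.ne', Metric.mem_sphere] at hxf
  refine (connectedComponentIn_subset _ _ (hsub ⟨?_, ?_⟩)).2 hx
  · rw [Metric.mem_ball, hxf]
    exact (min_le_left _ _).trans_lt (half_lt_self hρ)
  · rintro rfl
    rw [dist_self] at hxf
    exact hκ0.ne hxf

namespace RootedArcs

variable {X E : Set ℂ} {p : ℂ} {A : ℂ → Set ℂ}

/-- Points off `X` can be joined to `X \ E` by continua which stay close to an arc. -/
lemma exists_spoke (h : RootedArcs X E p A) (hXn : X.Nontrivial) {ε : ℝ} {z a : ℂ}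
    (hzX : z ∉ X) (ha : a ∈ nearest X z) (hz : Metric.infDist z X < ε) :
    ∃ T, ∃ v ∈ X \ E, IsCompact T ∧ IsPreconnected T ∧ z ∈ T ∧ v ∈ T ∧ T ∩ X ⊆ {v} ∧
      T ⊆ Metric.thickening ε (A a) := by
  have hε : 0 < ε := Metric.infDist_nonneg.trans_lt hz
  have hza : dist z a < ε := ha.2.trans_lt hz
  have hballA : Metric.ball a ε ⊆ Metric.thickening ε (A a) := fun u hu =>
    Metric.mem_thickening_iff.2 ⟨a, h.self_mem_arc a ha.1, hu⟩
  have hzne : z ≠ a := by rintro rfl; exact hzX ha.1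
  have hXne : X.Nonempty := ⟨a, ha.1⟩
  by_cases haE : a ∈ E
  swap
  · refine ⟨segment ℝ a z, a, ⟨ha.1, haE⟩, isCompact_segment _ _,
      (convex_segment _ _).isPreconnected, right_mem_segment _ _ _, left_mem_segment _ _ _,
      (segment_inter_eq ha).le, ?_⟩
    exact ((convex_ball a ε).segment_subset (Metric.mem_ball_self hε) hza).trans hballA
  obtain ⟨η, hη, henc⟩ := h.exists_enclosure ha.1 (half_pos hε)
  set ρ := min η ε / 2 with hρ
  have hρ0 : 0 < ρ := half_pos (lt_min hη hε)
  have hρη : 2 * ρ ≤ η := by rw [hρ]; linarith [min_le_left η ε]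
  have hρε : 2 * ρ ≤ ε := by rw [hρ]; linarith [min_le_right η ε]
  obtain ⟨t, hta, hto⟩ : ∃ t, t ∈ Metric.ball a ρ ∧ t ∈ openSegment ℝ a z := by
    have hcl : a ∈ closure (openSegment ℝ a z) := by
      rw [closure_openSegment]; exact left_mem_segment _ _ _
    obtain ⟨t, ht, hd⟩ := Metric.mem_closure_iff.1 hcl ρ hρ0
    exact ⟨t, by rwa [Metric.mem_ball, dist_comm], ht⟩
  have hts : t ∈ segment ℝ a z := openSegment_subset_segment _ _ _ hto
  have htne : t ≠ a := by
    rintro rfl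
    exact hzne (left_mem_openSegment_iff.1 hto).symm
  have htX : t ∉ X := fun h' => htne (eq_of_mem_segment_of_mem ha hts h')
  have hnt : a ∈ nearest X t := nearest_of_mem_segment ha hts
  have hsegX : ∀ u ∈ segment ℝ t z, u ∉ X := by
    intro u hu huX
    have h1 : u ∈ Metric.closedBall z (dist t z) :=
      (convex_closedBall z (dist t z)).segment_subset (Metric.mem_closedBall.2 le_rfl)
        (Metric.mem_closedBall_self dist_nonneg) hu
    have h2 := Metric.infDist_le_dist_of_mem (x := z) huX
    have h3 := dist_add_dist_of_mem_segment hts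
    have h4 : 0 < dist a t := dist_pos.2 htne.symm
    rw [← ha.2, dist_comm z u, dist_comm z a] at h2
    linarith [Metric.mem_closedBall.1 h1]
  have hseg : segment ℝ t z ⊆ Metric.thickening ε (A a) :=
    ((convex_ball a ε).segment_subset (Metric.ball_subset_ball (by linarith) hta) hza).trans hballA
  have hopen : IsOpen (Metric.ball a ρ \ X) := Metric.isOpen_ball.sdiff h.isCompact.isClosed
  set O := connectedComponentIn (Metric.ball a ρ \ X) t with hO
  have hOsub : O ⊆ Metric.ball a ρ \ X := connectedComponentIn_subset _ _
  have hOp : IsPreconnected O := isPreconnected_connectedComponentIn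
  have htO : t ∈ O := mem_connectedComponentIn ⟨hta, htX⟩
  have hOnear : ∀ w ∈ O, ∀ b ∈ nearest X w, b ∈ Metric.ball a (2 * ρ) := by
    intro w hw b hb
    have h1 := nearest_near ha.1 hb
    have h2 : dist w a < ρ := (hOsub hw).1
    rw [Metric.mem_ball]
    linarith
  have hjoin : ∀ w ∈ O, ∃ K, IsCompact K ∧ IsPreconnected K ∧ z ∈ K ∧ w ∈ K ∧ K ∩ X = ∅ ∧
      K ⊆ Metric.thickening ε (A a) := by
    intro w hw
    obtain ⟨K, hK, hKc, hKp, h1, h2⟩ :=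
      hopen.connectedComponentIn.exists_isCompact_isPreconnected hOp htO hw
    refine ⟨segment ℝ t z ∪ K, (isCompact_segment _ _).union hKc,
      (convex_segment _ _).isPreconnected.union t (left_mem_segment _ _ _) h1 hKp,
      Or.inl (right_mem_segment _ _ _), Or.inr h2, ?_, union_subset hseg ?_⟩
    · refine eq_empty_of_forall_notMem ?_
      rintro u ⟨hu | hu, huX⟩
      · exact hsegX u hu huX
      · exact (hOsub (hK hu)).2 huX
    · exact fun u hu => hballA (Metric.ball_subset_ball (by linarith) (hOsub (hK hu)).1)
  set S := ⋃ w ∈ O, nearest X w with hS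
  by_cases hSE : S ⊆ E
  swap
  · obtain ⟨v, hvS, hvE⟩ := not_subset.1 hSE
    obtain ⟨w, hw, hv⟩ := mem_iUnion₂.1 hvS
    obtain ⟨K, hKc, hKp, hzK, hwK, hKX, hKA⟩ := hjoin w hw
    refine ⟨K ∪ segment ℝ v w, v, ⟨hv.1, hvE⟩, hKc.union (isCompact_segment _ _),
      hKp.union w hwK (right_mem_segment _ _ _) (convex_segment _ _).isPreconnected, Or.inl hzK,
      Or.inr (left_mem_segment _ _ _), ?_, union_subset hKA ?_⟩
    · rw [union_inter_distrib_right, hKX, empty_union]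
      exact (segment_inter_eq hv).le
    · refine ((convex_ball a (2 * ρ)).segment_subset (hOnear w hw v hv) ?_).trans
        ((Metric.ball_subset_ball hρε).trans hballA)
      exact Metric.ball_subset_ball (by linarith) (hOsub hw).1
  have hSp : ¬ IsPreconnected S := by
    intro hp
    obtain ⟨w, hw, b, hb, hba⟩ := not_forall_nearest_eq h.isCompact h.isPreconnected hXn ha.1
      (t := t) ⟨hta, htX⟩
    exact hba (h.ends_hd S hSE hp (mem_iUnion₂.2 ⟨w, hw, hb⟩) (mem_iUnion₂.2 ⟨t, htO, hnt⟩))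
  rw [IsPreconnected] at hSp
  push Not at hSp
  obtain ⟨U, U', hU, hU', hcov, h1, h2, hdisj⟩ := hSp
  have hmeet : ∀ W : Set ℂ, (S ∩ W).Nonempty → ∃ w ∈ O, (nearest X w ∩ W).Nonempty := by
    rintro W ⟨u, hu, huW⟩
    obtain ⟨w, hw, huw⟩ := mem_iUnion₂.1 hu
    exact ⟨w, hw, u, huw, huW⟩
  obtain ⟨w, hw, ⟨c, hc, hcU⟩, ⟨d, hd, hdU⟩⟩ := exists_nearest_split h.isCompact hXne hOp
    (Z := S) (fun w hw b hb => mem_iUnion₂.2 ⟨w, hw, hb⟩) hU hU' hcov hdisj (hmeet U h1)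
    (hmeet U' h2)
  have hcS : c ∈ S := mem_iUnion₂.2 ⟨w, hw, hc⟩
  have hdS : d ∈ S := mem_iUnion₂.2 ⟨w, hw, hd⟩
  have hcut : IsCrosscut X w c d := by
    refine ⟨(hOsub hw).2, hc, hd, ?_⟩
    rintro rfl
    exact (hdisj.subset ⟨hcS, hcU, hdU⟩ :)
  obtain ⟨G, hG⟩ := h.exists_lobe hcut
  obtain ⟨v, hvZ, hvE⟩ := not_subset.1 (h.not_subset_ends hcut hG)
  have hv : v ∈ accessible X G := by
    rcases hvZ with (rfl | rfl) | hv
    · exact absurd (hSE hcS) hvE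
    · exact absurd (hSE hdS) hvE
    · exact hv
  have hvA := hv
  obtain ⟨hvX, R, hRc, hRp, hvR, hRG, g', hg'⟩ := hv
  have hGA' : G ⊆ Metric.thickening (ε / 2) (A a) := by
    intro u hu
    refine henc _ _ _ (isCompact_spokes w c d) (spokes_subset_ball ?_ ?_ ?_) hcut.spokes_inter u
      (hG.2.2 u hu).1 ?_
    · exact Metric.ball_subset_ball (by linarith) (hOsub hw).1
    · exact Metric.ball_subset_ball hρη (hOnear w hw c hc)
    · exact Metric.ball_subset_ball hρη (hOnear w hw d hd)
    · rw [← (hG.2.2 u hu).2]; exact hG.1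
  obtain ⟨g, hgO, hgG⟩ := mem_closure_iff_nhds.1
    (h.spokes_subset_closure_lobe hcut hG (Or.inl (right_mem_segment _ _ _))) O
    (hopen.connectedComponentIn.mem_nhds hw)
  obtain ⟨K, hKc, hKp, hzK, hgK, hKX, hKA⟩ := hjoin g hgO
  obtain ⟨K', hK', hKc', hKp', hgK', hg'K'⟩ :=
    (hG.isOpen h.isCompact (isCompact_spokes _ _ _)).exists_isCompact_isPreconnected
    hG.isPreconnected hgG (hRG hg')
  have hGA : G ⊆ Metric.thickening ε (A a) :=
    hGA'.trans (Metric.thickening_mono (half_le_self hε.le) _)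
  have hRA : R ⊆ Metric.thickening ε (A a) := by
    intro u hu
    by_cases huv : u = v
    · obtain ⟨u', hu', hd⟩ := Metric.mem_closure_iff.1
        (closure_mono hGA' (accessible_subset_closure hvA)) (ε / 2) (half_pos hε)
      obtain ⟨q, hq, hqd⟩ := Metric.mem_thickening_iff.1 hu'
      refine Metric.mem_thickening_iff.2 ⟨q, hq, ?_⟩
      rw [huv]
      linarith [dist_triangle v u' q]
    · exact hGA (hRG ⟨hu, huv⟩)
  refine ⟨K ∪ (K' ∪ R), v, ⟨hvX, hvE⟩, hKc.union (hKc'.union hRc),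
    hKp.union g hgK (Or.inl hgK') (hKp'.union g' hg'K' hg'.1 hRp), Or.inl hzK,
    Or.inr (Or.inr hvR), ?_, union_subset hKA (union_subset (hK'.trans hGA) hRA)⟩
  rintro u ⟨hu | hu | hu, huX⟩
  · exact absurd (hKX.subset ⟨hu, huX⟩ : u ∈ (∅ : Set ℂ)) (notMem_empty u)
  · exact absurd huX (hG.notMem (hK' hu))
  · by_contra huv
    exact hG.notMem (hRG ⟨hu, huv⟩) huX

end RootedArcs

namespace RootedArcs

variable {X E : Set ℂ} {p : ℂ} {A : ℂ → Set ℂ}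

/-- Two ends other than the root are separated in the plane by a compact set which misses all
ends. -/
theorem exists_separator (h : RootedArcs X E p A) {e e' : ℂ} (he : e ∈ E) (he' : e' ∈ E)
    (hep : e ≠ p) (hep' : e' ≠ p) (hne : e ≠ e') :
    ∃ K, IsCompact K ∧ Disjoint K E ∧ e' ∉ connectedComponentIn Kᶜ e := by
  by_contra! hcon
  have heX := h.ends_subset he
  have hXne : X.Nonempty := ⟨e, heX⟩
  have hXn : X.Nontrivial := ⟨e, heX, e', h.ends_subset he', hne⟩
  obtain ⟨x₀, hx₀⟩ : (X \ E).Nonempty := by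
    rw [sdiff_nonempty]
    exact fun hs => hXn.not_subsingleton (h.ends_hd X hs h.isPreconnected)
  obtain ⟨ε, hε, hlogs⟩ := h.exists_hasLog_of_ends hx₀ he he' hep hep' hne
  have hlog : ∀ a ∈ X, ∀ K, IsCompact K → Disjoint K E →
      K ⊆ Metric.thickening ε (A a ∪ A x₀) → HasLog K (fun z => z - e) := by
    intro a ha K hK hKE hKs
    rcases hlogs a ha with h1 | h1
    · exact h1.mono hKs
    · have h2 := HasLog.of_isPreconnected hK
        (isPreconnected_connectedComponentIn (F := Kᶜ) (x := e))
        (disjoint_left.2 fun z hz hz' => connectedComponentIn_subset _ _ hz' hz)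
        (mem_connectedComponentIn (disjoint_right.1 hKE he)) (hcon K hK hKE)
      refine (h2.mul (h1.mono hKs)).congr fun z hz => ?_
      rw [div_mul_cancel₀]
      exact fun h0 => disjoint_left.1 hKE hz (by rwa [sub_eq_zero.1 h0])
  obtain ⟨δ₁', hδ₁', hS₁'⟩ := h.exists_arc_subset_thickening hε
  obtain ⟨δ₁, hδ₁, hδ₁ε, hS₁⟩ : ∃ δ₁ > 0, δ₁ ≤ ε ∧ ∀ a ∈ X, ∀ v ∈ X,
      v ∈ Metric.thickening δ₁ (A a) → A v ⊆ Metric.thickening ε (A a) :=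
    ⟨min δ₁' ε, lt_min hδ₁' hε, min_le_right _ _, fun a ha v hv hva =>
      hS₁' a ha v hv (Metric.thickening_mono (min_le_left _ _) _ hva)⟩
  obtain ⟨δ₂, hδ₂, hS₂⟩ := h.exists_arc_subset_thickening (half_pos hδ₁)
  set δ := min (δ₁ / 2) (δ₂ / 3) with hδ
  have hδ0 : 0 < δ := lt_min (by positivity) (by positivity)
  have hδ1 : 2 * δ ≤ δ₁ := by linarith [min_le_left (δ₁ / 2) (δ₂ / 3)]
  have hδ2 : 3 * δ ≤ δ₂ := by linarith [min_le_right (δ₁ / 2) (δ₂ / 3)]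
  set D := {z | z ∉ X ∧ Metric.infDist z X < δ} with hD
  have hdata : ∀ z, ∃ a T v B, z ∈ D → a ∈ nearest X z ∧ v ∈ X \ E ∧ IsCompact T ∧
      IsPreconnected T ∧ z ∈ T ∧ v ∈ T ∧ T ∩ X ⊆ {v} ∧ T ⊆ Metric.thickening (δ₁ / 2) (A a) ∧
      IsCompact B ∧ IsPreconnected B ∧ x₀ ∈ B ∧ v ∈ B ∧ B ⊆ A x₀ ∪ A v ∧ Disjoint B E := by
    intro z
    by_cases hz : z ∈ D
    · obtain ⟨a, ha⟩ := nearest_nonempty h.isCompact hXne z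
      obtain ⟨T, v, hv, hT⟩ := h.exists_spoke hXn (ε := δ₁ / 2) hz.1 ha (by linarith [hz.2])
      obtain ⟨B, hB1, hB2, hB3, hB4, hB5, hB6⟩ := h.join x₀ hx₀ v hv
      obtain ⟨h1, h2, h3, h4, h5, h6⟩ := hT
      exact ⟨a, T, v, B, fun _ => ⟨ha, hv, h1, h2, h3, h4, h5, h6, hB1, hB2, hB3, hB4, hB5, hB6⟩⟩
    · exact ⟨0, ∅, 0, ∅, fun h' => absurd h' hz⟩
  choose a T v B hdata using hdata
  set Y : ℂ → Set ℂ := fun z => T z ∪ B z with hY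
  have hYc : ∀ z ∈ D, IsCompact (Y z) ∧ IsPreconnected (Y z) ∧ z ∈ Y z ∧ x₀ ∈ Y z ∧
      Disjoint (Y z) E := by
    intro z hz
    obtain ⟨ha, hv, h1, h2, h3, h4, h5, h6, hB1, hB2, hB3, hB4, hB5, hB6⟩ := hdata z hz
    refine ⟨h1.union hB1, h2.union (v z) h4 hB4 hB2, Or.inl h3, Or.inr hB3,
      disjoint_union_left.2 ⟨disjoint_left.2 fun u hu huE => hv.2 ?_, hB6⟩⟩
    rwa [← mem_singleton_iff.1 (h5 ⟨hu, h.ends_subset huE⟩)]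
  have hYs : ∀ z ∈ D, ∀ z' ∈ D, dist z' z ≤ δ →
      Y z' ⊆ Metric.thickening ε (A (a z) ∪ A x₀) := by
    intro z hz z' hz' hzz
    have ha := (hdata z hz).1
    obtain ⟨ha', hv', -, -, -, h4, -, h6, -, -, -, -, hB, -⟩ := hdata z' hz'
    have haa : a z' ∈ Metric.thickening δ₂ (A (a z)) := by
      refine Metric.mem_thickening_iff.2 ⟨a z, h.self_mem_arc _ ha.1, ?_⟩
      have h1 := dist_triangle4 (a z') z' z (a z)
      rw [dist_comm (a z') z', ha'.2, ha.2] at h1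
      linarith [hz.2, hz'.2]
    have hT : T z' ⊆ Metric.thickening δ₁ (A (a z)) := by
      refine h6.trans ((Metric.thickening_subset_of_subset _ (hS₂ _ ha.1 _ ha'.1 haa)).trans ?_)
      have := Metric.thickening_thickening_subset (δ₁ / 2) (δ₁ / 2) (A (a z))
      rwa [add_halves] at this
    refine union_subset (hT.trans ((Metric.thickening_mono hδ₁ε _).trans
      (Metric.thickening_subset_of_subset _ subset_union_left))) (hB.trans (union_subset ?_ ?_))
    · exact subset_union_right.trans (Metric.self_subset_thickening hε _)
    · exact (hS₁ _ ha.1 _ hv'.1 (hT h4)).trans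
        (Metric.thickening_subset_of_subset _ subset_union_left)
  have hx₀e : x₀ - e ≠ 0 := fun h0 => hx₀.2 (by rwa [sub_eq_zero.1 h0])
  set c := Complex.log (x₀ - e)
  have hex : ∀ z, ∃ l : ℂ → ℂ, z ∈ D → ContinuousOn l (Y z) ∧
      (∀ u ∈ Y z, Complex.exp (l u) = u - e) ∧ l x₀ = c := by
    intro z
    by_cases hz : z ∈ D
    · obtain ⟨h1, -, -, h4, h5⟩ := hYc z hz
      obtain ⟨l, hl, hle⟩ := hlog (a z) (hdata z hz).1.1 _ h1 h5
        (hYs z hz z hz (by rw [dist_self]; exact hδ0.le))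
      refine ⟨fun u => l u + (c - l x₀), fun _ => ⟨hl.add continuousOn_const, fun u hu => ?_,
        by ring⟩⟩
      rw [Complex.exp_add, Complex.exp_sub, Complex.exp_log hx₀e, hle u hu, hle x₀ h4,
        div_self hx₀e, mul_one]
    · exact ⟨0, fun h' => absurd h' hz⟩
  choose l hl using hex
  have hLc : ContinuousOn (fun z => l z z) D := by
    intro z hz
    obtain ⟨r, hr, hrX⟩ := Metric.nhds_basis_closedBall.mem_iff.1
      (h.isCompact.isClosed.isOpen_compl.mem_nhds hz.1)
    set ρ := min r δ with hρ
    have hρ0 : 0 < ρ := lt_min hr hδ0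
    have hzρ : z ∈ Metric.closedBall z ρ := Metric.mem_closedBall_self hρ0.le
    have ha := (hdata z hz).1
    have hball : Metric.closedBall z ρ ⊆ Metric.thickening ε (A (a z) ∪ A x₀) := by
      intro u hu
      refine Metric.mem_thickening_iff.2 ⟨a z, Or.inl (h.self_mem_arc _ ha.1), ?_⟩
      have h1 := dist_triangle u z (a z)
      rw [ha.2] at h1
      linarith [hz.2, Metric.mem_closedBall.1 hu, min_le_right r δ]
    have hballE : Disjoint (Metric.closedBall z ρ) E := disjoint_left.2 fun u hu huE =>
      hrX (Metric.closedBall_subset_closedBall (min_le_left _ _) hu) (h.ends_subset huE)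
    obtain ⟨m, hm, hme⟩ := hlog (a z) ha.1 _ (isCompact_closedBall z ρ) hballE hball
    have heq : ∀ z' ∈ D, z' ∈ Metric.closedBall z ρ → l z' z' = m z' + (l z z - m z) := by
      intro z' hz' hzz
      obtain ⟨hc1, hp1, hz1, hx1, hd1⟩ := hYc z hz
      obtain ⟨hc2, hp2, hz2, hx2, hd2⟩ := hYc z' hz'
      have hd0 : dist z' z ≤ δ := (Metric.mem_closedBall.1 hzz).trans (min_le_right _ _)
      obtain ⟨k, hk, hke⟩ := hlog (a z) ha.1 (Y z ∪ Y z' ∪ Metric.closedBall z ρ)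
        ((hc1.union hc2).union (isCompact_closedBall _ _))
        (disjoint_union_left.2 ⟨disjoint_union_left.2 ⟨hd1, hd2⟩, hballE⟩)
        (union_subset (union_subset (hYs z hz z hz (by rw [dist_self]; exact hδ0.le))
          (hYs z hz z' hz' hd0)) hball)
      have s1 : Y z ⊆ Y z ∪ Y z' ∪ Metric.closedBall z ρ := fun u hu => Or.inl (Or.inl hu)
      have s2 : Y z' ⊆ Y z ∪ Y z' ∪ Metric.closedBall z ρ := fun u hu => Or.inl (Or.inr hu)
      have s3 : Metric.closedBall z ρ ⊆ Y z ∪ Y z' ∪ Metric.closedBall z ρ := fun u hu => Or.inr hu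
      have e1 := log_sub_eq hp1 (hl z hz).1 (hk.mono s1)
        (fun u hu => by rw [(hl z hz).2.1 u hu, hke u (s1 hu)]) hz1 hx1
      have e2 := log_sub_eq hp2 (hl z' hz').1 (hk.mono s2)
        (fun u hu => by rw [(hl z' hz').2.1 u hu, hke u (s2 hu)]) hz2 hx2
      have e3 := log_sub_eq (convex_closedBall z ρ).isPreconnected hm (hk.mono s3)
        (fun u hu => by rw [hme u hu, hke u (s3 hu)]) hzz hzρ
      rw [(hl z hz).2.2] at e1
      rw [(hl z' hz').2.2] at e2
      linear_combination e2 - e1 - e3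
    have hnhds : Metric.closedBall z ρ ∈ 𝓝 z := Metric.closedBall_mem_nhds z hρ0
    have hmz : ContinuousAt (fun u => m u + (l z z - m z)) z :=
      (hm.continuousAt hnhds).add continuousAt_const
    refine hmz.continuousWithinAt.congr_of_eventuallyEq ?_ (heq z hz hzρ)
    filter_upwards [self_mem_nhdsWithin, mem_nhdsWithin_of_mem_nhds hnhds] with u hu hu'
    exact heq u hu hu'
  have hcont := Metric.continuous_infDist_pt X
  have hthick : {z | Metric.infDist z X < δ / 2} = Metric.thickening (δ / 2) X := by
    ext z
    exact (Metric.mem_thickening_iff_infDist_lt hXne).symm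
  refine not_hasLog_of_frontier (K := {z | Metric.infDist z X = δ / 2})
    (Q := {z | Metric.infDist z X < δ / 2}) (a := e) (h := fun _ => 1) ?_
    (isOpen_lt hcont continuous_const) (by rw [hthick]; exact h.isCompact.isBounded.thickening)
    (frontier_lt_subset_eq hcont continuous_const)
    (by rw [mem_ofPred_eq, Metric.infDist_zero_of_mem heX]; positivity)
    continuousOn_const (fun _ _ => one_ne_zero) ?_
  · refine Metric.isCompact_of_isClosed_isBounded (isClosed_eq hcont continuous_const)
      ((h.isCompact.isBounded.thickening (δ := δ)).subset fun z hz => ?_)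
    rw [Metric.mem_thickening_iff_infDist_lt hXne, show Metric.infDist z X = δ / 2 from hz]
    linarith
  · have hsub : {z | Metric.infDist z X = δ / 2} ⊆ D := by
      intro z hz
      have hz' : Metric.infDist z X = δ / 2 := hz
      refine ⟨fun hzX => ?_, by linarith⟩
      rw [Metric.infDist_zero_of_mem hzX] at hz'
      linarith
    refine ⟨fun z => l z z, hLc.mono hsub, fun z hz => ?_⟩
    change Complex.exp (l z z) = (z - e) / 1
    rw [div_one, (hl z (hsub hz)).2.1 z (hYc z (hsub hz)).2.2.1]

end RootedArcs

namespace IsArcWithEndpoints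

variable {α : Type*} [TopologicalSpace α] {B : Set α} {a b c d : α}

lemma isCompact (h : IsArcWithEndpoints B a b) : IsCompact B := by
  obtain ⟨f, hf, -, rfl, -, -⟩ := h
  exact isCompact_Icc.image_of_continuousOn hf

lemma isPreconnected (h : IsArcWithEndpoints B a b) : IsPreconnected B := by
  obtain ⟨f, hf, -, rfl, -, -⟩ := h
  exact isPreconnected_Icc.image _ hf

lemma left_mem (h : IsArcWithEndpoints B a b) : a ∈ B := by
  obtain ⟨f, -, -, rfl, rfl, -⟩ := h
  exact mem_image_of_mem f (left_mem_Icc.2 zero_le_one)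

lemma right_mem (h : IsArcWithEndpoints B a b) : b ∈ B := by
  obtain ⟨f, -, -, rfl, -, rfl⟩ := h
  exact mem_image_of_mem f (right_mem_Icc.2 zero_le_one)

/-- An arc has a continuous injective coordinate. -/
lemma exists_coordinate [T2Space α] (h : IsArcWithEndpoints B a b) :
    ∃ f : ℝ → α, ∃ g : α → ℝ, ContinuousOn f (Icc 0 1) ∧ ContinuousOn g B ∧ MapsTo f (Icc 0 1) B ∧
      MapsTo g B (Icc 0 1) ∧ (∀ t ∈ Icc (0 : ℝ) 1, g (f t) = t) ∧ (∀ x ∈ B, f (g x) = x) ∧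
      f 0 = a ∧ f 1 = b := by
  obtain ⟨f, hf, hinj, rfl, h0, h1⟩ := h
  have hgf : ∀ t ∈ Icc (0 : ℝ) 1, Function.invFunOn f (Icc 0 1) (f t) = t :=
    hinj.leftInvOn_invFunOn
  refine ⟨f, Function.invFunOn f (Icc 0 1), hf, ?_, mapsTo_image _ _, ?_, hgf, ?_, h0, h1⟩
  · rw [continuousOn_iff_isClosed]
    intro t ht
    refine ⟨f '' (Icc 0 1 ∩ t),
      ((isCompact_Icc.inter_right ht).image_of_continuousOn (hf.mono inter_subset_left)).isClosed,
      ?_⟩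
    ext x
    constructor
    · rintro ⟨hxt, s, hs, rfl⟩
      rw [mem_preimage, hgf s hs] at hxt
      exact ⟨⟨s, ⟨hs, hxt⟩, rfl⟩, s, hs, rfl⟩
    · rintro ⟨⟨s, ⟨hs, hst⟩, rfl⟩, hx⟩
      exact ⟨by rwa [mem_preimage, hgf s hs], hx⟩
  · rintro _ ⟨t, ht, rfl⟩
    rwa [hgf t ht]
  · rintro _ ⟨t, ht, rfl⟩
    rw [hgf t ht]

/-- A connected subset of an arc which contains both endpoints is the whole arc. -/
lemma subset_of_isPreconnected [T2Space α] (h : IsArcWithEndpoints B a b) {S : Set α} (hS : S ⊆ B)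
    (hSp : IsPreconnected S) (ha : a ∈ S) (hb : b ∈ S) : B ⊆ S := by
  obtain ⟨f, g, -, hg, -, hgm, hgf, hfg, rfl, rfl⟩ := h.exists_coordinate
  have hp := (hSp.image g (hg.mono hS)).ordConnected
  intro x hx
  obtain ⟨s, hs, hsx⟩ := hp.out (mem_image_of_mem g ha) (mem_image_of_mem g hb)
    (by rw [hgf 0 (by simp), hgf 1 (by simp)]; exact hgm hx)
  rwa [← hfg x hx, ← hsx, hfg s (hS hs)]

lemma left_eq_or_eq [T2Space α] (h : IsArcWithEndpoints B a b) (h' : IsArcWithEndpoints B c d) :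
    c = a ∨ c = b := by
  by_contra! hcon
  obtain ⟨f, g, hf, -, hfm, hgm, hgf, hfg, h0, h1⟩ := h'.exists_coordinate
  have hsub : f '' Ioc 0 1 ⊆ B := (hfm.mono_left Ioc_subset_Icc_self).image_subset
  have hmem : ∀ x ∈ B, x ≠ c → x ∈ f '' Ioc 0 1 := by
    intro x hx hxc
    refine ⟨g x, ⟨(hgm hx).1.lt_of_ne' fun h' => hxc ?_, (hgm hx).2⟩, hfg x hx⟩
    rw [← hfg x hx, h', h0]
  have hc := h.subset_of_isPreconnected hsub
    (isPreconnected_Ioc.image f (hf.mono Ioc_subset_Icc_self)) (hmem a h.left_mem hcon.1.symm)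
    (hmem b h.right_mem hcon.2.symm) h'.left_mem
  obtain ⟨t, ht, htc⟩ := hc
  have := hgf t (Ioc_subset_Icc_self ht)
  rw [htc, ← h0, hgf 0 (by simp)] at this
  exact ht.1.ne this

lemma image {β : Type*} [TopologicalSpace β] (h : IsArcWithEndpoints B a b) (φ : α ≃ₜ β) :
    IsArcWithEndpoints (φ '' B) (φ a) (φ b) := by
  obtain ⟨f, hf, hinj, rfl, rfl, rfl⟩ := h
  exact ⟨φ ∘ f, φ.continuous.comp_continuousOn hf, φ.injective.comp_injOn hinj,
    image_comp _ _ _, rfl, rfl⟩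

lemma hasLog {B : Set ℂ} {a b : ℂ} (h : IsArcWithEndpoints B a b) {c : ℂ} (hc : c ∉ B) :
    HasLog B (fun z => z - c) := by
  obtain ⟨f, g, hf, hg, hfm, hgm, -, hfg, -, -⟩ := h.exists_coordinate
  have hF : Continuous fun w : ℂ => f (projIcc (0 : ℝ) 1 zero_le_one w.re) - c :=
    (hf.domRestrict.comp (continuous_projIcc.comp Complex.continuous_re)).sub continuous_const
  obtain ⟨l, hl, he⟩ := exists_global_log hF (fun w h0 => hc (by
    rw [← sub_eq_zero.1 h0]; exact hfm (projIcc (0 : ℝ) 1 zero_le_one w.re).2))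
  refine ⟨fun z => l (g z), hl.comp_continuousOn (Complex.continuous_ofReal.comp_continuousOn hg),
    fun z hz => ?_⟩
  rw [he, Complex.ofReal_re, projIcc_of_mem zero_le_one (hgm hz), hfg z hz]

end IsArcWithEndpoints

section Transfer

variable {α β : Type*} [TopologicalSpace α] [TopologicalSpace β] {X : Set α}

lemma IsDendroid.image (h : IsDendroid X) (φ : α ≃ₜ β) : IsDendroid (φ '' X) := by
  obtain ⟨h1, h2, h3, h4⟩ := h
  refine ⟨h1.image φ.continuous, h2.image φ φ.continuous.continuousOn, ?_, ?_⟩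
  · intro K L hK hL hKc hKp hLc hLp
    have hsub : ∀ S ⊆ φ '' X, φ.symm '' S ⊆ X := by
      rintro S hS _ ⟨y, hy, rfl⟩
      obtain ⟨x, hx, rfl⟩ := hS hy
      rwa [φ.symm_apply_apply]
    have := h3 (φ.symm '' K) (φ.symm '' L) (hsub K hK) (hsub L hL)
      (hKc.image φ.symm.continuous) (hKp.image _ φ.symm.continuous.continuousOn)
      (hLc.image φ.symm.continuous) (hLp.image _ φ.symm.continuous.continuousOn)
    rwa [← image_inter φ.symm.injective, Homeomorph.isPreconnected_image] at this
  · rintro _ ⟨x, hx, rfl⟩ _ ⟨y, hy, rfl⟩ hne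
    obtain ⟨B, hB, hBa⟩ := h4 x hx y hy fun h' => hne (congrArg φ h')
    exact ⟨φ '' B, image_mono hB, hBa.image φ⟩

lemma apply_mem_endpoints (φ : α ≃ₜ β) {e : α} (he : e ∈ Endpoints X) :
    φ e ∈ Endpoints (φ '' X) := by
  refine ⟨mem_image_of_mem φ he.1, ?_⟩
  rintro B hB ⟨a, b, hab⟩ heB
  have hBB : φ '' (φ.symm '' B) = B := φ.toEquiv.image_symm_image B
  obtain ⟨d, hd⟩ := he.2 (φ.symm '' B) (by
    rw [← φ.toEquiv.symm_image_image X]; exact image_mono hB) ⟨_, _, hab.image φ.symm⟩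
    ⟨φ e, heB, φ.symm_apply_apply e⟩
  refine ⟨φ d, ?_⟩
  have := hd.image φ
  rwa [hBB] at this

lemma endpoints_image (φ : α ≃ₜ β) : Endpoints (φ '' X) = φ '' Endpoints X := by
  refine Subset.antisymm (fun y hy => ?_) (image_subset_iff.2 fun e he => apply_mem_endpoints φ he)
  have := apply_mem_endpoints φ.symm hy
  rw [show φ.symm '' (φ '' X) = X from φ.toEquiv.symm_image_image X] at this
  exact ⟨_, this, φ.apply_symm_apply y⟩

end Transfer

/-- If the terms `A (xs n)` converge to `A x` in the Hausdorff distance whenever `xs n` converges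
to `x` in `X`, then nearby points have nearby sets. -/
lemma eventually_subset_thickening {α : Type*} [PseudoMetricSpace α] {X : Set α} {A : α → Set α}
    (hA : ∀ (xs : ℕ → α) (x : α), (∀ n, xs n ∈ X) → x ∈ X → Tendsto xs atTop (𝓝 x) →
      Tendsto (fun n => Metric.hausdorffEDist (A (xs n)) (A x)) atTop (𝓝 0))
    {x : α} (hx : x ∈ X) {ε : ℝ} (hε : 0 < ε) :
    ∀ᶠ y in 𝓝[X] x, A y ⊆ Metric.thickening ε (A x) ∧ A x ⊆ Metric.thickening ε (A y) := by
  classical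
  rw [eventually_iff_seq_eventually]
  intro xs hxs
  rw [tendsto_nhdsWithin_iff] at hxs
  obtain ⟨hlim, hmem⟩ := hxs
  have heq : (fun n => if xs n ∈ X then xs n else x) =ᶠ[atTop] xs :=
    hmem.mono fun n hn => if_pos hn
  have := hA (fun n => if xs n ∈ X then xs n else x) x (fun n => by split_ifs <;> assumption) hx
    (hlim.congr' heq.symm)
  filter_upwards [heq, this.eventually_lt_const (ENNReal.ofReal_pos.2 hε)] with n hn hd
  rw [hn] at hd
  refine ⟨fun u hu => ?_, fun u hu => ?_⟩
  · obtain ⟨v, hv, huv⟩ := Metric.exists_edist_lt_of_hausdorffEDist_lt hu hd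
    exact Metric.mem_thickening_iff.2 ⟨v, hv, edist_lt_ofReal.1 huv⟩
  · rw [Metric.hausdorffEDist_comm] at hd
    obtain ⟨v, hv, huv⟩ := Metric.exists_edist_lt_of_hausdorffEDist_lt hu hd
    exact Metric.mem_thickening_iff.2 ⟨v, hv, edist_lt_ofReal.1 huv⟩

namespace IsDendroid

variable {α : Type*} [TopologicalSpace α] {X : Set α}

lemma isPreconnected_inter {K L : Set α} (h : IsDendroid X) (hK : K ⊆ X) (hL : L ⊆ X)
    (hKc : IsCompact K) (hKp : IsPreconnected K) (hLc : IsCompact L) (hLp : IsPreconnected L) :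
    IsPreconnected (K ∩ L) := by
  rcases K.eq_empty_or_nonempty with rfl | hKn
  · rw [empty_inter]; exact isPreconnected_empty
  rcases L.eq_empty_or_nonempty with rfl | hLn
  · rw [inter_empty]; exact isPreconnected_empty
  exact h.2.2.1 K L hK hL hKc ⟨hKn, hKp⟩ hLc ⟨hLn, hLp⟩

/-- An arc in a dendroid lies in every continuum containing its endpoints. -/
lemma arc_subset [T2Space α] (h : IsDendroid X) {B L : Set α} {a b : α}
    (hB : IsArcWithEndpoints B a b) (hBX : B ⊆ X) (hL : L ⊆ X) (hLc : IsCompact L)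
    (hLp : IsPreconnected L) (ha : a ∈ L) (hb : b ∈ L) : B ⊆ L :=
  (hB.subset_of_isPreconnected inter_subset_left
    (h.isPreconnected_inter hBX hL hB.isCompact hB.isPreconnected hLc hLp)
    ⟨hB.left_mem, ha⟩ ⟨hB.right_mem, hb⟩).trans inter_subset_right

end IsDendroid

/-- A smooth plane dendroid gives rise to a system of rooted arcs. -/
lemma IsDendroid.rootedArcs {X : Set ℂ} {p : ℂ} {A : ℂ → Set ℂ} (h : IsDendroid X) (hp : p ∈ X)
    (hAp : A p = {p}) (hA : ∀ x ∈ X, x ≠ p → A x ⊆ X ∧ IsArcWithEndpoints (A x) x p)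
    (hlim : ∀ (xs : ℕ → ℂ) (x : ℂ), (∀ n, xs n ∈ X) → x ∈ X → Tendsto xs atTop (𝓝 x) →
      Tendsto (fun n => Metric.hausdorffEDist (A (xs n)) (A x)) atTop (𝓝 0))
    (hE : HereditarilyDisconnected (Endpoints X)) : RootedArcs X (Endpoints X) p A := by
  have hcases : ∀ x ∈ X, A x = {x} ∧ x = p ∨ x ≠ p ∧ A x ⊆ X ∧ IsArcWithEndpoints (A x) x p := by
    intro x hx
    by_cases hxp : x = p
    · exact Or.inl ⟨by rw [hxp, hAp], hxp⟩
    · exact Or.inr ⟨hxp, hA x hx hxp⟩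
  have hsub : ∀ x ∈ X, A x ⊆ X := by
    intro x hx
    rcases hcases x hx with ⟨h1, -⟩ | ⟨-, h1, -⟩
    · rwa [h1, singleton_subset_iff]
    · exact h1
  have hcpt : ∀ x ∈ X, IsCompact (A x) := by
    intro x hx
    rcases hcases x hx with ⟨h1, -⟩ | ⟨-, -, h1⟩
    · rw [h1]; exact isCompact_singleton
    · exact h1.isCompact
  have hpre : ∀ x ∈ X, IsPreconnected (A x) := by
    intro x hx
    rcases hcases x hx with ⟨h1, -⟩ | ⟨-, -, h1⟩
    · rw [h1]; exact isPreconnected_singleton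
    · exact h1.isPreconnected
  have hself : ∀ x ∈ X, x ∈ A x := by
    intro x hx
    rcases hcases x hx with ⟨h1, -⟩ | ⟨-, -, h1⟩
    · rw [h1]; rfl
    · exact h1.left_mem
  have hroot : ∀ x ∈ X, p ∈ A x := by
    intro x hx
    rcases hcases x hx with ⟨h1, rfl⟩ | ⟨-, -, h1⟩
    · rw [h1]; rfl
    · exact h1.right_mem
  have htrans : ∀ x ∈ X, ∀ y ∈ A x, A y ⊆ A x := by
    intro x hx y hy
    rcases hcases y (hsub x hx hy) with ⟨h1, -⟩ | ⟨-, h1, h2⟩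
    · rwa [h1, singleton_subset_iff]
    · exact h.arc_subset h2 h1 (hsub x hx) (hcpt x hx) (hpre x hx) hy (hroot x hx)
  refine ⟨h.1, hp, hsub, hcpt, hpre, hself, hroot,
    fun x hx ε hε => (eventually_subset_thickening hlim hx hε).mono fun y hy => hy.1,
    fun x hx ε hε => (eventually_subset_thickening hlim hx hε).mono fun y hy => hy.2,
    fun x hx a ha => ?_,
    fun x hx y hy => h.isPreconnected_inter (hsub x hx) (hsub y hy) (hcpt x hx) (hpre x hx)
      (hcpt y hy) (hpre y hy),
    htrans, fun x hx y hy hxy => ?_, fun e he => he.1, fun e he x hx hex => ?_,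
    fun x hx y hy => ?_, hE⟩
  · rcases hcases x hx with ⟨h1, -⟩ | ⟨-, -, h1⟩
    · rw [h1] at ha ⊢
      refine (HasLog.const (sub_ne_zero.2 (Ne.symm ha))).congr fun z hz => ?_
      rw [mem_singleton_iff.1 hz]
    · exact h1.hasLog ha
  · have hyX := hsub x hx hy
    have heq : A x = A y := (htrans y hyX x hxy).antisymm (htrans x hx y hy)
    rcases hcases x hx with ⟨h1, -⟩ | ⟨hxp, -, h1⟩
    · rw [h1] at hy; exact (mem_singleton_iff.1 hy).symm
    · rcases hcases y hyX with ⟨h2, -⟩ | ⟨-, -, h2⟩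
      · rw [h2] at hxy; exact hxy
      · rw [← heq] at h2
        exact (h2.left_eq_or_eq h1).resolve_right hxp
  · rcases hcases x hx with ⟨h1, -⟩ | ⟨hxp, h1, h2⟩
    · rw [h1] at hex; exact Or.inl hex
    · obtain ⟨d, hd⟩ := he.2 (A x) h1 ⟨_, _, h2⟩ hex
      exact h2.left_eq_or_eq hd
  · by_cases hxy : x = y
    · subst hxy
      exact ⟨{x}, isCompact_singleton, isPreconnected_singleton, rfl, rfl,
        singleton_subset_iff.2 (Or.inl (hself x hx.1)), disjoint_singleton_left.2 hx.2⟩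
    obtain ⟨B, hB, hBa⟩ := h.2.2.2 x hx.1 y hy.1 hxy
    refine ⟨B, hBa.isCompact, hBa.isPreconnected, hBa.left_mem, hBa.right_mem,
      h.arc_subset hBa hB (union_subset (hsub x hx.1) (hsub y hy.1))
        ((hcpt x hx.1).union (hcpt y hy.1)) ((hpre x hx.1).union p (hroot x hx.1) (hroot y hy.1)
          (hpre y hy.1)) (Or.inl (hself x hx.1)) (Or.inr (hself y hy.1)), ?_⟩
    rw [disjoint_left]
    intro e heB he
    obtain ⟨d, hd⟩ := he.2 B hB ⟨_, _, hBa⟩ heB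
    rcases hBa.left_eq_or_eq hd with rfl | rfl
    · exact hx.2 he
    · exact hy.2 he

/-- Two endpoints of a smooth plane dendroid other than the initial point are separated by a clopen
set of endpoints. -/
lemma exists_isClopenIn_endpoints {X : Set Plane} {p : Plane} (hX : IsDendroid X)
    (hp : DendroidSmoothAt X p) (hhd : HereditarilyDisconnected (Endpoints X)) {e e' : Plane}
    (he : e ∈ Endpoints X \ {p}) (he' : e' ∈ Endpoints X \ {p}) (hne : e ≠ e') :
    ∃ B, IsClopenIn (Endpoints X) B ∧ e ∈ B ∧ e' ∉ B := by
  obtain ⟨hpX, A, hAp, hA, hlim⟩ := hp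
  let ψ : Plane ≃ᵢ ℂ := Complex.orthonormalBasisOneI.repr.symm.toIsometryEquiv
  let φ : Plane ≃ₜ ℂ := ψ.toHomeomorph
  have hsymm : ∀ x, φ.symm (φ x) = x := φ.symm_apply_apply
  have hroot : RootedArcs (φ '' X) (Endpoints (φ '' X)) (φ p) (fun z => φ '' A (φ.symm z)) := by
    refine (hX.image φ).rootedArcs (mem_image_of_mem φ hpX) ?_ ?_ ?_ ?_
    · rw [hsymm, hAp, image_singleton]
    · rintro _ ⟨x, hx, rfl⟩ hxp
      rw [hsymm]
      obtain ⟨h1, h2⟩ := hA x hx fun h' => hxp (congrArg φ h')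
      exact ⟨image_mono h1, h2.image φ⟩
    · intro xs x hxs hx hlim'
      have hmem : ∀ z ∈ φ '' X, φ.symm z ∈ X := by
        rintro _ ⟨x, hx, rfl⟩
        rwa [hsymm]
      have := hlim (fun n => φ.symm (xs n)) (φ.symm x) (fun n => hmem _ (hxs n)) (hmem _ hx)
        ((φ.symm.continuous.tendsto x).comp hlim')
      exact this.congr fun n => (Metric.hausdorffEDist_image ψ.isometry).symm
    · rw [endpoints_image]
      intro S hS hSp
      have h1 : (φ ⁻¹' S).Subsingleton := by
        refine hhd _ (fun x hx => ?_) ?_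
        · obtain ⟨y, hy, hyx⟩ := hS hx
          rwa [← φ.injective hyx]
        · rwa [φ.isPreconnected_preimage]
      intro x hx y hy
      exact φ.symm.injective (h1 (by rwa [mem_preimage, φ.apply_symm_apply])
        (by rwa [mem_preimage, φ.apply_symm_apply]))
  obtain ⟨K, hK, hKE, hK'⟩ := hroot.exists_separator (apply_mem_endpoints φ he.1)
    (apply_mem_endpoints φ he'.1) (φ.injective.ne he.2) (φ.injective.ne he'.2)
    (φ.injective.ne hne)
  have hKo : IsOpen Kᶜ := hK.isClosed.isOpen_compl
  set U := connectedComponentIn Kᶜ (φ e) with hU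
  refine ⟨Endpoints X ∩ φ ⁻¹' U, ⟨inter_subset_left,
    ⟨_, hKo.connectedComponentIn.preimage φ.continuous, rfl⟩,
    φ ⁻¹' closure U, isClosed_closure.preimage φ.continuous, ?_⟩,
    ⟨he.1, mem_connectedComponentIn (disjoint_right.1 hKE (apply_mem_endpoints φ he.1))⟩,
    fun h => hK' h.2⟩
  refine (inter_subset_inter_right _ (preimage_mono subset_closure)).antisymm ?_
  rintro x ⟨hx, hxU⟩
  refine ⟨hx, ?_⟩
  by_contra hxn
  refine frontier_connectedComponentIn_subset hKo (φ e)
    ⟨hxU, fun h' => hxn (interior_subset (s := U) h')⟩ ?_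
  exact disjoint_right.1 hKE (apply_mem_endpoints φ hx)

/-- Theorem 12. -/
theorem stmt_14 (X : Set Plane) (p : Plane) (hX : IsDendroid X) (hp : DendroidSmoothAt X p)
    (hhd : HereditarilyDisconnected (Endpoints X)) :
    (∀ e ∈ Endpoints X \ {p}, ∀ e' ∈ Endpoints X \ {p}, e ≠ e' →
        e' ∉ quasicomponentIn (Endpoints X) e) ∧
    (∀ e ∈ Endpoints X \ {p}, ∀ e' ∈ Endpoints X \ {p}, e ≠ e' →
        ∃ A : Set Plane, IsClopenIn (Endpoints X \ {p}) A ∧ e ∈ A ∧ e' ∉ A) := by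
  refine ⟨fun e he e' he' hne hq => ?_, fun e he e' he' hne => ?_⟩
  · obtain ⟨B, hB, h1, h2⟩ := exists_isClopenIn_endpoints hX hp hhd he he' hne
    exact h2 (hq.2 B hB h1)
  · obtain ⟨B, ⟨-, ⟨U, hU, hBU⟩, C, hC, hBC⟩, h1, h2⟩ :=
      exists_isClopenIn_endpoints hX hp hhd he he' hne
    refine ⟨B \ {p}, ⟨?_, ⟨U, hU, ?_⟩, C, hC, ?_⟩, ⟨h1, he.2⟩, fun h => h2 h.1⟩
    · rw [hBU]
      exact sdiff_subset_sdiff_left inter_subset_left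
    · rw [hBU, inter_sdiff_right_comm]
    · rw [hBC, inter_sdiff_right_comm]
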